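/- For q = 8, for q = 9, and for every prime power q ≥ 16, there exists an infinite sequence of F_q-linear codes C_j ⊆ F_q^{n_j} with n_j → ∞ such that the three families (C_j), (C_j^⊥) and (C_j^{*2}) are simultaneously asymptotically good; that is, there is a constant ε > 0 with dim C_j ≥ ε·n_j, d_min(C_j) ≥ ε·n_j, dim C_j^⊥ ≥ ε·n_j, d_min(C_j^⊥) ≥ ε·n_j, dim C_j^{*2} ≥ ε·n_j, and d_min(C_j^{*2}) ≥ ε·n_j for all j. -/

import Mathlib

open Filter

/-- The dual of a linear code with respect to the standard bilinear form on `F_q^n`. -/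
def dualCode {F : Type} [Field F] {n : ℕ} (C : Submodule F (Fin n → F)) :
    Submodule F (Fin n → F) where
  carrier := {x | ∀ c ∈ C, ∑ i, x i * c i = 0}
  zero_mem' := by intro c hc; simp
  add_mem' := by
    intro a b ha hb c hc
    simp only [Pi.add_apply, add_mul, Finset.sum_add_distrib, ha c hc, hb c hc, add_zero]
  smul_mem' := by
    intro r x hx c hc
    simp only [Pi.smul_apply, smul_eq_mul, mul_assoc, ← Finset.mul_sum, hx c hc, mul_zero]

/-- The square `C^{*2}` of a linear code: the span of all coordinatewise products of
two codewords. -/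
def codeSq {F : Type} [Field F] {n : ℕ} (C : Submodule F (Fin n → F)) :
    Submodule F (Fin n → F) :=
  Submodule.span F {x | ∃ a ∈ C, ∃ b ∈ C, x = a * b}

set_option linter.unusedSectionVars false

open PowerSeries in
/-- Spaces of functions with bounded poles, recorded through their power series expansions
at a finite set of points. -/
structure FunctionSpaces (κ Pt : Type) [Field κ] [Fintype Pt]
    (L : ℕ → Submodule κ (Pt → PowerSeries κ)) (g0 : ℕ) (σ : κ →+* κ) : Prop where
  mul_mem : ∀ s t F H, F ∈ L s → H ∈ L t → F * H ∈ L (s + t)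
  mono : ∀ t, L t ≤ L (t + 1)
  X_mul_mem : ∀ t F, F ∈ L t → (fun y => (X : PowerSeries κ) * F y) ∈ L (t + 1)
  mem_of_X_mul : ∀ t F, (fun y => (X : PowerSeries κ) * F y) ∈ L (t + 1) → F ∈ L t
  apply_ne_zero : ∀ t F, F ∈ L t → F ≠ 0 → ∀ y, F y ≠ 0
  sum_le : ∀ t F, F ∈ L t → F ≠ 0 → ∀ μ : Pt → ℕ, (∀ y, (X : PowerSeries κ) ^ μ y ∣ F y) →
    ∑ y, μ y ≤ t * Fintype.card Pt
  le_finrank : ∀ t, t * Fintype.card Pt ≤ Module.finrank κ (L t) + g0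
  cancel : ∀ s H, H ∈ L s → H ≠ 0 → ∃ (p : PowerSeries κ) (e : ℕ), 1 ≤ e ∧
    constantCoeff p = 1 ∧ (∀ t F, F ∈ L t → (fun y => p * F y) ∈ L (t + e)) ∧
    ∀ t F E, F ∈ L (t + e) → E ∈ L (t + s) → (∀ y, H y * F y = p * E y) →
      ∃ F' ∈ L t, ∀ y, F y = p * F' y
  frob_mem : ∀ t F, F ∈ L t → (fun y => PowerSeries.map σ (F y)) ∈ L t

namespace FunctionSpaces

open PowerSeries Module

variable {κ Pt : Type} [Field κ] [Fintype Pt]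
  {L : ℕ → Submodule κ (Pt → PowerSeries κ)} {g0 : ℕ} {σ : κ →+* κ}

/-- The subspace of `L t` of tuples vanishing to order at least `ν`. -/
def sub (L : ℕ → Submodule κ (Pt → PowerSeries κ)) (t : ℕ) (ν : Pt → ℕ) :
    Submodule κ (Pt → PowerSeries κ) where
  carrier := {F | F ∈ L t ∧ ∀ y, (X : PowerSeries κ) ^ ν y ∣ F y}
  zero_mem' := ⟨zero_mem _, fun y => dvd_zero _⟩
  add_mem' := fun ha hb => ⟨add_mem ha.1 hb.1, fun y => dvd_add (ha.2 y) (hb.2 y)⟩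
  smul_mem' := fun c F hF => ⟨Submodule.smul_mem _ _ hF.1, fun y => by
    rw [Pi.smul_apply, PowerSeries.smul_eq_C_mul]; exact (hF.2 y).mul_left _⟩

lemma mem_sub {t : ℕ} {ν : Pt → ℕ} {F : Pt → PowerSeries κ} :
    F ∈ sub L t ν ↔ F ∈ L t ∧ ∀ y, (X : PowerSeries κ) ^ ν y ∣ F y := Iff.rfl

lemma sub_zero (t : ℕ) : sub L t 0 = L t := by
  ext F; simp [mem_sub]

/-- Coefficients at prescribed orders. -/
noncomputable def coeffAt (ν : Pt → ℕ) : (Pt → PowerSeries κ) →ₗ[κ] (Pt → κ) :=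
  LinearMap.pi fun y => (PowerSeries.coeff (R := κ) (ν y)) ∘ₗ LinearMap.proj y

lemma coeffAt_apply (ν : Pt → ℕ) (F : Pt → PowerSeries κ) (y : Pt) :
    coeffAt ν F y = PowerSeries.coeff (ν y) (F y) := rfl

lemma X_pow_succ_dvd_iff {k : ℕ} {f : PowerSeries κ} (h : (X : PowerSeries κ) ^ k ∣ f) :
    (X : PowerSeries κ) ^ (k + 1) ∣ f ↔ PowerSeries.coeff k f = 0 := by
  rw [PowerSeries.X_pow_dvd_iff] at h ⊢
  constructor
  · intro H; exact H k (Nat.lt_succ_self k)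
  · intro H m hm
    rcases Nat.lt_succ_iff_lt_or_eq.mp hm with h1 | h1
    · exact h m h1
    · rw [h1, H]

lemma X_pow_mono_dvd {a b : ℕ} (h : a ≤ b) {f : PowerSeries κ}
    (hf : (X : PowerSeries κ) ^ b ∣ f) : (X : PowerSeries κ) ^ a ∣ f :=
  (pow_dvd_pow _ h).trans hf

lemma finiteDimensional (h : FunctionSpaces κ Pt L g0 σ) (t : ℕ) :
    FiniteDimensional κ (L t) := by
  classical
  set N := t * Fintype.card Pt + 1
  let f : (L t) →ₗ[κ] (Pt → Fin N → κ) :=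
    (LinearMap.pi fun y => LinearMap.pi fun i : Fin N =>
      (PowerSeries.coeff (R := κ) i) ∘ₗ LinearMap.proj y) ∘ₗ (L t).subtype
  refine FiniteDimensional.of_injective f ?_
  rw [injective_iff_map_eq_zero]
  rintro ⟨F, hF⟩ h0
  by_contra hne
  have hF0 : F ≠ 0 := fun hc => hne (by simp [hc])
  have hy : ∀ y, (X : PowerSeries κ) ^ N ∣ F y := by
    intro y
    rw [PowerSeries.X_pow_dvd_iff]
    intro m hm
    exact congrFun (congrFun h0 y) ⟨m, hm⟩
  rcases isEmpty_or_nonempty Pt with he | ⟨⟨y⟩⟩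
  · exact hF0 (Subsingleton.elim _ _)
  have := h.sum_le t F hF hF0 (fun _ => N) hy
  have h1 : N ≤ ∑ _y : Pt, N := Finset.single_le_sum (f := fun _ : Pt => N)
    (fun _ _ => Nat.zero_le _) (Finset.mem_univ y)
  omega

lemma finiteDimensional_sub (h : FunctionSpaces κ Pt L g0 σ) (t : ℕ) (ν : Pt → ℕ) :
    FiniteDimensional κ (sub L t ν) := by
  have := h.finiteDimensional t
  exact Submodule.finiteDimensional_of_le (S₂ := L t) (fun F hF => hF.1)

/-- Degree of the pair `(t, ν)`. -/
def deg (t : ℕ) (ν : Pt → ℕ) : ℤ := t * Fintype.card Pt - ∑ y, (ν y : ℤ)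

/-- The defect `deg - dim`. -/
noncomputable def defect (L : ℕ → Submodule κ (Pt → PowerSeries κ)) (t : ℕ) (ν : Pt → ℕ) : ℤ :=
  deg t ν - finrank κ (sub L t ν)

lemma deg_add (s t : ℕ) (μ ν : Pt → ℕ) : deg (s + t) (μ + ν) = deg s μ + deg t ν := by
  simp [deg, Finset.sum_add_distrib]; ring

lemma finrank_sub_add_indicator (h : FunctionSpaces κ Pt L g0 σ) [DecidableEq Pt]
    (t : ℕ) (ν : Pt → ℕ) (W : Finset Pt) :
    finrank κ (sub L t ν) ≤
      finrank κ (sub L t (ν + fun y => if y ∈ W then 1 else 0)) + W.card ∧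
    (finrank κ (sub L t ν) =
      finrank κ (sub L t (ν + fun y => if y ∈ W then 1 else 0)) + W.card →
      ∀ v : Pt → κ, ∃ F ∈ sub L t ν, ∀ y ∈ W, coeffAt ν F y = v y) := by
  have := h.finiteDimensional_sub t ν
  let f : sub L t ν →ₗ[κ] (W → κ) :=
    (LinearMap.pi fun y : W => LinearMap.proj (y : Pt)) ∘ₗ (coeffAt ν) ∘ₗ (sub L t ν).subtype
  have hf : ∀ (F : sub L t ν) (y : W), f F y = PowerSeries.coeff (ν y) ((F : Pt → _) y) :=
    fun F y => rfl
  have hker : (LinearMap.ker f).map (sub L t ν).subtype =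
      sub L t (ν + fun y => if y ∈ W then 1 else 0) := by
    ext F
    simp only [Submodule.mem_map, LinearMap.mem_ker, Submodule.subtype_apply, Subtype.exists,
      exists_and_right, exists_eq_right]
    constructor
    · rintro ⟨hF, hfF⟩
      refine ⟨hF.1, fun y => ?_⟩
      by_cases hy : y ∈ W
      · simp only [Pi.add_apply, hy, if_true]
        rw [X_pow_succ_dvd_iff (hF.2 y)]
        exact congrFun hfF ⟨y, hy⟩
      · simpa [hy] using hF.2 y
    · intro hF
      have hF' : F ∈ sub L t ν :=
        ⟨hF.1, fun y => X_pow_mono_dvd (by simp) (hF.2 y)⟩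
      refine ⟨hF', funext fun y => ?_⟩
      have := hF.2 y
      simp only [Pi.add_apply, y.2, if_true] at this
      exact (X_pow_succ_dvd_iff (hF'.2 y)).mp this
  have hk : finrank κ (LinearMap.ker f) =
      finrank κ (sub L t (ν + fun y => if y ∈ W then 1 else 0)) := by
    rw [← hker]
    exact (LinearEquiv.finrank_eq (Submodule.equivMapOfInjective _
      (Submodule.injective_subtype _) _))
  have hrn := f.finrank_range_add_finrank_ker
  have hr : finrank κ (LinearMap.range f) ≤ W.card := by
    refine (Submodule.finrank_le _).trans ?_
    simp
  refine ⟨by omega, fun heq v => ?_⟩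
  have hrange : LinearMap.range f = ⊤ := by
    apply Submodule.eq_top_of_finrank_eq
    simp; omega
  obtain ⟨F, hF⟩ := LinearMap.range_eq_top.mp hrange (fun y => v y)
  exact ⟨F, F.2, fun y hy => congrFun hF ⟨y, hy⟩⟩

lemma sub_anti {t : ℕ} {ν μ : Pt → ℕ} (hle : ν ≤ μ) : sub L t μ ≤ sub L t ν :=
  fun _ hF => ⟨hF.1, fun y => X_pow_mono_dvd (hle y) (hF.2 y)⟩

lemma deg_add_indicator [DecidableEq Pt] (t : ℕ) (ν : Pt → ℕ) (W : Finset Pt) :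
    deg t (ν + fun y => if y ∈ W then 1 else 0) = deg t ν - W.card := by
  simp [deg, Finset.sum_add_distrib]; ring

lemma defect_add_indicator (h : FunctionSpaces κ Pt L g0 σ) [DecidableEq Pt]
    (t : ℕ) (ν : Pt → ℕ) (W : Finset Pt) :
    defect L t (ν + fun y => if y ∈ W then 1 else 0) ≤ defect L t ν ∧
    defect L t ν - W.card ≤ defect L t (ν + fun y => if y ∈ W then 1 else 0) := by
  have h1 := (h.finrank_sub_add_indicator t ν W).1
  have := h.finiteDimensional_sub t ν
  have h2 : finrank κ (sub L t (ν + fun y => if y ∈ W then 1 else 0)) ≤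
      finrank κ (sub L t ν) := Submodule.finrank_mono (sub_anti (by intro y; simp))
  simp only [defect, deg_add_indicator]
  omega

lemma defect_anti (h : FunctionSpaces κ Pt L g0 σ) (t : ℕ) {ν μ : Pt → ℕ} (hle : ν ≤ μ) :
    defect L t μ ≤ defect L t ν := by
  classical
  obtain ⟨ρ, rfl⟩ : ∃ ρ, μ = ν + ρ := ⟨μ - ν, by ext y; have : ν y ≤ μ y := hle y; simp; omega⟩
  clear hle
  induction hs : ∑ y, ρ y using Nat.strong_induction_on generalizing ρ with
  | _ k ih =>
  by_cases h0 : ρ = 0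
  · simp [h0]
  obtain ⟨P, hP⟩ : ∃ P, ρ P ≠ 0 := by
    by_contra hc; push Not at hc; exact h0 (funext hc)
  let ρ' : Pt → ℕ := fun y => if y = P then ρ y - 1 else ρ y
  have hρ : ν + ρ = (ν + ρ') + fun y => if y ∈ ({P} : Finset Pt) then 1 else 0 := by
    ext y
    by_cases hy : y = P
    · subst hy; simp [ρ']; omega
    · simp [ρ', hy]
  rw [hρ]
  refine (h.defect_add_indicator t _ {P}).1.trans (ih (∑ y, ρ' y) ?_ ρ' rfl)
  rw [← hs]
  refine Finset.sum_lt_sum (fun y _ => ?_) ⟨P, Finset.mem_univ _, ?_⟩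
  · simp only [ρ']; split_ifs <;> omega
  · simp only [ρ', if_true]; omega

lemma X_mul_inj : Function.Injective (fun (F : Pt → PowerSeries κ) y => (X : PowerSeries κ) * F y) := by
  intro F G hFG
  ext1 y
  exact mul_left_cancel₀ PowerSeries.X_ne_zero (congrFun hFG y)

lemma finrank_sub_shift (h : FunctionSpaces κ Pt L g0 σ) (t : ℕ) (ν : Pt → ℕ) :
    finrank κ (sub L (t + 1) (ν + 1)) = finrank κ (sub L t ν) := by
  let f : (Pt → PowerSeries κ) →ₗ[κ] (Pt → PowerSeries κ) :=
    LinearMap.pi fun y => (LinearMap.mulLeft κ (X : PowerSeries κ)) ∘ₗ LinearMap.proj y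
  have hf : ∀ F y, f F y = X * F y := fun F y => rfl
  have hinj : Function.Injective f := X_mul_inj
  have : sub L (t + 1) (ν + 1) = (sub L t ν).map f := by
    ext F
    constructor
    · rintro ⟨hF, hd⟩
      have : ∀ y, ∃ G, F y = X * G ∧ (X : PowerSeries κ) ^ ν y ∣ G := by
        intro y
        obtain ⟨G, hG⟩ := hd y
        exact ⟨X ^ ν y * G, by rw [hG]; simp [pow_succ]; ring, dvd_mul_right _ _⟩
      choose G hG hGd using this
      refine ⟨G, ⟨h.mem_of_X_mul t G ?_, hGd⟩, ?_⟩
      · convert hF using 1; ext1 y; rw [hG y]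
      · ext1 y; rw [hf, hG y]
    · rintro ⟨G, ⟨hG, hd⟩, rfl⟩
      refine ⟨h.X_mul_mem t G hG, fun y => ?_⟩
      rw [hf]
      obtain ⟨E, hE⟩ := hd y
      exact ⟨E, by rw [hE]; simp [pow_succ]; ring⟩
  rw [this]
  exact (LinearEquiv.finrank_eq (Submodule.equivMapOfInjective _ hinj _)).symm

lemma deg_shift (t k : ℕ) (ν : Pt → ℕ) : deg (t + k) (ν + fun _ => k) = deg t ν := by
  simp [deg, Finset.sum_add_distrib]; ring

lemma defect_shift (h : FunctionSpaces κ Pt L g0 σ) (t k : ℕ) (ν : Pt → ℕ) :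
    defect L (t + k) (ν + fun _ => k) = defect L t ν := by
  have : finrank κ (sub L (t + k) (ν + fun _ => k)) = finrank κ (sub L t ν) := by
    induction k with
    | zero => rw [show (ν + fun _ => 0) = ν from by ext; simp, add_zero]
    | succ k ih =>
      rw [← ih, ← h.finrank_sub_shift (t + k)]
      rfl
  simp [defect, deg_shift, this]

lemma defect_mono (h : FunctionSpaces κ Pt L g0 σ) {s t : ℕ} (hst : s ≤ t) (ν : Pt → ℕ) :
    defect L s ν ≤ defect L t ν := by
  obtain ⟨k, rfl⟩ := Nat.exists_eq_add_of_le hst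
  rw [← h.defect_shift s k ν]
  exact h.defect_anti _ (by intro y; simp)

lemma defect_le (h : FunctionSpaces κ Pt L g0 σ) (t : ℕ) (ν : Pt → ℕ) :
    defect L t ν ≤ g0 := by
  refine (h.defect_anti t (show 0 ≤ ν from fun y => Nat.zero_le _)).trans ?_
  have := h.le_finrank t
  rw [defect, sub_zero]
  simp only [deg, Pi.zero_apply, Nat.cast_zero, Finset.sum_const_zero, _root_.sub_zero]
  zify at this
  linarith

/-- The defect takes a maximal value, attained for all large `t`. -/
lemma exists_genus (h : FunctionSpaces κ Pt L g0 σ) :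
    ∃ γ : ℤ, γ ≤ g0 ∧ (∀ t ν, defect L t ν ≤ γ) ∧
      ∀ ν : Pt → ℕ, ∃ t0, ∀ t, t0 ≤ t → defect L t ν = γ := by
  obtain ⟨γ, ⟨t1, ht1⟩, hγ⟩ := Int.exists_greatest_of_bdd
    (P := fun z => ∃ t, defect L t (0 : Pt → ℕ) = z)
    ⟨g0, by rintro z ⟨t, rfl⟩; exact h.defect_le t 0⟩ ⟨_, 0, rfl⟩
  have hmax : ∀ t ν, defect L t ν ≤ γ := fun t ν =>
    (h.defect_anti t (show 0 ≤ ν from fun y => Nat.zero_le _)).trans (hγ _ ⟨t, rfl⟩)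
  refine ⟨γ, ht1 ▸ h.defect_le t1 0, hmax, fun ν => ?_⟩
  refine ⟨t1 + ∑ y, ν y, fun t ht => le_antisymm (hmax _ _) ?_⟩
  set k := ∑ y, ν y
  calc (γ : ℤ) = defect L t1 (0 : Pt → ℕ) := ht1.symm
    _ = defect L (t1 + k) (0 + fun _ => k) := (h.defect_shift _ _ _).symm
    _ ≤ defect L (t1 + k) ν := h.defect_anti _ (fun y => by
        simp only [Pi.add_apply, Pi.zero_apply, zero_add]
        exact Finset.single_le_sum (fun _ _ => Nat.zero_le _) (Finset.mem_univ y))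
    _ ≤ defect L t ν := h.defect_mono ht ν

/-- Multiplication by a nonzero function. -/
lemma finrank_mul_le (h : FunctionSpaces κ Pt L g0 σ) {s : ℕ} {μ : Pt → ℕ}
    {H : Pt → PowerSeries κ} (hH : H ∈ sub L s μ) (hH0 : H ≠ 0) (t : ℕ) (ν : Pt → ℕ) :
    defect L t ν ≤ defect L (t + s) (ν + μ) := by
  obtain ⟨γ, -, -, hγ⟩ := h.exists_genus
  obtain ⟨p, e, he, hp, hpm, hpd⟩ := h.cancel s H hH.1 hH0
  have hp0 : p ≠ 0 := by rintro rfl; simp at hp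
  have hHy := h.apply_ne_zero s H hH.1 hH0
  let mul : (Pt → PowerSeries κ) → (Pt → PowerSeries κ) →ₗ[κ] (Pt → PowerSeries κ) := fun G =>
    LinearMap.pi fun y => (LinearMap.mulLeft κ (G y)) ∘ₗ LinearMap.proj y
  have hmul : ∀ G F y, mul G F y = G y * F y := fun _ _ _ => rfl
  have hinj : ∀ G : Pt → PowerSeries κ, (∀ y, G y ≠ 0) → Function.Injective (mul G) := by
    intro G hG F F' hFF
    ext1 y
    exact mul_left_cancel₀ (hG y) (congrFun hFF y)
  have hunit : ∀ (k : ℕ) (F : PowerSeries κ),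
      (X : PowerSeries κ) ^ k ∣ p * F → (X : PowerSeries κ) ^ k ∣ F := by
    intro k F hF
    have : IsUnit p := by
      rw [PowerSeries.isUnit_iff_constantCoeff, hp]; exact isUnit_one
    exact (this.dvd_mul_left).mp hF
  have hfin := h.finiteDimensional_sub
  -- the image of multiplication by `H`
  have hmapH : ∀ t, (sub L t ν).map (mul H) ≤ sub L (t + s) (ν + μ) := by
    rintro t _ ⟨F, hF, rfl⟩
    refine ⟨?_, fun y => ?_⟩
    · rw [add_comm]; exact h.mul_mem s t H F hH.1 hF.1
    · rw [hmul, Pi.add_apply, pow_add, mul_comm]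
      exact mul_dvd_mul (hH.2 y) (hF.2 y)
  have hfr : ∀ t, finrank κ ((sub L t ν).map (mul H)) = finrank κ (sub L t ν) := fun t =>
    (LinearEquiv.finrank_eq (Submodule.equivMapOfInjective _ (hinj _ hHy) _)).symm
  have hstep : ∀ t, finrank κ (sub L (t + s) (ν + μ)) + finrank κ (sub L (t + e) ν) ≤
      finrank κ (sub L (t + e + s) (ν + μ)) + finrank κ (sub L t ν) := by
    intro t
    set A := (sub L (t + s) (ν + μ)).map (mul fun _ => p)
    set B := (sub L (t + e) ν).map (mul H)
    have hA : finrank κ A = finrank κ (sub L (t + s) (ν + μ)) :=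
      (LinearEquiv.finrank_eq (Submodule.equivMapOfInjective _ (hinj _ fun _ => hp0) _)).symm
    have hA' : A ≤ sub L (t + e + s) (ν + μ) := by
      rintro _ ⟨F, hF, rfl⟩
      refine ⟨?_, fun y => (hF.2 y).mul_left _⟩
      rw [add_right_comm]
      exact hpm _ _ hF.1
    have hB' := hmapH (t + e)
    have hAB : A ⊓ B ≤ ((sub L t ν).map (mul H)).map (mul fun _ => p) := by
      rintro _ ⟨⟨E, hE, rfl⟩, ⟨F, hF, hFE⟩⟩
      obtain ⟨F', hF', hFF'⟩ := hpd t F E hF.1 hE.1 (fun y => congrFun hFE y)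
      refine ⟨mul H F', ⟨F', ⟨hF', fun y => ?_⟩, rfl⟩, ?_⟩
      · apply hunit; rw [← hFF']; exact hF.2 y
      · rw [← hFE]; ext1 y; simp only [hmul, hFF']; ring
    have hAfin : FiniteDimensional κ A := inferInstance
    have hBfin : FiniteDimensional κ B := inferInstance
    have h1 := Submodule.finrank_sup_add_finrank_inf_eq A B
    have h2 : finrank κ (A ⊔ B : Submodule κ _) ≤ finrank κ (sub L (t + e + s) (ν + μ)) :=
      Submodule.finrank_mono (sup_le hA' hB')
    have h3 : finrank κ (A ⊓ B : Submodule κ _) ≤ finrank κ (sub L t ν) := by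
      refine (Submodule.finrank_mono hAB).trans (le_of_eq ?_)
      rw [← hfr t]
      exact (LinearEquiv.finrank_eq (Submodule.equivMapOfInjective _
        (hinj _ fun _ => hp0) _)).symm
    have h4 : finrank κ B = finrank κ (sub L (t + e) ν) := hfr _
    omega
  have hstep' : ∀ t, defect L (t + e + s) (ν + μ) - defect L (t + e) ν ≤
      defect L (t + s) (ν + μ) - defect L t ν := by
    intro t
    have := hstep t
    simp only [defect, deg_add]
    zify at this
    linarith
  have hiter : ∀ r t, defect L (t + r * e + s) (ν + μ) - defect L (t + r * e) ν ≤
      defect L (t + s) (ν + μ) - defect L t ν := by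
    intro r
    induction r with
    | zero => intro t; simp
    | succ r ih =>
      intro t
      have h1 := ih (t + e)
      have h2 := hstep' t
      rw [show t + (r + 1) * e = t + e + r * e by ring]
      linarith
  obtain ⟨t0, ht0⟩ := hγ ν
  obtain ⟨t1, ht1⟩ := hγ (ν + μ)
  have h1 := hiter (t0 + t1) t
  have h2 : t0 + t1 ≤ (t0 + t1) * e := Nat.le_mul_of_pos_right _ he
  rw [ht0 (t + (t0 + t1) * e) (by omega), ht1 (t + (t0 + t1) * e + s) (by omega)] at h1
  linarith

end FunctionSpaces

namespace FunctionSpaces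

open PowerSeries Module

variable {κ Pt : Type} [Field κ] [Fintype Pt] [DecidableEq Pt]
  {L : ℕ → Submodule κ (Pt → PowerSeries κ)} {g0 : ℕ} {σ : κ →+* κ}

/-- Indicator function of a finite set, with natural number values. -/
def ind (W : Finset Pt) : Pt → ℕ := fun y => if y ∈ W then 1 else 0

lemma sum_ind (W : Finset Pt) : ∑ y, ind W y = W.card := by simp [ind]

lemma exists_ne_zero_of_finrank_sub_pos {t : ℕ} {ν : Pt → ℕ}
    (h0 : 0 < finrank κ (sub L t ν)) : ∃ F ∈ sub L t ν, F ≠ 0 := by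
  have : sub L t ν ≠ ⊥ := by rintro hb; rw [hb, finrank_bot] at h0; exact lt_irrefl _ h0
  exact Submodule.exists_mem_ne_zero_of_ne_bot this

lemma exists_drop (h : FunctionSpaces κ Pt L g0 σ) {t : ℕ} {ν : Pt → ℕ}
    (h0 : 0 < finrank κ (sub L t ν)) :
    ∃ P, finrank κ (sub L t (ν + ind {P})) < finrank κ (sub L t ν) := by
  by_contra hc
  push Not at hc
  have hfin := h.finiteDimensional_sub
  have heq : ∀ P, sub L t (ν + ind {P}) = sub L t ν := fun P =>
    Submodule.eq_of_le_of_finrank_le (sub_anti (by intro y; simp)) (hc P)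
  have h1 : ∀ F ∈ sub L t ν, F ∈ sub L (t + 1) (ν + 1) := by
    intro F hF
    refine ⟨h.mono t hF.1, fun y => ?_⟩
    have := hF
    rw [← heq y] at this
    simpa [ind] using this.2 y
  have h2 : sub L t ν = sub L (t + 1) (ν + 1) :=
    Submodule.eq_of_le_of_finrank_eq h1 (h.finrank_sub_shift t ν).symm
  have h3 : ∀ k, ∀ F ∈ sub L t ν, (fun y => (X : PowerSeries κ) ^ k * F y) ∈ sub L t ν := by
    intro k
    induction k with
    | zero => intro F hF; simpa using hF
    | succ k ih =>
      intro F hF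
      have := ih F hF
      rw [h2]
      refine ⟨?_, fun y => ?_⟩
      · have := h.X_mul_mem t _ this.1
        simpa only [pow_succ', mul_assoc] using this
      · have := mul_dvd_mul_left (X : PowerSeries κ) (this.2 y)
        change X ^ (ν y + 1) ∣ _
        simpa only [pow_succ', mul_assoc] using this
  obtain ⟨F, hF, hF0⟩ := exists_ne_zero_of_finrank_sub_pos h0
  obtain ⟨P, hP⟩ := Function.ne_iff.mp hF0
  have h4 := h3 (t + 1) F hF
  have h5 := h.sum_le t _ h4.1 (fun hz => hP (by
    have := congrFun hz P
    simpa [PowerSeries.X_ne_zero] using this)) (fun _ => t + 1) (fun y => dvd_mul_right _ _)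
  simp only [Finset.sum_const, smul_eq_mul, Finset.card_univ] at h5
  have : 0 < Fintype.card Pt := Fintype.card_pos_iff.mpr ⟨P⟩
  nlinarith

lemma exists_nonspecial (h : FunctionSpaces κ Pt L g0 σ) {γ : ℤ}
    (hγ : ∀ ν : Pt → ℕ, ∃ t0, ∀ t, t0 ≤ t → defect L t ν = γ) :
    ∃ t ν, defect L t ν = γ ∧ finrank κ (sub L t ν) = 0 := by
  obtain ⟨t, ht⟩ := hγ 0
  have key : ∀ k ν, defect L t ν = γ → finrank κ (sub L t ν) = k →
      ∃ t ν, defect L t ν = γ ∧ finrank κ (sub L t ν) = 0 := by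
    intro k
    induction k with
    | zero => intro ν h1 h2; exact ⟨t, ν, h1, h2⟩
    | succ k ih =>
      intro ν h1 h2
      obtain ⟨P, hP⟩ := h.exists_drop (t := t) (ν := ν) (by omega)
      have h3 := (h.finrank_sub_add_indicator t ν {P}).1
      rw [Finset.card_singleton] at h3
      change _ ≤ finrank κ (sub L t (ν + ind {P})) + 1 at h3
      refine ih (ν + ind {P}) ?_ (by omega)
      have h4 : deg t (ν + ind {P}) = _ := deg_add_indicator t ν {P}
      rw [Finset.card_singleton] at h4
      rw [← h1]
      simp only [defect, h4]
      push_cast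
      omega
  exact key _ 0 (ht t le_rfl) rfl

/-- A weak form of the Riemann–Roch theorem: pairs of large degree have maximal defect. -/
lemma defect_eq_of_le_deg (h : FunctionSpaces κ Pt L g0 σ) {γ : ℤ}
    (hmax : ∀ t ν, defect L t ν ≤ γ) {t₀ : ℕ} {ν₀ : Pt → ℕ} (h0 : defect L t₀ ν₀ = γ)
    {t : ℕ} {ν : Pt → ℕ} (hdeg : deg t₀ ν₀ + γ < deg t ν) : defect L t ν = γ := by
  refine le_antisymm (hmax _ _) ?_
  set k := t₀ + ∑ y, ν₀ y
  have hk : ∀ y, ν₀ y ≤ k := fun y =>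
    (Finset.single_le_sum (f := ν₀) (fun _ _ => Nat.zero_le _) (Finset.mem_univ y)).trans
      (Nat.le_add_left _ _)
  obtain ⟨s, hs⟩ : ∃ s, t + k = t₀ + s := ⟨t + ∑ y, ν₀ y, by omega⟩
  obtain ⟨μ, hμ⟩ : ∃ μ, (ν + fun _ => k) = ν₀ + μ :=
    ⟨fun y => ν y + k - ν₀ y, by ext y; have := hk y; simp; omega⟩
  rw [← h.defect_shift t k ν, hs, hμ]
  have hd : deg s μ > γ := by
    have h1 := deg_shift t k ν
    rw [hs, hμ, deg_add] at h1
    linarith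
  have h2 := hmax s μ
  have h3 : 0 < finrank κ (sub L s μ) := by
    rw [defect] at h2; omega
  obtain ⟨H, hH, hH0⟩ := exists_ne_zero_of_finrank_sub_pos h3
  rw [← h0]
  exact h.finrank_mul_le hH hH0 t₀ ν₀

lemma finrank_add_card_le (h : FunctionSpaces κ Pt L g0 σ) {t : ℕ} {α : Pt → ℕ}
    (Q : Finset Pt)
    (hQ : ∀ P ∈ Q, finrank κ (sub L t α) < finrank κ (sub L t (α - ind {P}))) :
    finrank κ (sub L t α) + Q.card ≤ finrank κ (sub L t (α - ind Q)) := by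
  have hfin := h.finiteDimensional_sub
  induction Q using Finset.induction_on with
  | empty => rw [show (α - ind (∅ : Finset Pt)) = α by ext y; simp [ind]]; simp
  | insert P Q hP ih =>
    have ih' := ih (fun P' hP' => hQ P' (Finset.mem_insert_of_mem hP'))
    rw [Finset.card_insert_of_notMem hP]
    suffices finrank κ (sub L t (α - ind Q)) < finrank κ (sub L t (α - ind (insert P Q))) by omega
    apply Submodule.finrank_lt_finrank_of_lt
    have hle : sub L t (α - ind Q) ≤ sub L t (α - ind (insert P Q)) :=
      sub_anti (by
        intro y
        simp only [Pi.sub_apply, ind, Finset.mem_insert]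
        split_ifs <;> simp_all)
    refine lt_of_le_of_ne hle ?_
    intro heq
    have hlt := hQ P (Finset.mem_insert_self _ _)
    apply not_le_of_gt hlt
    apply Submodule.finrank_mono
    intro F hF
    have hF2 : F ∈ sub L t (α - ind (insert P Q)) :=
      sub_anti (by
        intro y
        simp only [Pi.sub_apply, ind, Finset.mem_insert, Finset.mem_singleton]
        split_ifs <;> simp_all) hF
    rw [← heq] at hF2
    refine ⟨hF.1, fun y => ?_⟩
    by_cases hy : y = P
    · subst hy
      have := hF2.2 y
      simpa [ind, hP] using this
    · have := hF.2 y
      simpa [ind, hy] using this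

/-- One greedy step: the sets `W` at which evaluation is not surjective become rarer. -/
lemma exists_greedy_step (h : FunctionSpaces κ Pt L g0 σ) {γ : ℤ}
    (hmax : ∀ t ν, defect L t ν ≤ γ) {t₀ : ℕ} {ν₀ : Pt → ℕ} (h0 : defect L t₀ ν₀ = γ)
    (hd0 : deg t₀ ν₀ = γ) (w : ℕ) (hw : 2 * (γ + w) ≤ Fintype.card Pt) [Nonempty Pt]
    {t : ℕ} {ν : Pt → ℕ} (hν : ∀ y, 1 ≤ ν y) (hd : γ ≤ deg t ν) (S : Finset (Finset Pt))
    (hS : ∀ W ∈ S, W.card = w) :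
    ∃ P, ∑ W ∈ S.filter (fun W => defect L t (ν - ind {P} + ind W) < γ),
        (2 : ℝ) ^ (γ - defect L t (ν - ind {P} + ind W)).toNat ≤
      3 / 4 * ∑ W ∈ S.filter (fun W => defect L t (ν + ind W) < γ),
        (2 : ℝ) ^ (γ - defect L t (ν + ind W)).toNat := by
  by_contra hc
  push Not at hc
  have hfin := h.finiteDimensional_sub
  set n := Fintype.card Pt with hn
  have hnpos : 0 < n := Fintype.card_pos
  have hsum : (n : ℝ) * (3 / 4 * ∑ W ∈ S.filter (fun W => defect L t (ν + ind W) < γ),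
        (2 : ℝ) ^ (γ - defect L t (ν + ind W)).toNat) <
      ∑ P, ∑ W ∈ S.filter (fun W => defect L t (ν - ind {P} + ind W) < γ),
        (2 : ℝ) ^ (γ - defect L t (ν - ind {P} + ind W)).toNat := by
    have := Finset.sum_lt_sum_of_nonempty (s := (Finset.univ : Finset Pt))
      Finset.univ_nonempty (fun P _ => hc P)
    simpa [Finset.sum_const, hn] using this
  refine absurd hsum (not_lt.mpr ?_)
  have hcomm : ∀ P W, ν - ind {P} + ind W = (ν + ind W) - ind {P} := by
    intro P W; ext y
    have := hν y
    simp only [Pi.sub_apply, Pi.add_apply, ind, Finset.mem_singleton]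
    split_ifs <;> omega
  have hstep : ∀ P W, defect L t (ν + ind W) ≤ defect L t (ν - ind {P} + ind W) :=
    fun P W => h.defect_anti t (by intro y; rw [hcomm]; simp)
  have hfilter : ∀ P, S.filter (fun W => defect L t (ν - ind {P} + ind W) < γ) ⊆
      S.filter (fun W => defect L t (ν + ind W) < γ) := by
    intro P W
    simp only [Finset.mem_filter]
    exact fun ⟨h1, h2⟩ => ⟨h1, (hstep P W).trans_lt h2⟩
  let T := S.filter (fun W => defect L t (ν + ind W) < γ)
  have hterm : ∀ W ∈ T, ∑ P, (if defect L t (ν - ind {P} + ind W) < γ then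
        (2 : ℝ) ^ (γ - defect L t (ν - ind {P} + ind W)).toNat else 0) ≤
      (n : ℝ) * (3 / 4 * (2 : ℝ) ^ (γ - defect L t (ν + ind W)).toNat) := by
    intro W hW
    obtain ⟨hWS, hWγ⟩ := Finset.mem_filter.mp hW
    set α := ν + ind W with hα
    have hα1 : ∀ y, 1 ≤ α y := fun y => (hν y).trans (by simp [hα])
    set Q := Finset.univ.filter
      (fun P => finrank κ (sub L t α) < finrank κ (sub L t (α - ind {P}))) with hQ
    have hQc := h.finrank_add_card_le (t := t) (α := α) Q (fun P hP => (Finset.mem_filter.mp hP).2)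
    have hsubind : ∀ Q : Finset Pt, (α - ind Q) + ind Q = α := by
      intro Q; ext y
      have := hα1 y
      simp only [Pi.sub_apply, Pi.add_apply, ind]
      split_ifs <;> omega
    have hdegsub : ∀ Q : Finset Pt, deg t (α - ind Q) = deg t α + Q.card := by
      intro Q
      have := deg_add_indicator t (α - ind Q) Q
      change deg t ((α - ind Q) + ind Q) = _ at this
      rw [hsubind] at this
      linarith
    have hdegα : deg t α = deg t ν - w := by
      have := deg_add_indicator t ν W
      rw [← hS W hWS]; exact this
    have hQcard : (Q.card : ℤ) ≤ γ + w := by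
      by_contra hlt
      push Not at hlt
      have h1 : deg t₀ ν₀ + γ < deg t (α - ind Q) := by
        rw [hdegsub, hdegα]; linarith
      have h2 := h.defect_eq_of_le_deg hmax h0 h1
      have h3 : defect L t (α - ind Q) ≤ defect L t α := by
        simp only [defect, hdegsub]
        zify at hQc
        linarith
      linarith
    have hone : ∀ P, (if defect L t (ν - ind {P} + ind W) < γ then
        (2 : ℝ) ^ (γ - defect L t (ν - ind {P} + ind W)).toNat else 0) ≤
        (1 / 2 + if P ∈ Q then 1 / 2 else 0) * (2 : ℝ) ^ (γ - defect L t α).toNat := by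
      intro P
      have hs := hstep P W
      by_cases hPQ : P ∈ Q
      · simp only [hPQ, if_true]
        split_ifs
        · rw [show (1 / 2 + 1 / 2 : ℝ) = 1 by norm_num, one_mul]
          exact pow_le_pow_right₀ (by norm_num) (Int.toNat_le_toNat (by linarith))
        · positivity
      · simp only [hPQ, if_false, add_zero]
        split_ifs with hlt
        · have hPQ' : ¬ (finrank κ (sub L t α) < finrank κ (sub L t (α - ind {P}))) := by
            intro hh; exact hPQ (Finset.mem_filter.mpr ⟨Finset.mem_univ _, hh⟩)
          have h1 : defect L t α + 1 ≤ defect L t (ν - ind {P} + ind W) := by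
            rw [hcomm, ← hα]
            simp only [defect, hdegsub, Finset.card_singleton]
            push_cast
            omega
          have h2 : (γ - defect L t α).toNat =
            ((γ - defect L t α).toNat - 1) + 1 := by omega
          rw [h2, pow_succ]
          have h3 : (2 : ℝ) ^ (γ - defect L t (ν - ind {P} + ind W)).toNat ≤
              2 ^ ((γ - defect L t α).toNat - 1) :=
            pow_le_pow_right₀ (by norm_num) (by omega)
          linarith
        · positivity
    refine (Finset.sum_le_sum fun P _ => hone P).trans ?_
    rw [← Finset.sum_mul, Finset.sum_add_distrib, ← mul_assoc]
    refine mul_le_mul_of_nonneg_right ?_ (by positivity)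
    have hQr : 2 * (Q.card : ℝ) ≤ n := by
      have : 2 * (Q.card : ℤ) ≤ n := by linarith
      exact_mod_cast this
    simp only [Finset.sum_const, Finset.card_univ, nsmul_eq_mul, Finset.sum_ite_mem,
      Finset.univ_inter, ← hn]
    linarith
  calc ∑ P, ∑ W ∈ S.filter (fun W => defect L t (ν - ind {P} + ind W) < γ),
        (2 : ℝ) ^ (γ - defect L t (ν - ind {P} + ind W)).toNat
      = ∑ P, ∑ W ∈ T, (if defect L t (ν - ind {P} + ind W) < γ then
        (2 : ℝ) ^ (γ - defect L t (ν - ind {P} + ind W)).toNat else 0) := by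
        refine Finset.sum_congr rfl fun P _ => ?_
        rw [← Finset.sum_filter]
        refine Finset.sum_congr ?_ fun _ _ => rfl
        ext W
        have := @hfilter P W
        simp only [Finset.mem_filter, T] at this ⊢
        tauto
    _ = ∑ W ∈ T, ∑ P, (if defect L t (ν - ind {P} + ind W) < γ then
        (2 : ℝ) ^ (γ - defect L t (ν - ind {P} + ind W)).toNat else 0) := Finset.sum_comm
    _ ≤ ∑ W ∈ T, (n : ℝ) * (3 / 4 * (2 : ℝ) ^ (γ - defect L t (ν + ind W)).toNat) :=
        Finset.sum_le_sum hterm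
    _ = _ := by rw [← Finset.mul_sum, ← Finset.mul_sum]

end FunctionSpaces

namespace FunctionSpaces

open PowerSeries Module

variable {κ Pt : Type} [Field κ] [Fintype Pt] [DecidableEq Pt]
  {L : ℕ → Submodule κ (Pt → PowerSeries κ)} {g0 : ℕ} {σ : κ →+* κ}

/-- There is a pair of small degree at which evaluation on any `w` points is surjective. -/
lemma exists_surjective_pair (h : FunctionSpaces κ Pt L g0 σ) [Nonempty Pt] (w τ : ℕ)
    (hw : 2 * (g0 + w) ≤ Fintype.card Pt)
    (hτ : ((Fintype.card Pt).choose w : ℝ) * 2 ^ w * (3 / 4) ^ τ < 1) :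
    ∃ (γ : ℤ) (t : ℕ) (ν : Pt → ℕ), γ ≤ g0 ∧ (∀ t ν, defect L t ν ≤ γ) ∧
      deg t ν = γ + τ ∧ defect L t ν = γ ∧
      ∀ W : Finset Pt, W.card = w → ∀ v : Pt → κ,
        ∃ F ∈ sub L t ν, ∀ y ∈ W, coeffAt ν F y = v y := by
  obtain ⟨γ, hγg, hmax, hγ⟩ := h.exists_genus
  obtain ⟨t₀, ν₀, hd0, hf0⟩ := h.exists_nonspecial hγ
  have hdeg0 : deg t₀ ν₀ = γ := by
    rw [defect, hf0] at hd0; simpa using hd0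
  set t := t₀ + τ
  set ν := ν₀ + fun _ => τ
  have hdegν : deg t ν = γ := by rw [deg_shift, hdeg0]
  have hdefν : defect L t ν = γ := by rw [h.defect_shift, hd0]
  set S : Finset (Finset Pt) := Finset.univ.powersetCard w
  have hS : ∀ W ∈ S, W.card = w := fun W hW => (Finset.mem_powersetCard.mp hW).2
  let Ψ : (Pt → ℕ) → ℝ := fun ν => ∑ W ∈ S.filter (fun W => defect L t (ν + ind W) < γ),
        (2 : ℝ) ^ (γ - defect L t (ν + ind W)).toNat
  have hΨ0 : Ψ ν ≤ ((Fintype.card Pt).choose w : ℝ) * 2 ^ w := by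
    have : ∀ W ∈ S.filter (fun W => defect L t (ν + ind W) < γ),
        (2 : ℝ) ^ (γ - defect L t (ν + ind W)).toNat ≤ 2 ^ w := by
      intro W hW
      apply pow_le_pow_right₀ (by norm_num)
      have h1 := (h.defect_add_indicator t ν W).2
      change _ ≤ defect L t (ν + ind W) at h1
      rw [hS W (Finset.mem_filter.mp hW).1] at h1
      omega
    refine (Finset.sum_le_sum this).trans ?_
    rw [Finset.sum_const, nsmul_eq_mul]
    refine mul_le_mul_of_nonneg_right ?_ (by positivity)
    have : (S.filter (fun W => defect L t (ν + ind W) < γ)).card ≤ S.card :=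
      Finset.card_filter_le _ _
    rw [Finset.card_powersetCard, Finset.card_univ] at this
    exact_mod_cast this
  have hiter : ∀ k, k ≤ τ → ∃ ν' : Pt → ℕ, (∀ y, τ - k ≤ ν' y) ∧ deg t ν' = γ + k ∧
      defect L t ν' = γ ∧ Ψ ν' ≤ (3 / 4) ^ k * Ψ ν := by
    intro k
    induction k with
    | zero =>
      intro _
      exact ⟨ν, fun y => by simp [ν], by simpa using hdegν, hdefν, by simp⟩
    | succ k ih =>
      intro hk
      obtain ⟨ν', h1, h2, h3, h4⟩ := ih (by omega)
      have hν1 : ∀ y, 1 ≤ ν' y := fun y => le_trans (by omega) (h1 y)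
      obtain ⟨P, hP⟩ := h.exists_greedy_step hmax hd0 hdeg0 w (by omega)
        hν1 (by rw [h2]; omega) S hS
      have hadd : ν' - ind {P} + ind {P} = ν' := by
        ext y
        have := hν1 y
        simp only [Pi.sub_apply, Pi.add_apply, ind]
        split_ifs <;> omega
      refine ⟨ν' - ind {P}, fun y => ?_, ?_, le_antisymm (hmax _ _) ?_, ?_⟩
      · have := h1 y
        simp only [Pi.sub_apply, ind]
        split_ifs <;> omega
      · have := deg_add_indicator t (ν' - ind {P}) {P}
        change deg t (ν' - ind {P} + ind {P}) = _ at this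
        rw [hadd, h2, Finset.card_singleton] at this
        push_cast at this ⊢; linarith
      · rw [← h3]
        refine h.defect_anti t (fun y => ?_)
        simp
      · refine hP.trans ?_
        rw [pow_succ']
        change 3 / 4 * Ψ ν' ≤ _
        rw [mul_assoc]
        exact mul_le_mul_of_nonneg_left h4 (by norm_num)
  obtain ⟨ν', -, hdeg, hdef, hΨ⟩ := hiter τ le_rfl
  have hΨ1 : Ψ ν' < 1 := by
    refine hΨ.trans_lt (lt_of_le_of_lt ?_ hτ)
    rw [mul_comm]
    exact mul_le_mul_of_nonneg_right hΨ0 (by positivity)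
  refine ⟨γ, t, ν', hγg, hmax, hdeg, hdef, fun W hW => ?_⟩
  have hWγ : defect L t (ν' + ind W) = γ := by
    by_contra hne
    have hlt := lt_of_le_of_ne (hmax t (ν' + ind W)) hne
    have hmem : W ∈ S.filter (fun W => defect L t (ν' + ind W) < γ) :=
      Finset.mem_filter.mpr ⟨Finset.mem_powersetCard.mpr ⟨Finset.subset_univ _, hW⟩, hlt⟩
    have h1 := Finset.single_le_sum
      (f := fun W => (2 : ℝ) ^ (γ - defect L t (ν' + ind W)).toNat)
      (fun W _ => by positivity) hmem
    have h2 : (1 : ℝ) ≤ 2 ^ (γ - defect L t (ν' + ind W)).toNat := one_le_pow₀ (by norm_num)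
    exact absurd (h2.trans h1) (not_le.mpr hΨ1)
  refine (h.finrank_sub_add_indicator t ν' W).2 ?_
  have h1 : deg t (ν' + ind W) = _ := deg_add_indicator t ν' W
  change _ = finrank κ (sub L t (ν' + ind W)) + _
  simp only [defect] at hWγ hdef
  omega

lemma coeff_mul_of_dvd {a b : ℕ} {f g : PowerSeries κ} (hf : (X : PowerSeries κ) ^ a ∣ f)
    (hg : (X : PowerSeries κ) ^ b ∣ g) :
    PowerSeries.coeff (a + b) (f * g) = PowerSeries.coeff a f * PowerSeries.coeff b g := by
  obtain ⟨f, rfl⟩ := hf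
  obtain ⟨g, rfl⟩ := hg
  have h1 : ∀ (a : ℕ) (f : PowerSeries κ), PowerSeries.coeff a (X ^ a * f) =
      constantCoeff f := by
    intro a f
    have := PowerSeries.coeff_X_pow_mul f a 0
    simpa using this
  rw [show X ^ a * f * (X ^ b * g) = X ^ (a + b) * (f * g) by ring, h1, h1, h1, map_mul]

lemma pow_mem_sub (h : FunctionSpaces κ Pt L g0 σ) {t : ℕ} {ν : Pt → ℕ}
    {F : Pt → PowerSeries κ} (hF : F ∈ sub L t ν) (k : ℕ) :
    F ^ (k + 1) ∈ sub L ((k + 1) * t) ((k + 1) • ν) ∧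
      ∀ y, coeffAt ((k + 1) • ν) (F ^ (k + 1)) y = coeffAt ν F y ^ (k + 1) := by
  induction k with
  | zero => simpa using hF
  | succ k ih =>
    obtain ⟨⟨h1, h2⟩, h3⟩ := ih
    refine ⟨⟨?_, fun y => ?_⟩, fun y => ?_⟩
    · rw [pow_succ, add_mul (k + 1), one_mul]
      exact h.mul_mem _ _ _ _ h1 hF.1
    · rw [pow_succ, add_smul (k + 1), one_smul, Pi.add_apply, pow_add]
      exact mul_dvd_mul (h2 y) (hF.2 y)
    · rw [pow_succ (coeffAt ν F y), ← h3 y, add_smul (k + 1), one_smul, pow_succ F (k + 1)]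
      exact coeff_mul_of_dvd (h2 y) (hF.2 y)

lemma mul_mem_map (h : FunctionSpaces κ Pt L g0 σ) {s t : ℕ} {μ ν : Pt → ℕ}
    {F G : Pt → PowerSeries κ} (hF : F ∈ sub L s μ) (hG : G ∈ sub L t ν) :
    coeffAt μ F * coeffAt ν G ∈ (sub L (s + t) (μ + ν)).map (coeffAt (μ + ν)) := by
  refine ⟨F * G, ⟨h.mul_mem _ _ _ _ hF.1 hG.1, fun y => ?_⟩, ?_⟩
  · rw [Pi.add_apply, pow_add]
    exact mul_dvd_mul (hF.2 y) (hG.2 y)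
  · ext1 y
    exact coeff_mul_of_dvd (hF.2 y) (hG.2 y)

lemma card_zeros_le (h : FunctionSpaces κ Pt L g0 σ) {t : ℕ} {ν : Pt → ℕ} {v : Pt → κ}
    (hv : v ∈ (sub L t ν).map (coeffAt ν)) (hv0 : v ≠ 0) (Z : Finset Pt)
    (hZ : ∀ y ∈ Z, v y = 0) : (Z.card : ℤ) ≤ deg t ν := by
  obtain ⟨F, hF, rfl⟩ := hv
  have hF0 : F ≠ 0 := by rintro rfl; exact hv0 (map_zero _)
  have := h.sum_le t F hF.1 hF0 (ν + ind Z) (fun y => by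
    by_cases hy : y ∈ Z
    · simp only [Pi.add_apply, ind, hy, if_true]
      exact (X_pow_succ_dvd_iff (hF.2 y)).mpr (hZ y hy)
    · simpa [ind, hy] using hF.2 y)
  simp only [Pi.add_apply, Finset.sum_add_distrib, sum_ind] at this
  zify at this
  rw [deg]; linarith

/-- The codes obtained from a family of function spaces. -/
theorem exists_codes (h : FunctionSpaces κ Pt L g0 σ) (w τ q : ℕ) (hw0 : 1 ≤ w) (hq : 1 ≤ q)
    (hwn : w ≤ Fintype.card Pt)
    (hw : 2 * (g0 + w) ≤ Fintype.card Pt)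
    (hτ : ((Fintype.card Pt).choose w : ℝ) * 2 ^ w * (3 / 4) ^ τ < 1) :
    ∃ C H₀ H₁ : Submodule κ (Pt → κ),
      (∀ W : Finset Pt, W.card = w → ∀ v : Pt → κ, ∃ c ∈ C, ∀ y ∈ W, c y = v y) ∧
      (∀ c ∈ C, (fun y => σ (c y)) ∈ C) ∧
      (∀ a ∈ C, ∀ b ∈ C, a * b ∈ H₀) ∧ (∀ a ∈ C, ∀ b ∈ C, a ^ q * b ∈ H₁) ∧
      finrank κ H₀ ≤ g0 + 2 * τ ∧ finrank κ H₁ ≤ q * g0 + (q + 1) * τ ∧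
      (∀ c ∈ H₀, c ≠ 0 → ∀ Z : Finset Pt, (∀ y ∈ Z, c y = 0) → Z.card ≤ 2 * (g0 + τ)) ∧
      (∀ c ∈ H₁, c ≠ 0 → ∀ Z : Finset Pt, (∀ y ∈ Z, c y = 0) →
        Z.card ≤ (q + 1) * (g0 + τ)) := by
  have hne : Nonempty Pt := Fintype.card_pos_iff.mp (by omega)
  obtain ⟨γ, t, ν, hγ, hmax, hdeg, hdef, hsurj⟩ := h.exists_surjective_pair w τ hw hτ
  obtain ⟨H, hH, hH0⟩ : ∃ H ∈ sub L t ν, H ≠ 0 := by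
    obtain ⟨W, hW⟩ := Finset.exists_subset_card_eq (s := (Finset.univ : Finset Pt)) (n := w)
      (by simpa using hwn)
    obtain ⟨F, hF, hFW⟩ := hsurj W hW.2 (fun _ => 1)
    obtain ⟨y, hy⟩ : W.Nonempty := by rw [← Finset.card_pos]; omega
    refine ⟨F, hF, ?_⟩
    rintro rfl
    simpa using hFW y hy
  have hdegk : ∀ k : ℕ, deg (k * t) (k • ν) = k * (γ + τ) := by
    intro k
    rw [← hdeg]
    simp only [deg, Pi.smul_apply, smul_eq_mul]
    push_cast
    rw [← Finset.mul_sum]; ring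
  have hfr : ∀ k : ℕ, (finrank κ (sub L ((k + 1) * t) ((k + 1) • ν)) : ℤ) ≤
      (k + 1) * (γ + τ) - γ := by
    intro k
    have h1 : γ ≤ defect L ((k + 1) * t) ((k + 1) • ν) := by
      rcases Nat.eq_zero_or_pos k with rfl | hk
      · simpa using hdef.ge
      · obtain ⟨k, rfl⟩ := Nat.exists_eq_add_of_le' hk
        have h2 := h.finrank_mul_le ((h.pow_mem_sub hH k).1) (by
          intro hz; exact hH0 (pow_eq_zero_iff (Nat.succ_ne_zero k) |>.mp hz)) t ν
        rw [hdef] at h2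
        rw [add_mul (k + 1), one_mul, add_smul (k + 1), one_smul, add_comm _ t, add_comm _ ν]
        exact h2
    have h3 := hdegk (k + 1)
    simp only [defect] at h1
    push_cast at h3 ⊢
    omega
  have hmapfr : ∀ k : ℕ, finrank κ ((sub L ((k + 1) * t) ((k + 1) • ν)).map
      (coeffAt ((k + 1) • ν))) ≤ finrank κ (sub L ((k + 1) * t) ((k + 1) • ν)) := by
    intro k
    have := h.finiteDimensional_sub ((k + 1) * t) ((k + 1) • ν)
    exact Submodule.finrank_map_le _ _
  refine ⟨(sub L t ν).map (coeffAt ν),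
    (sub L ((1 + 1) * t) ((1 + 1) • ν)).map (coeffAt ((1 + 1) • ν)),
    (sub L ((q + 1) * t) ((q + 1) • ν)).map (coeffAt ((q + 1) • ν)), ?_, ?_, ?_, ?_, ?_, ?_,
    ?_, ?_⟩
  · intro W hW v
    obtain ⟨F, hF, hFW⟩ := hsurj W hW v
    exact ⟨_, ⟨F, hF, rfl⟩, hFW⟩
  · rintro _ ⟨F, hF, rfl⟩
    refine ⟨fun y => PowerSeries.map σ (F y), ⟨h.frob_mem t F hF.1, fun y => ?_⟩, ?_⟩
    · have := map_dvd (PowerSeries.map σ) (hF.2 y)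
      simpa using this
    · ext1 y; simp [coeffAt_apply]
  · rintro _ ⟨F, hF, rfl⟩ _ ⟨G, hG, rfl⟩
    have := h.mul_mem_map hF hG
    rwa [← two_mul, ← two_nsmul] at this
  · rintro _ ⟨F, hF, rfl⟩ _ ⟨G, hG, rfl⟩
    obtain ⟨k, rfl⟩ := Nat.exists_eq_add_of_le' hq
    obtain ⟨h1, h2⟩ := h.pow_mem_sub hF k
    have := h.mul_mem_map h1 hG
    rw [add_mul (k + 1) 1, one_mul, add_smul (k + 1) 1, one_smul]
    convert this using 2
    ext1 y
    exact (h2 y).symm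
  · have h1 := hmapfr 1
    have h2 := hfr 1
    norm_num only at h1 h2 ⊢
    omega
  · have h1 := hmapfr q
    have h2 := hfr q
    have h3 : (q : ℤ) * γ ≤ q * g0 := mul_le_mul_of_nonneg_left hγ (by positivity)
    zify at h1 ⊢
    linarith
  · intro c hc hc0 Z hZ
    have h1 := h.card_zeros_le hc hc0 Z hZ
    rw [hdegk] at h1
    push_cast at h1
    omega
  · intro c hc hc0 Z hZ
    have h1 := h.card_zeros_le hc hc0 Z hZ
    rw [hdegk] at h1
    zify
    push_cast at h1
    refine h1.trans ?_
    exact mul_le_mul_of_nonneg_left (by linarith) (by positivity)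

end FunctionSpaces

section

open Module

/-- An information set for a code on a set of positions. -/
lemma exists_information_set {κ Pt : Type} [Field κ] [Fintype Pt] [DecidableEq Pt]
    (H : Submodule κ (Pt → κ)) (A : Finset Pt) :
    ∃ I ⊆ A, I.card ≤ finrank κ H ∧ ∀ h ∈ H, (∀ y ∈ I, h y = 0) → ∀ y ∈ A, h y = 0 := by
  induction hk : finrank κ H using Nat.strong_induction_on generalizing H with
  | _ k ih =>
  by_cases hz : ∀ h ∈ H, ∀ y ∈ A, h y = 0
  · exact ⟨∅, Finset.empty_subset _, by simp, fun h hh _ => hz h hh⟩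
  push Not at hz
  obtain ⟨h, hh, P, hP, hhP⟩ := hz
  set H' := H ⊓ LinearMap.ker (LinearMap.proj P : (Pt → κ) →ₗ[κ] κ)
  have hlt : finrank κ H' < k := by
    rw [← hk]
    apply Submodule.finrank_lt_finrank_of_lt
    refine lt_of_le_of_ne inf_le_left fun heq => hhP ?_
    have : h ∈ H' := heq ▸ hh
    exact this.2
  obtain ⟨I, hIA, hIc, hI⟩ := ih _ hlt H' rfl
  refine ⟨insert P I, Finset.insert_subset hP hIA, (Finset.card_insert_le _ _).trans (by omega),
    fun g hg hgI => hI g ⟨hg, hgI P (Finset.mem_insert_self _ _)⟩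
      fun y hy => hgI y (Finset.mem_insert_of_mem hy)⟩

/-- Counting functions whose values outside `M` are constrained by their values on `M`. -/
lemma card_constrained_le {Pt X : Type} [Fintype Pt] [DecidableEq Pt] [DecidableEq X]
    (T : Finset X) (M : Finset Pt) (S : (Pt → X) → Pt → Finset X) (b : ℕ)
    (hS : ∀ c c', (∀ P ∈ M, c P = c' P) → S c = S c') (hb : ∀ c, ∀ P ∉ M, (S c P).card ≤ b)
    (G : Finset (Pt → X)) (hGT : ∀ c ∈ G, ∀ P, c P ∈ T) (hG : ∀ c ∈ G, ∀ P ∉ M, c P ∈ S c P) :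
    G.card ≤ T.card ^ M.card * b ^ (Fintype.card Pt - M.card) := by
  classical
  let r : (Pt → X) → (M → X) := fun c P => c P
  have h1 : (G.image r).card ≤ T.card ^ M.card := by
    have : G.image r ⊆ Fintype.piFinset (fun _ : M => T) := by
      intro f hf
      obtain ⟨c, hc, rfl⟩ := Finset.mem_image.mp hf
      exact Fintype.mem_piFinset.mpr fun P => hGT c hc P
    refine (Finset.card_le_card this).trans ?_
    simp
  have h2 : ∀ f ∈ G.image r, (G.filter fun c => r c = f).card ≤
      b ^ (Fintype.card Pt - M.card) := by
    intro f hf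
    obtain ⟨c₀, hc₀, rfl⟩ := Finset.mem_image.mp hf
    have : (G.filter fun c => r c = r c₀) ⊆
        Fintype.piFinset (fun P => if P ∈ M then {c₀ P} else S c₀ P) := by
      intro c hc
      obtain ⟨hcG, hcr⟩ := Finset.mem_filter.mp hc
      have hcM : ∀ P ∈ M, c P = c₀ P := fun P hP => congrFun hcr ⟨P, hP⟩
      refine Fintype.mem_piFinset.mpr fun P => ?_
      by_cases hP : P ∈ M
      · simp [hP, hcM P hP]
      · simp only [hP, if_false]
        rw [← hS c c₀ hcM]
        exact hG c hcG P hP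
    refine (Finset.card_le_card this).trans ?_
    rw [Fintype.card_piFinset]
    calc ∏ P, (if P ∈ M then {c₀ P} else S c₀ P).card
        ≤ ∏ P, (if P ∈ M then 1 else b) := by
          refine Finset.prod_le_prod' fun P _ => ?_
          split_ifs with hP
          · simp
          · exact hb c₀ P hP
      _ = b ^ (Fintype.card Pt - M.card) := by
          rw [Finset.prod_ite]
          simp [Finset.filter_not, Finset.card_sdiff, Finset.card_univ]
  calc G.card ≤ b ^ (Fintype.card Pt - M.card) * (G.image r).card :=
        Finset.card_le_mul_card_image G _ h2
    _ ≤ _ := by rw [mul_comm]; exact Nat.mul_le_mul_right _ h1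

section Cubic

variable {F K : Type} [Field F] [Fintype F] [Field K] [Fintype K] [Algebra F K]

lemma card_eq_of_finrank_three (h3 : finrank F K = 3) :
    Fintype.card K = Fintype.card F ^ 3 := by
  rw [Module.card_eq_pow_finrank (K := F) (V := K), h3]

lemma trace_cubic (h3 : finrank F K = 3) (x : K) :
    algebraMap F K (Algebra.trace F K x) =
      x + x ^ Fintype.card F + x ^ Fintype.card F ^ 2 := by
  rw [FiniteField.algebraMap_trace_eq_sum_pow, h3, Nat.card_eq_fintype_card]
  simp [Finset.sum_range_succ]

lemma pow_card_cube (h3 : finrank F K = 3) (x : K) :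
    x ^ Fintype.card F ^ 3 = x := by
  rw [← card_eq_of_finrank_three h3, FiniteField.pow_card]

lemma add_pow_card (x y : K) :
    (x + y) ^ Fintype.card F = x ^ Fintype.card F + y ^ Fintype.card F := by
  have := (FiniteField.frobeniusAlgHom F K).map_add x y
  simpa using this

lemma trace_mul_trace (h3 : finrank F K = 3) (c f g : K) :
    Algebra.trace F K (c * f) * Algebra.trace F K (c * g) =
      Algebra.trace F K (c ^ 2 * (f * g)) + Algebra.trace F K
        (c ^ (Fintype.card F + 1) * (f ^ Fintype.card F * g + g ^ Fintype.card F * f)) := by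
  apply (algebraMap F K).injective
  simp only [map_mul, map_add, trace_cubic h3]
  set q := Fintype.card F
  have hadd : ∀ x y : K, (x + y) ^ q = x ^ q + y ^ q := add_pow_card (F := F) (K := K)
  have hadd2 : ∀ x y : K, (x + y) ^ q ^ 2 = x ^ q ^ 2 + y ^ q ^ 2 := by
    intro x y; rw [pow_two q, pow_mul, hadd, hadd, ← pow_mul, ← pow_mul]
  have hq : ∀ x : K, (x ^ q) ^ q = x ^ q ^ 2 := by intro x; rw [← pow_mul, pow_two]
  have hq2 : ∀ x : K, (x ^ q) ^ q ^ 2 = x := by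
    intro x
    rw [← pow_mul, ← pow_succ']; exact pow_card_cube h3 x
  have h2 : ∀ (x : K) (n : ℕ), (x ^ 2) ^ n = (x ^ n) ^ 2 := fun x n => by
    rw [← pow_mul, ← pow_mul, mul_comm]
  simp only [hadd, hadd2, mul_pow, pow_succ c q, hq, hq2, h2]
  ring

/-- The quadratic equation in `c` attached to a pair `(a, b)` with `a ≠ 0` has few solutions. -/
lemma card_trace_zeros_le [DecidableEq K] [DecidableEq F] (h3 : finrank F K = 3) {a : K}
    (ha : a ≠ 0) (b : K) :
    (Finset.univ.filter fun c : K => Algebra.trace F K (c ^ 2 * a) +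
      Algebra.trace F K (c ^ (Fintype.card F + 1) * b) = 0).card ≤ 2 * Fintype.card F ^ 2 := by
  open Polynomial in
  set q := Fintype.card F with hq
  have hq1 : 1 < q := Fintype.one_lt_card
  let p : Polynomial K := C (a ^ q ^ 2) * X ^ (2 * q ^ 2) +
    (C a * X ^ 2 + C (a ^ q) * X ^ (2 * q) + C b * X ^ (q + 1) + C (b ^ q) * X ^ (q * (q + 1)) +
      C (b ^ q ^ 2) * X ^ (q ^ 2 + 1))
  have hqq : q < q ^ 2 := by nlinarith
  have hdeg : (C a * X ^ 2 + C (a ^ q) * X ^ (2 * q) + C b * X ^ (q + 1) +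
      C (b ^ q) * X ^ (q * (q + 1)) + C (b ^ q ^ 2) * X ^ (q ^ 2 + 1) : Polynomial K).degree
        < (2 * q ^ 2 : ℕ) := by
    have hm : ∀ (x : K) (k : ℕ), k < 2 * q ^ 2 →
        (C x * X ^ k : Polynomial K).degree < (2 * q ^ 2 : ℕ) := fun x k hk =>
      (degree_C_mul_X_pow_le k x).trans_lt (by exact_mod_cast hk)
    refine (degree_add_le _ _).trans_lt (max_lt ((degree_add_le _ _).trans_lt (max_lt
      ((degree_add_le _ _).trans_lt (max_lt ((degree_add_le _ _).trans_lt (max_lt ?_ ?_))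
        ?_)) ?_)) ?_)
    all_goals apply hm; nlinarith
  have ha' : a ^ q ^ 2 ≠ 0 := pow_ne_zero _ ha
  have hpd : p.degree = (2 * q ^ 2 : ℕ) := by
    rw [degree_add_eq_left_of_degree_lt, degree_C_mul_X_pow _ ha']
    rw [degree_C_mul_X_pow _ ha']; exact hdeg
  have hp0 : p ≠ 0 := by
    rintro h
    rw [h, degree_zero] at hpd
    exact WithBot.bot_ne_coe hpd
  have hsub : (Finset.univ.filter fun c : K => Algebra.trace F K (c ^ 2 * a) +
      Algebra.trace F K (c ^ (q + 1) * b) = 0) ⊆ p.roots.toFinset := by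
    intro c hc
    rw [Multiset.mem_toFinset, mem_roots hp0, IsRoot.def]
    have h1 := congrArg (algebraMap F K) (Finset.mem_filter.mp hc).2
    rw [map_add, trace_cubic h3, trace_cubic h3, map_zero, ← hq] at h1
    rw [← h1]
    simp only [p, eval_add, eval_mul, eval_C, eval_pow, eval_X]
    have hc3 := pow_card_cube h3 c
    rw [← hq] at hc3
    have h2 : (c ^ (q + 1)) ^ q ^ 2 = c ^ (q ^ 2 + 1) := by
      rw [← pow_mul, add_mul, ← pow_succ', one_mul, pow_add, hc3, pow_succ]; ring
    simp only [mul_pow, h2]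
    simp only [← pow_mul, mul_comm q]
    ring
  calc _ ≤ p.roots.toFinset.card := Finset.card_le_card hsub
    _ ≤ Multiset.card p.roots := Multiset.toFinset_card_le _
    _ ≤ p.natDegree := card_roots' p
    _ = 2 * q ^ 2 := natDegree_eq_of_degree_eq_some hpd

/-- The triples used to expand `K` over `F`. -/
noncomputable def goodTriples (F K : Type) [Field F] [Field K] [Fintype K] [Algebra F K] :
    Finset (Fin 3 → K) := by
  classical
  exact Finset.univ.filter fun c => LinearIndependent F c ∧ LinearIndependent F c⁻¹

lemma mem_goodTriples {c : Fin 3 → K} : c ∈ goodTriples F K ↔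
    LinearIndependent F c ∧ LinearIndependent F c⁻¹ := by
  simp [goodTriples]

lemma card_goodTriples (h3 : finrank F K = 3) :
    2 * ((Fintype.card F ^ 3 - 1) * (Fintype.card F ^ 3 - Fintype.card F) *
      (Fintype.card F ^ 3 - Fintype.card F ^ 2)) ≤
      (goodTriples F K).card + Fintype.card F ^ 9 := by
  classical
  set A : Finset (Fin 3 → K) := Finset.univ.filter fun c => LinearIndependent F c
  set A' : Finset (Fin 3 → K) := Finset.univ.filter fun c => LinearIndependent F c⁻¹
  have hA : A.card = (Fintype.card F ^ 3 - 1) * (Fintype.card F ^ 3 - Fintype.card F) *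
      (Fintype.card F ^ 3 - Fintype.card F ^ 2) := by
    have := card_linearIndependent (K := F) (V := K) (k := 3) (by rw [h3])
    rw [h3] at this
    rw [Nat.card_eq_fintype_card, Fintype.card_subtype] at this
    rw [this]
    simp [Fin.prod_univ_succ, mul_assoc]
  have hA' : A'.card = A.card := by
    refine Finset.card_bij (fun c _ => c⁻¹) ?_ ?_ ?_
    · intro c hc; simpa [A, A'] using hc
    · intro c _ c' _ h; exact inv_injective h
    · intro c hc; exact ⟨c⁻¹, by simpa [A, A'] using hc, by simp⟩
  have hinteg : goodTriples F K = A ∩ A' := by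
    ext c; simp [mem_goodTriples, A, A']
  have hU : (A ∪ A').card ≤ Fintype.card F ^ 9 := by
    refine (Finset.card_le_univ _).trans (le_of_eq ?_)
    rw [Fintype.card_fun, card_eq_of_finrank_three h3]
    simp [← pow_mul]
  have := Finset.card_union_add_card_inter A A'
  rw [hinteg]
  omega

lemma linearIndependent_pow_of_goodTriples (h3 : finrank F K = 3) {c : Fin 3 → K}
    (hc : c ∈ goodTriples F K) :
    LinearIndependent F (fun i => c i ^ (Fintype.card F + 1)) := by
  obtain ⟨h1, h2⟩ := mem_goodTriples.mp hc
  set q := Fintype.card F with hq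
  have hq1 : 0 < q := Fintype.card_pos
  let φ := (FiniteField.frobeniusAlgHom F K).comp (FiniteField.frobeniusAlgHom F K)
  have hφ : ∀ x, φ x = x ^ q ^ 2 := by intro x; simp [φ, ← pow_mul, pow_two, hq]
  have h4 : LinearIndependent F (φ ∘ c⁻¹) :=
    h2.map' φ.toLinearMap (LinearMap.ker_eq_bot.mpr φ.injective)
  have hc0 : ∀ i, c i ≠ 0 := h1.ne_zero
  have hN : ∀ i, algebraMap F K (Algebra.norm F (c i)) = c i ^ (1 + q + q ^ 2) := by
    intro i
    rw [FiniteField.algebraMap_norm_eq_prod_pow, h3, Nat.card_eq_fintype_card]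
    simp [Finset.prod_range_succ, ← hq, pow_add]
  have hN0 : ∀ i, Algebra.norm F (c i) ≠ 0 := fun i h => by
    have := hN i
    rw [h, map_zero] at this
    exact pow_ne_zero _ (hc0 i) this.symm
  have h5 := h4.units_smul (fun i => Units.mk0 _ (hN0 i))
  convert h5 using 2 with i
  simp only [Pi.smul_apply', Function.comp, Units.smul_mk0, Pi.inv_apply, hφ, Algebra.smul_def, hN]
  have := hc0 i
  rw [inv_pow]
  field_simp
  ring

end Cubic

end

section

open Module

section Concatenation

variable {F K κ Pt : Type} [Field F] [Fintype F] [Field K] [Fintype K] [Algebra F K]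
  [Field κ] [Algebra K κ] [Fintype Pt] [DecidableEq Pt]

/-- The `K`-rational words of a code over an extension of `K`. -/
def rationalWords (K : Type) {κ Pt : Type} [Field K] [Field κ] [Algebra K κ]
    (C : Submodule κ (Pt → κ)) : Submodule K (Pt → K) where
  carrier := {f | (fun P => algebraMap K κ (f P)) ∈ C}
  zero_mem' := by
    rw [Set.mem_ofPred_eq]; convert C.zero_mem using 1; ext; simp
  add_mem' := by
    intro a b ha hb
    rw [Set.mem_ofPred_eq]; convert C.add_mem ha hb using 1; ext; simp
  smul_mem' := by
    intro r a ha
    rw [Set.mem_ofPred_eq]; convert C.smul_mem (algebraMap K κ r) ha using 1; ext; simp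

lemma mem_rationalWords {C : Submodule κ (Pt → κ)} {f : Pt → K} :
    f ∈ rationalWords K C ↔ (fun P => algebraMap K κ (f P)) ∈ C := Iff.rfl

/-- Galois descent: a Frobenius-stable code interpolating arbitrary values on `W` has rational
words interpolating arbitrary rational values on `W`. -/
lemma exists_rationalWords [Finite κ] {C : Submodule κ (Pt → κ)}
    (hσ : ∀ c ∈ C, (fun y => c y ^ Fintype.card K) ∈ C) {W : Finset Pt}
    (hW : ∀ v : Pt → κ, ∃ c ∈ C, ∀ y ∈ W, c y = v y) (v : Pt → K) :
    ∃ f ∈ rationalWords K C, ∀ y ∈ W, f y = v y := by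
  obtain ⟨l, hl⟩ := Algebra.trace_surjective K κ 1
  obtain ⟨c, hc, hcv⟩ := hW fun y => algebraMap K κ (v y) * l
  refine ⟨fun y => Algebra.trace K κ (c y), ?_, fun y hy => ?_⟩
  · rw [mem_rationalWords]
    have h1 : ∀ i : ℕ, (fun y => c y ^ Fintype.card K ^ i) ∈ C := by
      intro i
      induction i with
      | zero => simpa using hc
      | succ i ih => simpa [pow_succ, pow_mul] using hσ _ ih
    have : (fun y => algebraMap K κ (Algebra.trace K κ (c y))) =
        ∑ i ∈ Finset.range (finrank K κ), fun y => c y ^ Fintype.card K ^ i := by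
      ext y
      rw [FiniteField.algebraMap_trace_eq_sum_pow, Nat.card_eq_fintype_card]
      simp
    rw [this]
    exact C.sum_mem fun i _ => h1 i
  · simp only
    rw [hcv y hy, ← Algebra.smul_def, map_smul, hl]; simp

open Classical in
lemma card_rationalWords_le (C : Submodule κ (Pt → κ)) :
    (Finset.univ.filter fun f : Pt → K => f ∈ rationalWords K C).card ≤
      Fintype.card K ^ finrank κ C := by
  obtain ⟨I, -, hI, hIC⟩ := exists_information_set C Finset.univ
  calc _ ≤ Fintype.card (I → K) := by
        rw [← Finset.card_univ]
        refine Finset.card_le_card_of_injOn (fun f P => f P) (fun _ _ => Finset.mem_univ _) ?_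
        intro f hf g hg hfg
        have hf' : f ∈ rationalWords K C := by simpa using hf
        have hg' : g ∈ rationalWords K C := by simpa using hg
        have := hIC _ (mem_rationalWords.mp (sub_mem hf' hg')) (fun y hy => by
          have := congrFun hfg ⟨y, hy⟩
          simp only at this
          simp [this])
        ext y
        have h2 := this y (Finset.mem_univ _)
        rw [map_eq_zero] at h2
        exact sub_eq_zero.mp h2
    _ ≤ _ := by
        rw [Fintype.card_fun, Fintype.card_coe]
        exact Nat.pow_le_pow_right Fintype.card_pos hI

/-- The values of a product of two traces. -/
noncomputable def traceForm (F : Type) {K : Type} [Field F] [Fintype F] [Field K] [Algebra F K]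
    (c h₀ h₁ : K) : F :=
  Algebra.trace F K (c ^ 2 * h₀) + Algebra.trace F K (c ^ (Fintype.card F + 1) * h₁)

lemma eq_of_traceForm_eq_zero (h3 : finrank F K = 3) {c : Fin 3 → K}
    (hc : c ∈ goodTriples F K) {h₀ h₁ h₁' : K} (h : ∀ i, traceForm F (c i) h₀ h₁ = 0)
    (h' : ∀ i, traceForm F (c i) h₀ h₁' = 0) : h₁ = h₁' := by
  have hli := linearIndependent_pow_of_goodTriples h3 hc
  have hsp := hli.span_eq_top_of_card_eq_finrank (by simp [h3])
  have h1 : ∀ i, Algebra.trace F K (c i ^ (Fintype.card F + 1) * (h₁ - h₁')) = 0 := by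
    intro i
    have := (h i).trans (h' i).symm
    simp only [traceForm, add_right_inj] at this
    rw [mul_sub, map_sub, this, sub_self]
  have h2 : ∀ x : K, Algebra.trace F K (x * (h₁ - h₁')) = 0 := by
    intro x
    have hx : x ∈ Submodule.span F (Set.range fun i => c i ^ (Fintype.card F + 1)) := by
      rw [hsp]; trivial
    induction hx using Submodule.span_induction with
    | mem x hx => obtain ⟨i, rfl⟩ := hx; exact h1 i
    | zero => simp
    | add x y _ _ hx hy => rw [add_mul, map_add, hx, hy, add_zero]
    | smul a x _ hx => rw [smul_mul_assoc, map_smul, hx, smul_zero]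
  by_contra hne
  have hne' : h₁ - h₁' ≠ 0 := sub_ne_zero.mpr hne
  obtain ⟨l, hl⟩ := Algebra.trace_surjective F K 1
  have := h2 (l * (h₁ - h₁')⁻¹)
  rw [mul_assoc, inv_mul_cancel₀ hne', mul_one, hl] at this
  exact one_ne_zero this

lemma traceForm_add (c a b a' b' : K) :
    traceForm F c (a + a') (b + b') = traceForm F c a b + traceForm F c a' b' := by
  simp only [traceForm, mul_add, map_add]; ring

lemma traceForm_smul (c a b : K) (r : F) :
    traceForm F c (r • a) (r • b) = r * traceForm F c a b := by
  simp only [traceForm, mul_smul_comm, map_smul, smul_eq_mul]; ring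

variable [DecidableEq F] [DecidableEq K]

/-- A choice of expansion triples for which no word of the square coming from a nonzero `h₀`
has few nonzero blocks. -/
lemma exists_good_choice (h3 : finrank F K = 3) (H₀ H₁ : Submodule κ (Pt → κ)) (s D₀ D₁ Z₀ m : ℕ)
    (hD₀ : finrank κ H₀ ≤ D₀) (hD₁ : finrank κ H₁ ≤ D₁)
    (hZ₀ : ∀ c ∈ H₀, c ≠ 0 → ∀ Z : Finset Pt, (∀ y ∈ Z, c y = 0) → Z.card ≤ Z₀)
    (hs : s + D₁ + Z₀ + m ≤ Fintype.card Pt)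
    (hB : (2 * Fintype.card F ^ 2) ^ 3 ≤ (goodTriples F K).card)
    (hnum : Fintype.card K ^ D₀ * (Fintype.card Pt).choose s * ((2 * Fintype.card F ^ 2) ^ 3) ^ m <
      (goodTriples F K).card ^ m) :
    ∃ c : Pt → Fin 3 → K, (∀ P, c P ∈ goodTriples F K) ∧
      ∀ h₀ ∈ rationalWords K H₀, h₀ ≠ 0 → ∀ h₁ ∈ rationalWords K H₁, ∀ J : Finset Pt,
        J.card = s → ∃ P ∉ J, ∃ i, traceForm F (c P i) (h₀ P) (h₁ P) ≠ 0 := by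
  classical
  by_contra hcon
  push Not at hcon
  set T := goodTriples F K with hT
  set B := (2 * Fintype.card F ^ 2) ^ 3 with hBdef
  let H0 : Finset (Pt → K) := Finset.univ.filter fun f => f ∈ rationalWords K H₀
  let all : Finset (Pt → Fin 3 → K) := Fintype.piFinset fun _ => T
  let G : (Pt → K) → Finset Pt → Finset (Pt → Fin 3 → K) := fun h₀ J =>
    if h₀ = 0 then ∅ else all.filter fun c => ∃ h₁ ∈ rationalWords K H₁, ∀ P ∉ J, ∀ i,
      traceForm F (c P i) (h₀ P) (h₁ P) = 0
  have hcov : all ⊆ H0.biUnion fun h₀ =>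
      (Finset.univ.powersetCard s).biUnion fun J => G h₀ J := by
    intro c hc
    obtain ⟨h₀, hh₀, hne, h₁, hh₁, J, hJ, hz⟩ := hcon c (Fintype.mem_piFinset.mp hc)
    simp only [Finset.mem_biUnion]
    refine ⟨h₀, by simpa [H0] using hh₀, J, by simpa [Finset.mem_powersetCard] using hJ, ?_⟩
    simp only [G, hne, if_false, Finset.mem_filter]
    exact ⟨hc, h₁, hh₁, hz⟩
  have hGc : ∀ h₀ ∈ H0, ∀ J ∈ Finset.univ.powersetCard s,
      (G h₀ J).card ≤ T.card ^ (Fintype.card Pt - m) * B ^ m := by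
    intro h₀ hh₀ J hJ
    by_cases hne : h₀ = 0
    · simp [G, hne]
    have hh₀' : h₀ ∈ rationalWords K H₀ := by simpa [H0] using hh₀
    have hJ' : J.card = s := (Finset.mem_powersetCard.mp hJ).2
    obtain ⟨I, hIJ, hIc, hI⟩ := exists_information_set H₁ (Finset.univ \ J)
    let Z : Finset Pt := Finset.univ.filter fun P => h₀ P = 0
    have hZ : Z.card ≤ Z₀ := by
      refine hZ₀ _ (mem_rationalWords.mp hh₀') (fun h => hne ?_) Z fun y hy => ?_
      · ext P; simpa using congrFun h P
      · simpa [Z] using hy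
    let M := J ∪ I ∪ Z
    have hM : M.card + m ≤ Fintype.card Pt := by
      have h1 := Finset.card_union_le (J ∪ I) Z
      have h2 := Finset.card_union_le J I
      simp only [M]
      omega
    let S : (Pt → Fin 3 → K) → Pt → Finset (Fin 3 → K) := fun c P =>
      Finset.univ.filter fun b => (∀ y ∈ I, c y ∈ T) ∧ ∃ h₁ ∈ rationalWords K H₁,
        (∀ y ∈ I, ∀ i, traceForm F (c y i) (h₀ y) (h₁ y) = 0) ∧
          ∀ i, traceForm F (b i) (h₀ P) (h₁ P) = 0
    have hmain := card_constrained_le T M S B ?_ ?_ (G h₀ J) ?_ ?_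
    · refine hmain.trans ?_
      obtain ⟨k, hk⟩ := Nat.exists_eq_add_of_le hM
      have e1 : Fintype.card Pt - M.card = k + m := by omega
      have e2 : Fintype.card Pt - m = M.card + k := by omega
      rw [e1, e2, pow_add, pow_add, mul_assoc]
      gcongr
    · intro c c' hcc'
      have hI' : ∀ y ∈ I, c y = c' y := fun y hy => hcc' y (by simp [M, hy])
      funext P
      apply Finset.filter_congr
      intro b _
      refine and_congr (forall₂_congr fun y hy => by rw [hI' y hy])
        (exists_congr fun h₁ => and_congr_right fun _ => and_congr_left fun _ =>
          forall₂_congr fun y hy => by rw [hI' y hy])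
    · intro c P hP
      have hPJ : P ∉ J := fun h => hP (by simp [M, h])
      have hPZ : h₀ P ≠ 0 := fun h => hP (by simp [M, Z, h])
      rcases (S c P).eq_empty_or_nonempty with he | ⟨b₀, hb₀⟩
      · simp [he]
      obtain ⟨hcT, h₁, hh₁, hh₁c, -⟩ := (Finset.mem_filter.mp hb₀).2
      have hsub : S c P ⊆ Fintype.piFinset fun _ : Fin 3 => Finset.univ.filter fun x : K =>
          Algebra.trace F K (x ^ 2 * h₀ P) +
            Algebra.trace F K (x ^ (Fintype.card F + 1) * h₁ P) = 0 := by
        intro b hb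
        obtain ⟨-, h₁', hh₁', hh₁c', hb'⟩ := (Finset.mem_filter.mp hb).2
        have heq : h₁ P = h₁' P := by
          have := hI _ (mem_rationalWords.mp (sub_mem hh₁ hh₁')) (fun y hy => by
            simp [eq_of_traceForm_eq_zero h3 (hcT y hy) (hh₁c y hy) (hh₁c' y hy)]) P
              (by simp [hPJ])
          rw [map_eq_zero] at this
          exact sub_eq_zero.mp this
        refine Fintype.mem_piFinset.mpr fun i => ?_
        rw [heq]
        simpa [traceForm] using hb' i
      refine (Finset.card_le_card hsub).trans ?_
      rw [Fintype.card_piFinset, Finset.prod_const, Finset.card_univ, Fintype.card_fin]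
      exact Nat.pow_le_pow_left (card_trace_zeros_le h3 hPZ _) 3
    · intro c hc P
      simp only [G, hne, if_false, Finset.mem_filter] at hc
      exact Fintype.mem_piFinset.mp hc.1 P
    · intro c hc P hP
      simp only [G, hne, if_false, Finset.mem_filter] at hc
      obtain ⟨hcT, h₁, hh₁, hz⟩ := hc
      have hPJ : P ∉ J := fun h => hP (by simp [M, h])
      refine Finset.mem_filter.mpr ⟨Finset.mem_univ _, fun y _ => Fintype.mem_piFinset.mp hcT y,
        h₁, hh₁, fun y hy => hz y ?_, hz P hPJ⟩
      have := hIJ hy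
      simpa using this
  have hH0 : H0.card ≤ Fintype.card K ^ D₀ :=
    (card_rationalWords_le H₀).trans (Nat.pow_le_pow_right Fintype.card_pos hD₀)
  have hall : all.card = T.card ^ Fintype.card Pt := by simp [all]
  have hle : all.card ≤ H0.card * ((Fintype.card Pt).choose s *
      (T.card ^ (Fintype.card Pt - m) * B ^ m)) := by
    refine (Finset.card_le_card hcov).trans ((Finset.card_biUnion_le_card_mul _ _ _ ?_))
    intro h₀ hh₀
    refine (Finset.card_biUnion_le_card_mul _ _ _ (hGc h₀ hh₀)).trans (le_of_eq ?_)
    rw [Finset.card_powersetCard, Finset.card_univ]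
  have hTpos : 0 < T.card := by
    have : 0 < B := by have := Fintype.card_pos (α := F); positivity
    omega
  have hfin : T.card ^ Fintype.card Pt < T.card ^ Fintype.card Pt := by
    calc T.card ^ Fintype.card Pt ≤ _ := hall ▸ hle
      _ ≤ Fintype.card K ^ D₀ * ((Fintype.card Pt).choose s *
          (T.card ^ (Fintype.card Pt - m) * B ^ m)) := by gcongr
      _ = T.card ^ (Fintype.card Pt - m) *
          (Fintype.card K ^ D₀ * (Fintype.card Pt).choose s * B ^ m) := by ring
      _ < T.card ^ (Fintype.card Pt - m) * T.card ^ m := by gcongr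
      _ = _ := by rw [← pow_add]; congr 1; omega
  exact lt_irrefl _ hfin

/-- Expansion of words over `K` to words over `F` using a triple at each position. -/
noncomputable def expandMap (F : Type) {K Pt : Type} [Field F] [Field K] [Algebra F K]
    (c : Pt → Fin 3 → K) : (Pt → K) →ₗ[F] Pt × Fin 3 → F where
  toFun := fun f x => Algebra.trace F K (c x.1 x.2 * f x.1)
  map_add' := by intro f g; ext x; simp [mul_add]
  map_smul' := by intro r f; ext x; simp only [Pi.smul_apply, mul_smul_comm, map_smul]; rfl

/-- The expansion of a code over `K` to a code over `F` using a triple at each position. -/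
noncomputable def expandCode (F : Type) {K Pt : Type} [Field F] [Field K] [Algebra F K]
    (c : Pt → Fin 3 → K) (C : Submodule K (Pt → K)) : Submodule F (Pt × Fin 3 → F) :=
  (C.restrictScalars F).map (expandMap F c)

theorem exists_expanded_code [Finite κ] (h3 : finrank F K = 3) (C H₀ H₁ : Submodule κ (Pt → κ))
    (w s D₀ D₁ Z₀ Z₁ m : ℕ) (hs0 : s ≤ Fintype.card Pt) (hwn : w ≤ Fintype.card Pt)
    (hC : ∀ W : Finset Pt, W.card = w → ∀ v : Pt → κ, ∃ c ∈ C, ∀ y ∈ W, c y = v y)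
    (hσ : ∀ c ∈ C, (fun y => c y ^ Fintype.card K) ∈ C)
    (hH₀ : ∀ a ∈ C, ∀ b ∈ C, a * b ∈ H₀)
    (hH₁ : ∀ a ∈ C, ∀ b ∈ C, a ^ Fintype.card F * b ∈ H₁)
    (hD₀ : finrank κ H₀ ≤ D₀) (hD₁ : finrank κ H₁ ≤ D₁)
    (hZ₀ : ∀ c ∈ H₀, c ≠ 0 → ∀ Z : Finset Pt, (∀ y ∈ Z, c y = 0) → Z.card ≤ Z₀)
    (hZ₁ : ∀ c ∈ H₁, c ≠ 0 → ∀ Z : Finset Pt, (∀ y ∈ Z, c y = 0) → Z.card ≤ Z₁)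
    (hs : s + D₁ + Z₀ + m ≤ Fintype.card Pt)
    (hB : (2 * Fintype.card F ^ 2) ^ 3 ≤ (goodTriples F K).card)
    (hnum : Fintype.card K ^ D₀ * (Fintype.card Pt).choose s * ((2 * Fintype.card F ^ 2) ^ 3) ^ m <
      (goodTriples F K).card ^ m) :
    ∃ D : Submodule F (Pt × Fin 3 → F),
      (∀ y : Pt × Fin 3 → F, y ≠ 0 → (∀ x ∈ D, ∑ i, y i * x i = 0) → w < hammingNorm y) ∧
      ∀ z ∈ Submodule.span F {z | ∃ a ∈ D, ∃ b ∈ D, z = a * b}, z ≠ 0 →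
        Fintype.card Pt ≤ hammingNorm z + Z₁ ∨ s < hammingNorm z := by
  classical
  obtain ⟨c, hcT, hc⟩ := exists_good_choice (F := F) (K := K) h3 H₀ H₁ s D₀ D₁ Z₀ m hD₀ hD₁ hZ₀ hs
    hB hnum
  refine ⟨expandCode F c (rationalWords K C), ?_, ?_⟩
  · intro y hy hyD
    by_contra! hle
    let z : Pt → K := fun P => ∑ i, y (P, i) • c P i
    let supp : Finset Pt := (Finset.univ.filter fun x => y x ≠ 0).image Prod.fst
    have hsupp : supp.card ≤ w := Finset.card_image_le.trans (by simpa [hammingNorm] using hle)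
    obtain ⟨W, hWs, hWc⟩ := Finset.exists_superset_card_eq hsupp hwn
    have hz0 : ∀ P ∉ W, z P = 0 := by
      intro P hP
      refine Finset.sum_eq_zero fun i _ => ?_
      have : y (P, i) = 0 := by
        by_contra h
        exact hP (hWs (Finset.mem_image.mpr ⟨(P, i), by simp [h], rfl⟩))
      rw [this, zero_smul]
    obtain ⟨⟨P₀, i₀⟩, hx⟩ := Function.ne_iff.mp hy
    have hzP : z P₀ ≠ 0 := by
      intro h
      have hli := (mem_goodTriples.mp (hcT P₀)).1
      exact hx (Fintype.linearIndependent_iff.mp hli (fun i => y (P₀, i)) h i₀)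
    obtain ⟨l, hl⟩ := Algebra.trace_surjective F K 1
    obtain ⟨f, hf, hfv⟩ := exists_rationalWords (K := K) hσ (hC W hWc)
      (fun P => if P = P₀ then (z P₀)⁻¹ * l else 0)
    have h1 := hyD _ (Submodule.mem_map_of_mem (f := expandMap F c)
      (p := (rationalWords K C).restrictScalars F) hf)
    simp only [expandMap, LinearMap.coe_mk, AddHom.coe_mk] at h1
    rw [Fintype.sum_prod_type] at h1
    have h2 : ∀ P, ∑ i, y (P, i) * Algebra.trace F K (c P i * f P) =
        Algebra.trace F K (z P * f P) := by
      intro P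
      simp only [z, Finset.sum_mul, map_sum, smul_mul_assoc, map_smul, smul_eq_mul]
    simp only [h2] at h1
    rw [Finset.sum_eq_single P₀] at h1
    · have hP₀ : P₀ ∈ W := by
        by_contra h; exact hzP (hz0 _ h)
      rw [hfv _ hP₀, if_pos rfl, mul_inv_cancel_left₀ hzP, hl] at h1
      exact one_ne_zero h1
    · intro P _ hP
      by_cases hPW : P ∈ W
      · rw [hfv _ hPW, if_neg hP]; simp
      · rw [hz0 _ hPW]; simp
    · simp
  · intro z hz hz0
    obtain ⟨h₀, hh₀, h₁, hh₁, rfl⟩ : ∃ h₀ ∈ rationalWords K H₀, ∃ h₁ ∈ rationalWords K H₁,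
        z = fun x => traceForm F (c x.1 x.2) (h₀ x.1) (h₁ x.1) := by
      clear hz0
      induction hz using Submodule.span_induction with
      | mem z hz =>
        obtain ⟨-, ⟨f, hf, rfl⟩, -, ⟨g, hg, rfl⟩, rfl⟩ := hz
        refine ⟨f * g, ?_, f ^ Fintype.card F * g + g ^ Fintype.card F * f, add_mem ?_ ?_, ?_⟩
        · have := hH₀ _ (mem_rationalWords.mp hf) _ (mem_rationalWords.mp hg)
          rw [mem_rationalWords]; convert this using 1; ext P; simp
        · have := hH₁ _ (mem_rationalWords.mp hf) _ (mem_rationalWords.mp hg)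
          rw [mem_rationalWords]; convert this using 1; ext P; simp
        · have := hH₁ _ (mem_rationalWords.mp hg) _ (mem_rationalWords.mp hf)
          rw [mem_rationalWords]; convert this using 1; ext P; simp
        · ext x
          exact trace_mul_trace h3 (c x.1 x.2) (f x.1) (g x.1)
      | zero => exact ⟨0, zero_mem _, 0, zero_mem _, by ext; simp [traceForm]⟩
      | add z z' _ _ hz hz' =>
        obtain ⟨a, ha, b, hb, rfl⟩ := hz
        obtain ⟨a', ha', b', hb', rfl⟩ := hz'
        exact ⟨a + a', add_mem ha ha', b + b', add_mem hb hb', by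
          ext x; simp [traceForm_add]⟩
      | smul r z _ hz =>
        obtain ⟨a, ha, b, hb, rfl⟩ := hz
        refine ⟨r • a, ?_, r • b, ?_, by ext x; simp [traceForm_smul]⟩
        · simpa [algebraMap_smul] using (rationalWords K H₀).smul_mem (algebraMap F K r) ha
        · simpa [algebraMap_smul] using (rationalWords K H₁).smul_mem (algebraMap F K r) hb
    set z : Pt × Fin 3 → F := fun x => traceForm F (c x.1 x.2) (h₀ x.1) (h₁ x.1) with hz
    let supp : Finset Pt := (Finset.univ.filter fun x => z x ≠ 0).image Prod.fst
    have hsupp : supp.card ≤ hammingNorm z := Finset.card_image_le.trans (by simp [hammingNorm])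
    have hout : ∀ P ∉ supp, ∀ i, z (P, i) = 0 := by
      intro P hP i
      by_contra h
      exact hP (Finset.mem_image.mpr ⟨(P, i), by simp [h], rfl⟩)
    by_cases h0 : h₀ = 0
    · left
      have hne : h₁ ≠ 0 := by
        rintro rfl
        apply hz0
        ext x
        simp [hz, h0, traceForm]
      have hZ := hZ₁ _ (mem_rationalWords.mp hh₁) (fun h => hne (by
        ext P; simpa using congrFun h P)) (Finset.univ \ supp) (fun P hP => by
          have h1 : ∀ i, traceForm F (c P i) 0 (h₁ P) = 0 := fun i => by
            have := hout P (by simpa using hP) i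
            simpa [hz, h0] using this
          have h2 : ∀ i, traceForm F (c P i) 0 0 = 0 := fun i => by simp [traceForm]
          rw [eq_of_traceForm_eq_zero h3 (hcT P) h1 h2, map_zero])
      have := Finset.card_sdiff_add_card_eq_card (Finset.subset_univ supp)
      rw [Finset.card_univ] at this
      omega
    · right
      by_contra! hle
      obtain ⟨J, hJs, hJc⟩ := Finset.exists_superset_card_eq (hsupp.trans hle) hs0
      obtain ⟨P, hP, i, hi⟩ := hc h₀ hh₀ h0 h₁ hh₁ J hJc
      exact hi (hout P (fun h => hP (hJs h)) i)

end Concatenation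

end

section

open Polynomial Module

section Theta

variable (F : Type) [Field F] [Fintype F] {R S : Type} [CommRing R] [Algebra F R]
  [CommRing S] [Algebra F S]

/-- The `F`-linear operator `x ↦ x + g x^{q²} + x^{q³}`. -/
noncomputable def theta (g : R) : Module.End F R :=
  LinearMap.id + LinearMap.mulLeft F g ∘ₗ (FiniteField.frobeniusAlgHom F R ^ 2).toLinearMap +
    (FiniteField.frobeniusAlgHom F R ^ 3).toLinearMap

lemma theta_apply (g x : R) :
    theta F g x = x + g * x ^ Fintype.card F ^ 2 + x ^ Fintype.card F ^ 3 := by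
  simp [theta, ← pow_mul, pow_succ]

lemma add_pow_card_pow (n : ℕ) (x y : R) :
    (x + y) ^ Fintype.card F ^ n = x ^ Fintype.card F ^ n + y ^ Fintype.card F ^ n := by
  have h : ∀ (x : R), (FiniteField.frobeniusAlgHom F R ^ n) x = x ^ Fintype.card F ^ n := by
    intro x
    induction n with
    | zero => simp
    | succ n ih => rw [pow_succ', AlgHom.mul_apply, ih]; simp [← pow_mul, pow_succ]
  rw [← h, ← h, ← h, map_add]

lemma sub_pow_card_pow (n : ℕ) (x y : R) :
    (x - y) ^ Fintype.card F ^ n = x ^ Fintype.card F ^ n - y ^ Fintype.card F ^ n := by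
  rw [eq_sub_iff_add_eq, ← add_pow_card_pow F, sub_add_cancel]

variable {F}

lemma map_theta (f : R →ₐ[F] S) (g x : R) : f (theta F g x) = theta F (f g) (f x) := by
  simp [theta_apply]

lemma map_aeval_theta (f : R →ₐ[F] S) (g x : R) (b : F[X]) :
    f (aeval (theta F g) b x) = aeval (theta F (f g)) b (f x) := by
  have hpow : ∀ n : ℕ, f ((theta F g ^ n) x) = (theta F (f g) ^ n) (f x) := by
    intro n
    induction n with
    | zero => simp
    | succ n ih => rw [pow_succ', pow_succ', Module.End.mul_apply, Module.End.mul_apply,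
        map_theta, ih]
  rw [aeval_eq_sum_range, aeval_eq_sum_range]
  simp [LinearMap.sum_apply, hpow]

end Theta

section Levels

variable {F : Type} [Field F] [Fintype F] {E : Type} [NormedField E] [IsUltrametricDist E]
  [Algebra F E] {g : E}

local notation "q" => Fintype.card F

lemma norm_algebraMap_eq_one {a : F} (ha : a ≠ 0) : ‖algebraMap F E a‖ = 1 := by
  have h1 : ‖algebraMap F E a‖ ^ (q - 1) = 1 := by
    rw [← norm_pow, ← map_pow, FiniteField.pow_card_sub_one_eq_one a ha, map_one, norm_one]
  have : q - 1 ≠ 0 := by have := Fintype.one_lt_card (α := F); omega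
  exact (pow_eq_one_iff_of_nonneg (norm_nonneg _) this).mp h1

lemma norm_smul_finite {a : F} (ha : a ≠ 0) (x : E) : ‖a • x‖ = ‖x‖ := by
  rw [Algebra.smul_def, norm_mul, norm_algebraMap_eq_one ha, one_mul]

lemma norm_smul_finite_le (a : F) (x : E) : ‖a • x‖ ≤ ‖x‖ := by
  rcases eq_or_ne a 0 with rfl | h
  · simp
  · exact (norm_smul_finite h x).le

/-- The logarithmic size of an element relative to `g`. -/
noncomputable def lev (g x : E) : ℝ := Real.logb ‖g‖ ‖x‖

lemma lev_lt_lev (hg : 1 < ‖g‖) {x y : E} (hx : x ≠ 0) (hy : y ≠ 0) :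
    lev g x < lev g y ↔ ‖x‖ < ‖y‖ :=
  Real.logb_lt_logb_iff hg (norm_pos_iff.mpr hx) (norm_pos_iff.mpr hy)

lemma lev_le_lev (hg : 1 < ‖g‖) {x y : E} (hx : x ≠ 0) (hy : y ≠ 0) :
    lev g x ≤ lev g y ↔ ‖x‖ ≤ ‖y‖ :=
  Real.logb_le_logb hg (norm_pos_iff.mpr hx) (norm_pos_iff.mpr hy)

lemma lev_mul {x y : E} (hx : x ≠ 0) (hy : y ≠ 0) : lev g (x * y) = lev g x + lev g y := by
  rw [lev, norm_mul, Real.logb_mul (norm_ne_zero_iff.mpr hx) (norm_ne_zero_iff.mpr hy)]; rfl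

lemma lev_pow (x : E) (n : ℕ) : lev g (x ^ n) = n * lev g x := by
  rw [lev, norm_pow, Real.logb_pow]; rfl

lemma lev_self (hg : 1 < ‖g‖) : lev g g = 1 := Real.logb_self_eq_one hg

lemma norm_eq_rpow_lev (hg : 1 < ‖g‖) {x : E} (hx : x ≠ 0) : ‖x‖ = ‖g‖ ^ lev g x :=
  (Real.rpow_logb (by positivity) hg.ne' (norm_pos_iff.mpr hx)).symm

lemma lev_lt_iff (hg : 1 < ‖g‖) {x : E} (hx : x ≠ 0) (r : ℝ) : lev g x < r ↔ ‖x‖ < ‖g‖ ^ r :=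
  Real.logb_lt_iff_lt_rpow hg (norm_pos_iff.mpr hx)

lemma lev_le_iff (hg : 1 < ‖g‖) {x : E} (hx : x ≠ 0) (r : ℝ) : lev g x ≤ r ↔ ‖x‖ ≤ ‖g‖ ^ r :=
  Real.logb_le_iff_le_rpow hg (norm_pos_iff.mpr hx)

lemma ne_zero_of_one_lt_norm (hg : 1 < ‖g‖) : g ≠ 0 := by
  rintro rfl; simp at hg; linarith

variable (F) in
/-- The generic lower level. -/
noncomputable def levBot : ℝ := -1 / ((q : ℝ) ^ 2 - 1)

variable (F) in
/-- The top level. -/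
noncomputable def levTop : ℝ := 1 / ((q : ℝ) ^ 3 - (q : ℝ) ^ 2)

variable (F) in
lemma two_le_card : (2 : ℝ) ≤ q := by
  exact_mod_cast Fintype.one_lt_card (α := F)

variable (F) in
lemma levBot_spec : 1 + (q : ℝ) ^ 2 * levBot F = levBot F := by
  have := two_le_card F
  have : (q : ℝ) ^ 2 - 1 ≠ 0 := by nlinarith
  rw [levBot]; field_simp; ring

variable (F) in
lemma levTop_spec : 1 + (q : ℝ) ^ 2 * levTop F = (q : ℝ) ^ 3 * levTop F := by
  have := two_le_card F
  have h : (q : ℝ) ^ 3 - q ^ 2 = q ^ 2 * (q - 1) := by ring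
  have h1 : (q : ℝ) - 1 ≠ 0 := by linarith
  have h2 : (q : ℝ) ≠ 0 := by linarith
  rw [levTop, h]; field_simp; ring

variable (F) in
lemma levBot_neg : levBot F < 0 := by
  have := two_le_card F
  exact div_neg_of_neg_of_pos (by norm_num) (by nlinarith)

variable (F) in
lemma levTop_pos : 0 < levTop F := by
  have := two_le_card F
  have : (q : ℝ) ^ 3 - q ^ 2 = q ^ 2 * (q - 1) := by ring
  rw [levTop, this]
  have h : (0 : ℝ) < q - 1 := by linarith
  positivity

lemma lev_mul_pow (hg : 1 < ‖g‖) {x : E} (hx : x ≠ 0) (n : ℕ) :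
    lev g (g * x ^ n) = 1 + n * lev g x := by
  rw [lev_mul (ne_zero_of_one_lt_norm hg) (pow_ne_zero _ hx), lev_self hg, lev_pow]

lemma norm_add_three_eq_middle {a b c : E} (h1 : ‖a‖ < ‖b‖) (h2 : ‖c‖ < ‖b‖) :
    ‖a + b + c‖ = ‖b‖ := by
  have h3 : ‖a + b‖ = ‖b‖ := by
    rw [IsUltrametricDist.norm_add_eq_max_of_norm_ne_norm h1.ne, max_eq_right h1.le]
  rw [IsUltrametricDist.norm_add_eq_max_of_norm_ne_norm (by rw [h3]; exact h2.ne'), h3,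
    max_eq_left h2.le]

lemma theta_ne_zero_of_norm {x y : E} (hy : y ≠ 0) (h : ‖theta F g x‖ = ‖y‖) :
    theta F g x ≠ 0 := by
  rw [← norm_pos_iff, h]; exact norm_pos_iff.mpr hy

lemma lev_theta_of_mid (hg : 1 < ‖g‖) {x : E} (hx : x ≠ 0) (h1 : levBot F < lev g x)
    (h2 : lev g x < levTop F) :
    theta F g x ≠ 0 ∧ lev g (theta F g x) = 1 + (q : ℝ) ^ 2 * lev g x := by
  have hq := two_le_card F
  have hg0 := ne_zero_of_one_lt_norm hg
  have hne : g * x ^ q ^ 2 ≠ 0 := mul_ne_zero hg0 (pow_ne_zero _ hx)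
  have e2 : lev g (g * x ^ q ^ 2) = 1 + (q : ℝ) ^ 2 * lev g x := by
    rw [lev_mul_pow hg hx]; push_cast; ring
  have e3 : lev g (x ^ q ^ 3) = (q : ℝ) ^ 3 * lev g x := by rw [lev_pow]; push_cast; ring
  have h3 : ‖theta F g x‖ = ‖g * x ^ q ^ 2‖ := by
    rw [theta_apply]
    apply norm_add_three_eq_middle
    · rw [← lev_lt_lev hg hx hne, e2]
      have := levBot_spec F
      nlinarith [mul_pos (show (0:ℝ) < (q:ℝ)^2 - 1 by nlinarith) (sub_pos.mpr h1)]
    · rw [← lev_lt_lev hg (pow_ne_zero _ hx) hne, e2, e3]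
      have := levTop_spec F
      have h4 : (0 : ℝ) < (q : ℝ) ^ 3 - q ^ 2 := by
        have : (q : ℝ) ^ 3 - q ^ 2 = q ^ 2 * (q - 1) := by ring
        rw [this]
        have : (0 : ℝ) < q - 1 := by linarith
        positivity
      nlinarith [mul_pos h4 (sub_pos.mpr h2)]
  refine ⟨theta_ne_zero_of_norm hne h3, ?_⟩
  rw [← e2, lev, h3]; rfl

lemma lev_theta_of_top_lt (hg : 1 < ‖g‖) {x : E} (hx : x ≠ 0) (h : levTop F < lev g x) :
    theta F g x ≠ 0 ∧ lev g (theta F g x) = (q : ℝ) ^ 3 * lev g x := by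
  have hq := two_le_card F
  have hg0 := ne_zero_of_one_lt_norm hg
  have hne : g * x ^ q ^ 2 ≠ 0 := mul_ne_zero hg0 (pow_ne_zero _ hx)
  have e2 : lev g (g * x ^ q ^ 2) = 1 + (q : ℝ) ^ 2 * lev g x := by
    rw [lev_mul_pow hg hx]; push_cast; ring
  have e3 : lev g (x ^ q ^ 3) = (q : ℝ) ^ 3 * lev g x := by rw [lev_pow]; push_cast; ring
  have hpos := levTop_pos F
  have h3 : ‖theta F g x‖ = ‖x ^ q ^ 3‖ := by
    rw [theta_apply, add_right_comm]
    apply norm_add_three_eq_middle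
    · rw [← lev_lt_lev hg hx (pow_ne_zero _ hx), e3]
      have : (8 : ℝ) ≤ (q : ℝ) ^ 3 := by
        calc (8 : ℝ) = 2 ^ 3 := by norm_num
          _ ≤ _ := by gcongr
      nlinarith
    · rw [← lev_lt_lev hg hne (pow_ne_zero _ hx), e2, e3]
      have := levTop_spec F
      have h4 : (0 : ℝ) < (q : ℝ) ^ 3 - q ^ 2 := by
        have : (q : ℝ) ^ 3 - q ^ 2 = q ^ 2 * (q - 1) := by ring
        rw [this]
        have : (0 : ℝ) < q - 1 := by linarith
        positivity
      nlinarith [mul_pos h4 (sub_pos.mpr h)]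
  refine ⟨theta_ne_zero_of_norm (pow_ne_zero _ hx) h3, ?_⟩
  rw [← e3, lev, h3]; rfl

lemma norm_theta_sub_le (hg : 1 < ‖g‖) {x : E} (hx : x ≠ 0) (h : lev g x ≤ levBot F) :
    ‖theta F g x - x‖ ≤ ‖x‖ ∧ (lev g x < levBot F → ‖theta F g x - x‖ < ‖x‖) := by
  have hq := two_le_card F
  have hg0 := ne_zero_of_one_lt_norm hg
  have hne : g * x ^ q ^ 2 ≠ 0 := mul_ne_zero hg0 (pow_ne_zero _ hx)
  have e2 : lev g (g * x ^ q ^ 2) = 1 + (q : ℝ) ^ 2 * lev g x := by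
    rw [lev_mul_pow hg hx]; push_cast; ring
  have e3 : lev g (x ^ q ^ 3) = (q : ℝ) ^ 3 * lev g x := by rw [lev_pow]; push_cast; ring
  have e : theta F g x - x = g * x ^ q ^ 2 + x ^ q ^ 3 := by rw [theta_apply]; ring
  have hneg := levBot_neg F
  have hs := levBot_spec F
  have h3 : ‖x ^ q ^ 3‖ < ‖x‖ := by
    rw [← lev_lt_lev hg (pow_ne_zero _ hx) hx, e3]
    have : (8 : ℝ) ≤ (q : ℝ) ^ 3 := by
      calc (8 : ℝ) = 2 ^ 3 := by norm_num
        _ ≤ _ := by gcongr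
    nlinarith
  have h4 : (0 : ℝ) < (q : ℝ) ^ 2 - 1 := by nlinarith
  constructor
  · rw [e]
    refine (IsUltrametricDist.norm_add_le_max _ _).trans (max_le ?_ h3.le)
    rw [← lev_le_lev hg hne hx, e2]
    nlinarith [mul_nonneg h4.le (sub_nonneg.mpr h)]
  · intro h'
    rw [e]
    refine (IsUltrametricDist.norm_add_le_max _ _).trans_lt (max_lt ?_ h3)
    rw [← lev_lt_lev hg hne hx, e2]
    nlinarith [mul_pos h4 (sub_pos.mpr h')]

lemma norm_theta_le (hg : 1 < ‖g‖) {x : E} (h : x ≠ 0 → lev g x ≤ levBot F) :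
    ‖theta F g x‖ ≤ ‖x‖ := by
  rcases eq_or_ne x 0 with rfl | hx
  · simp
  have := (norm_theta_sub_le hg hx (h hx)).1
  calc ‖theta F g x‖ = ‖(theta F g x - x) + x‖ := by rw [sub_add_cancel]
    _ ≤ max _ _ := IsUltrametricDist.norm_add_le_max _ _
    _ ≤ _ := max_le this le_rfl

lemma norm_aeval_theta_le (hg : 1 < ‖g‖) {x : E} (h : x ≠ 0 → lev g x ≤ levBot F) (b : F[X]) :
    ‖aeval (theta F g) b x‖ ≤ ‖x‖ := by
  have key : ∀ n : ℕ, ‖(theta F g ^ n) x‖ ≤ ‖x‖ := by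
    intro n
    induction n with
    | zero => simp
    | succ n ih =>
      rw [pow_succ', Module.End.mul_apply]
      refine (norm_theta_le hg fun h0 => ?_).trans ih
      have hx : x ≠ 0 := by rintro rfl; simp at h0
      exact ((lev_le_lev hg h0 hx).mpr ih).trans (h hx)
  rw [aeval_eq_sum_range, LinearMap.sum_apply]
  refine IsUltrametricDist.norm_sum_le_of_forall_le_of_nonneg (norm_nonneg _) fun i _ => ?_
  exact (norm_smul_finite_le _ _).trans (key i)

end Levels

end

section

open Polynomial Module

section Torsion

variable {F : Type} [Field F] [Fintype F] {E : Type} [NormedField E] [IsUltrametricDist E]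
  [Algebra F E] {g : E} {N : F[X]}

local notation "q" => Fintype.card F

lemma norm_sub_le_max_norm (x y : E) : ‖x - y‖ ≤ max ‖x‖ ‖y‖ := by
  rw [sub_eq_add_neg, ← norm_neg y]
  exact IsUltrametricDist.norm_add_le_max _ _

/-- The kernel of `φ_N`. -/
noncomputable def torsion (g : E) (N : F[X]) : Submodule F E := LinearMap.ker (aeval (theta F g) N)

lemma mem_torsion {x : E} : x ∈ torsion g N ↔ aeval (theta F g) N x = 0 := LinearMap.mem_ker

lemma aeval_theta_mem (b : F[X]) {x : E} (hx : x ∈ torsion g N) :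
    aeval (theta F g) b x ∈ torsion g N := by
  rw [mem_torsion] at *
  rw [← Module.End.mul_apply, ← map_mul, mul_comm, map_mul, Module.End.mul_apply, hx, map_zero]

lemma theta_pow_mem (i : ℕ) {x : E} (hx : x ∈ torsion g N) : (theta F g ^ i) x ∈ torsion g N := by
  simpa using aeval_theta_mem (X ^ i) hx

lemma theta_pow_succ_apply (i : ℕ) (x : E) :
    (theta F g ^ (i + 1)) x = theta F g ((theta F g ^ i) x) := by
  rw [pow_succ', Module.End.mul_apply]

lemma not_forall_norm_lt (hN : N.Monic) (hd : 1 ≤ N.natDegree) {x : E} (hx : x ∈ torsion g N) :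
    ¬ ∀ i < N.natDegree, ‖(theta F g ^ i) x‖ < ‖(theta F g ^ (i + 1)) x‖ := by
  intro h
  rw [mem_torsion, aeval_eq_sum_range, Finset.sum_range_succ, hN.coeff_natDegree, one_smul,
    LinearMap.add_apply, LinearMap.sum_apply] at hx
  have hmono : ∀ i k, i + k + 1 ≤ N.natDegree →
      ‖(theta F g ^ i) x‖ < ‖(theta F g ^ (i + k + 1)) x‖ := by
    intro i k
    induction k with
    | zero => intro hk; exact h i (by omega)
    | succ k ih => intro hk; exact (ih (by omega)).trans (h _ (by omega))
  obtain ⟨i, hi, hle⟩ := IsUltrametricDist.exists_norm_finsetSum_le_of_nonempty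
    (t := Finset.range N.natDegree) ⟨0, Finset.mem_range.mpr hd⟩
    (fun i => (N.coeff i • theta F g ^ i) x)
  rw [Finset.mem_range] at hi
  have h1 : ‖(theta F g ^ N.natDegree) x‖ ≤ ‖(theta F g ^ i) x‖ := by
    rw [← norm_neg, ← eq_neg_of_add_eq_zero_left hx]
    exact hle.trans (norm_smul_finite_le _ _)
  obtain ⟨k, hk⟩ := Nat.exists_eq_add_of_lt hi
  exact absurd (hk ▸ hmono i k (by omega)) (not_lt.mpr h1)

variable (hg : 1 < ‖g‖)

section

include hg

lemma lev_le_levTop (hN : N.Monic) (hd : 1 ≤ N.natDegree) {x : E} (hx : x ∈ torsion g N)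
    (hx0 : x ≠ 0) : lev g x ≤ levTop F := by
  by_contra! hlt
  have hq := two_le_card F
  have hpos := levTop_pos F
  have h8 : (8 : ℝ) ≤ (q : ℝ) ^ 3 := by
    calc (8 : ℝ) = 2 ^ 3 := by norm_num
      _ ≤ _ := by gcongr
  have key : ∀ i, (theta F g ^ i) x ≠ 0 ∧ levTop F < lev g ((theta F g ^ i) x) := by
    intro i
    induction i with
    | zero => simpa using ⟨hx0, hlt⟩
    | succ i ih =>
      rw [theta_pow_succ_apply]
      obtain ⟨h1, h2⟩ := lev_theta_of_top_lt (F := F) hg ih.1 ih.2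
      refine ⟨h1, ?_⟩
      rw [h2]; nlinarith [ih.2]
  refine not_forall_norm_lt hN hd hx fun i _ => ?_
  rw [← lev_lt_lev hg (key i).1 (key (i + 1)).1, theta_pow_succ_apply,
    (lev_theta_of_top_lt (F := F) hg (key i).1 (key i).2).2]
  nlinarith [(key i).2]

end

variable (F) in
/-- The possible levels of torsion elements above the generic one. -/
noncomputable def lvl (j : ℕ) : ℝ := levBot F + (levTop F - levBot F) / ((q : ℝ) ^ 2) ^ j

variable (F) in
lemma levBot_lt_lvl (j : ℕ) : levBot F < lvl F j := by
  have hq := two_le_card F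
  have := levTop_pos F
  have := levBot_neg F
  rw [lvl, lt_add_iff_pos_right]
  apply div_pos (by linarith) (by positivity)

variable (F) in
lemma lvl_strictAnti : StrictAnti (lvl F) := by
  have hq := two_le_card F
  have := levTop_pos F
  have := levBot_neg F
  refine strictAnti_nat_of_succ_lt fun j => ?_
  rw [lvl, lvl, add_lt_add_iff_left]
  apply div_lt_div_of_pos_left (by linarith) (by positivity)
  exact pow_lt_pow_right₀ (by nlinarith) (Nat.lt_succ_self j)

include hg

lemma exists_level (hN : N.Monic) (hd : 1 ≤ N.natDegree) {x : E} (hx : x ∈ torsion g N)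
    (hx0 : x ≠ 0) (hlev : levBot F < lev g x) :
    ∃ j < N.natDegree, lev g x = lvl F j ∧ (theta F g ^ j) x ≠ 0 ∧
      lev g ((theta F g ^ j) x) = levTop F := by
  have hq := two_le_card F
  have hq2 : (1 : ℝ) < (q : ℝ) ^ 2 := by nlinarith
  have hspec := levBot_spec F
  have key : ∀ k, (∀ i < k, (theta F g ^ i) x ≠ 0 → lev g ((theta F g ^ i) x) ≠ levTop F) →
      (theta F g ^ k) x ≠ 0 ∧ lev g ((theta F g ^ k) x) =
        levBot F + ((q : ℝ) ^ 2) ^ k * (lev g x - levBot F) := by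
    intro k
    induction k with
    | zero => intro _; simpa using hx0
    | succ k ih =>
      intro hk
      obtain ⟨h1, h2⟩ := ih fun i hi => hk i (by omega)
      have h3 : levBot F < lev g ((theta F g ^ k) x) := by
        rw [h2]
        have : 0 < ((q : ℝ) ^ 2) ^ k * (lev g x - levBot F) := by
          apply mul_pos (by positivity); linarith
        linarith
      have h4 := lt_of_le_of_ne (lev_le_levTop hg hN hd (theta_pow_mem k hx) h1) (hk k (by omega) h1)
      obtain ⟨h5, h6⟩ := lev_theta_of_mid (F := F) hg h1 h3 h4
      rw [theta_pow_succ_apply]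
      refine ⟨h5, ?_⟩
      rw [h6, h2, pow_succ]; linear_combination hspec
  have hex : ∃ j, (theta F g ^ j) x ≠ 0 ∧ lev g ((theta F g ^ j) x) = levTop F ∧
      j < N.natDegree := by
    by_contra! hcon
    have hk : ∀ i < N.natDegree, (theta F g ^ i) x ≠ 0 →
        lev g ((theta F g ^ i) x) ≠ levTop F := fun i hi h1 h2 =>
      absurd (hcon i h1 h2) (not_le.mpr hi)
    refine not_forall_norm_lt hN hd hx fun i hi => ?_
    obtain ⟨h1, h2⟩ := key i fun j hj => hk j (by omega)
    obtain ⟨h3, h4⟩ := key (i + 1) fun j hj => hk j (by omega)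
    rw [← lev_lt_lev hg h1 h3, h2, h4, pow_succ ((q : ℝ) ^ 2) i]
    have : 0 < ((q : ℝ) ^ 2) ^ i * (lev g x - levBot F) := by
      apply mul_pos (by positivity); linarith
    have e : ((q : ℝ) ^ 2) ^ i * (q : ℝ) ^ 2 * (lev g x - levBot F) =
      (q : ℝ) ^ 2 * (((q : ℝ) ^ 2) ^ i * (lev g x - levBot F)) := by ring
    rw [e]
    nlinarith
  classical
  obtain ⟨h1, h2, h3⟩ := Nat.find_spec hex
  have hmin := key (Nat.find hex) fun i hi h4 h5 => Nat.find_min hex hi ⟨h4, h5, by omega⟩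
  refine ⟨_, h3, ?_, h1, h2⟩
  have h4 := hmin.2
  rw [h2] at h4
  rw [lvl]
  have : ((q : ℝ) ^ 2) ^ Nat.find hex ≠ 0 := by positivity
  field_simp
  linear_combination -h4

lemma lev_eq_levBot (hN : N.eval 1 ≠ 0) {x : E} (hx : x ∈ torsion g N) (hx0 : x ≠ 0)
    (h : lev g x ≤ levBot F) : lev g x = levBot F := by
  by_contra hne
  have hlt := lt_of_le_of_ne h hne
  have h1 := (norm_theta_sub_le (F := F) hg hx0 h).2 hlt
  obtain ⟨Q, hQ⟩ := X_sub_C_dvd_sub_C_eval (a := (1 : F)) (p := N)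
  have h2 : N = Q * (X - C 1) + C (N.eval 1) := by rw [mul_comm, ← hQ]; ring
  rw [mem_torsion, h2, map_add, map_mul, LinearMap.add_apply, Module.End.mul_apply] at hx
  simp only [map_sub, aeval_X, map_one, LinearMap.sub_apply, Module.End.one_apply, aeval_C,
    Module.algebraMap_end_apply] at hx
  have h3 : ‖x‖ ≤ ‖theta F g x - x‖ := by
    rw [← norm_smul_finite hN x, ← norm_neg, ← eq_neg_of_add_eq_zero_left hx]
    have := norm_aeval_theta_le (F := F) hg (x := theta F g x - x)
      (fun h0 => ((lev_lt_lev hg h0 hx0).mpr h1).le.trans h) Q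
    rwa [map_sub] at this
  linarith

omit hg in
/-- The subspace of the torsion of elements of bounded norm. -/
noncomputable def torsionLe (g : E) (N : F[X]) (r : ℝ) : Submodule F E where
  carrier := {x | x ∈ torsion g N ∧ ‖x‖ ≤ ‖g‖ ^ r}
  zero_mem' := ⟨zero_mem _, by simpa using Real.rpow_nonneg (norm_nonneg g) r⟩
  add_mem' := fun hx hy => ⟨add_mem hx.1 hy.1,
    (IsUltrametricDist.norm_add_le_max _ _).trans (max_le hx.2 hy.2)⟩
  smul_mem' := fun a _ hx => ⟨Submodule.smul_mem _ a hx.1, (norm_smul_finite_le _ _).trans hx.2⟩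

lemma mem_torsionLe {r : ℝ} {x : E} (hx0 : x ≠ 0) :
    x ∈ torsionLe g N r ↔ x ∈ torsion g N ∧ lev g x ≤ r :=
  and_congr_right fun _ => (lev_le_iff hg hx0 r).symm

omit hg in
lemma torsionLe_le_torsion {r : ℝ} : torsionLe g N r ≤ torsion g N := fun _ h => h.1

omit hg in
lemma exists_smul_sub_lt_one {ρ : E} (h : ‖ρ ^ q - ρ‖ < 1) : ∃ ζ : F, ‖ρ - ζ • (1 : E)‖ < 1 := by
  by_contra! hcon
  have h1 : (X ^ q - X : F[X]) = (Finset.univ.val.map fun a : F => X - C a).prod := by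
    have hm : (X ^ q - X : F[X]).Monic := by
      apply monic_X_pow_sub; rw [degree_X]; exact_mod_cast Fintype.one_lt_card (α := F)
    have := prod_multiset_X_sub_C_of_monic_of_roots_card_eq hm (by
      rw [FiniteField.roots_X_pow_card_sub_X,
        FiniteField.X_pow_card_sub_X_natDegree_eq _ Fintype.one_lt_card]; rfl)
    rw [FiniteField.roots_X_pow_card_sub_X] at this
    exact this.symm
  have h2 := congrArg (aeval ρ) h1
  have h3 : (Finset.univ.val.map fun a : F => X - C a).prod = ∏ a : F, (X - C a) := rfl
  rw [h3, map_prod] at h2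
  simp only [map_sub, map_pow, aeval_X, aeval_C] at h2
  rw [h2, norm_prod] at h
  refine absurd h (not_lt.mpr ?_)
  calc (1 : ℝ) = ∏ a : F, (1 : ℝ) := by simp
    _ ≤ _ := Finset.prod_le_prod (fun _ _ => zero_le_one) fun a _ => by
      rw [Algebra.algebraMap_eq_smul_one]; exact hcon a

lemma exists_smul_sub_lev_lt (hN : N.Monic) (hd : 1 ≤ N.natDegree) {j : ℕ} {x x' : E}
    (hx : x ∈ torsion g N) (hx0 : x ≠ 0) (hxj : lev g x = lvl F j)
    (hx' : x' ∈ torsion g N) (hx0' : x' ≠ 0) (hxj' : lev g x' = lvl F j) :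
    ∃ ζ : F, ‖x' - ζ • x‖ < ‖g‖ ^ lvl F j := by
  have hq := two_le_card F
  have htop : ∀ y ∈ torsion g N, y ≠ 0 → lev g y = lvl F j →
      (theta F g ^ j) y ≠ 0 ∧ lev g ((theta F g ^ j) y) = levTop F := by
    intro y hy hy0 hyj
    obtain ⟨i, -, hi, h⟩ := exists_level hg hN hd hy hy0 (by rw [hyj]; exact levBot_lt_lvl F j)
    have : i = j := (lvl_strictAnti F).injective (hi.symm.trans hyj)
    rwa [this] at h
  obtain ⟨hy0, hy⟩ := htop x hx hx0 hxj
  obtain ⟨hy0', hy'⟩ := htop x' hx' hx0' hxj'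
  set y := (theta F g ^ j) x with hydef
  set y' := (theta F g ^ j) x' with hydef'
  have hyV : y ∈ torsion g N := theta_pow_mem j hx
  have hyV' : y' ∈ torsion g N := theta_pow_mem j hx'
  have hnorm : ∀ z ∈ torsion g N, ‖z‖ ≤ ‖y‖ := by
    intro z hz
    rcases eq_or_ne z 0 with rfl | hz0
    · simp
    · rw [← lev_le_lev hg hz0 hy0, hy]; exact lev_le_levTop hg hN hd hz hz0
  have hynorm : ‖y'‖ = ‖y‖ := by rw [norm_eq_rpow_lev hg hy0, norm_eq_rpow_lev hg hy0', hy, hy']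
  set ρ := y' / y with hρ
  have hρy : y' = ρ * y := by rw [hρ]; field_simp
  have hρ1 : ‖ρ‖ = 1 := by rw [hρ, norm_div, hynorm, div_self (norm_ne_zero_iff.mpr hy0)]
  have hθ : theta F g y ∈ torsion g N := by
    have := aeval_theta_mem X hyV; rwa [aeval_X] at this
  have hθ' : theta F g y' ∈ torsion g N := by
    have := aeval_theta_mem X hyV'; rwa [aeval_X] at this
  have hid : g * y ^ q ^ 2 * (ρ ^ q - ρ) ^ q ^ 2 =
      ρ ^ q ^ 3 * theta F g y - theta F g y' - (ρ ^ q ^ 3 - ρ) * y := by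
    rw [theta_apply, theta_apply, sub_pow_card_pow F, ← pow_mul, ← pow_succ', hρy]
    ring
  have hbig : ‖y‖ < ‖g * y ^ q ^ 2‖ := by
    rw [← lev_lt_lev hg hy0 (mul_ne_zero (ne_zero_of_one_lt_norm hg) (pow_ne_zero _ hy0)),
      lev_mul_pow hg hy0, hy]
    have := levTop_pos F
    push_cast
    have : (1 : ℝ) ≤ (q : ℝ) ^ 2 := by nlinarith
    nlinarith
  have hsmall : ‖g * y ^ q ^ 2 * (ρ ^ q - ρ) ^ q ^ 2‖ ≤ ‖y‖ := by
    rw [hid]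
    refine (norm_sub_le_max_norm _ _).trans (max_le
      ((norm_sub_le_max_norm _ _).trans (max_le ?_ (hnorm _ hθ'))) ?_)
    · rw [norm_mul, norm_pow, hρ1, one_pow, one_mul]; exact hnorm _ hθ
    · rw [norm_mul]
      refine mul_le_of_le_one_left (norm_nonneg _)
        ((norm_sub_le_max_norm _ _).trans (max_le ?_ hρ1.le))
      rw [norm_pow, hρ1, one_pow]
  have hlt : ‖ρ ^ q - ρ‖ < 1 := by
    by_contra! h1
    rw [norm_mul, norm_pow (ρ ^ q - ρ)] at hsmall
    have := one_le_pow₀ h1 (n := q ^ 2)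
    have h2 : 0 ≤ ‖g * y ^ q ^ 2‖ := norm_nonneg _
    nlinarith
  obtain ⟨ζ, hζ⟩ := exists_smul_sub_lt_one hlt
  refine ⟨ζ, ?_⟩
  have hmem : x' - ζ • x ∈ torsion g N := sub_mem hx' (Submodule.smul_mem _ _ hx)
  have himg : ‖(theta F g ^ j) (x' - ζ • x)‖ < ‖y‖ := by
    have : (theta F g ^ j) (x' - ζ • x) = (ρ - ζ • (1 : E)) * y := by
      rw [map_sub, map_smul, ← hydef, ← hydef', hρy, sub_mul, smul_mul_assoc, one_mul]
    rw [this, norm_mul]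
    have := norm_pos_iff.mpr hy0
    nlinarith
  have hle : ‖x' - ζ • x‖ ≤ ‖g‖ ^ lvl F j := by
    refine (norm_sub_le_max_norm _ _).trans (max_le ?_ ?_)
    · exact (lev_le_iff hg hx0' _).mp hxj'.le
    · exact (norm_smul_finite_le _ _).trans ((lev_le_iff hg hx0 _).mp hxj.le)
  rcases eq_or_ne (x' - ζ • x) 0 with h0 | h0
  · rw [h0, norm_zero]; positivity
  rw [← lev_lt_iff hg h0]
  refine lt_of_le_of_ne ((lev_le_iff hg h0 _).mpr hle) fun heq => ?_
  obtain ⟨h1, h2⟩ := htop _ hmem h0 heq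
  rw [← lev_lt_lev hg h1 hy0, h2, hy] at himg
  exact lt_irrefl _ himg

end Torsion

end

section

open Polynomial Module

section TorsionDim

variable {F : Type} [Field F] [Fintype F] {E : Type} [NormedField E] [IsUltrametricDist E]
  [Algebra F E] {g : E} {N : F[X]}

local notation "q" => Fintype.card F

lemma lev_le_levBot_or (hg : 1 < ‖g‖) (hN : N.Monic) (hd : 1 ≤ N.natDegree) {x : E}
    (hx : x ∈ torsion g N) (hx0 : x ≠ 0) :
    lev g x ≤ levBot F ∨ ∃ j < N.natDegree, lev g x = lvl F j := by
  rcases le_or_gt (lev g x) (levBot F) with h | h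
  · exact Or.inl h
  · obtain ⟨j, hj, h, -⟩ := exists_level hg hN hd hx hx0 h
    exact Or.inr ⟨j, hj, h⟩

lemma torsionLe_zero (hg : 1 < ‖g‖) (hN : N.Monic) (hd : 1 ≤ N.natDegree) :
    torsionLe g N (lvl F 0) = torsion g N := by
  refine le_antisymm torsionLe_le_torsion fun x hx => ?_
  rcases eq_or_ne x 0 with rfl | hx0
  · exact zero_mem _
  rw [mem_torsionLe hg hx0]
  refine ⟨hx, (lev_le_levTop hg hN hd hx hx0).trans (le_of_eq ?_)⟩
  simp [lvl]

lemma torsionLe_natDegree (hg : 1 < ‖g‖) (hN : N.Monic) (hd : 1 ≤ N.natDegree) :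
    torsionLe g N (lvl F N.natDegree) = torsionLe g N (levBot F) := by
  ext x
  rcases eq_or_ne x 0 with rfl | hx0
  · simp
  rw [mem_torsionLe hg hx0, mem_torsionLe hg hx0]
  refine and_congr_right fun hx => ⟨fun h => ?_, fun h => h.trans (levBot_lt_lvl F _).le⟩
  rcases lev_le_levBot_or hg hN hd hx hx0 with h1 | ⟨j, hj, h1⟩
  · exact h1
  · have := lvl_strictAnti F hj
    linarith

/-- If `x` has exact level `lvl F j`, it spans `torsionLe (lvl F j)` modulo the next step. -/
lemma exists_smul_sub_mem (hg : 1 < ‖g‖) (hN : N.Monic) (hd : 1 ≤ N.natDegree) {j : ℕ} {x x' : E}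
    (hx : x ∈ torsion g N) (hx0 : x ≠ 0) (hxj : lev g x = lvl F j)
    (hx' : x' ∈ torsionLe g N (lvl F j)) :
    ∃ ζ : F, x' - ζ • x ∈ torsionLe g N (lvl F (j + 1)) := by
  have key : ∀ y ∈ torsion g N, ‖y‖ < ‖g‖ ^ lvl F j → y ∈ torsionLe g N (lvl F (j + 1)) := by
    intro y hy hlt
    rcases eq_or_ne y 0 with rfl | hy0
    · exact zero_mem _
    rw [mem_torsionLe hg hy0]
    refine ⟨hy, ?_⟩
    rw [← lev_lt_iff hg hy0] at hlt
    rcases lev_le_levBot_or hg hN hd hy hy0 with h1 | ⟨i, hi, h1⟩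
    · exact h1.trans (levBot_lt_lvl F _).le
    · rw [h1] at hlt ⊢
      exact (lvl_strictAnti F).antitone ((lvl_strictAnti F).lt_iff_gt.mp hlt)
  rcases lt_or_eq_of_le hx'.2 with h | h
  · exact ⟨0, key _ (by simpa using hx'.1) (by simpa using h)⟩
  · have hx0' : x' ≠ 0 := by
      rintro rfl
      have : 0 < ‖g‖ ^ lvl F j := by positivity
      simp [← h] at this
    have hl : lev g x' = lvl F j := by
      rw [lev, h, Real.logb_rpow (by positivity) hg.ne']
    obtain ⟨ζ, hζ⟩ := exists_smul_sub_lev_lt hg hN hd hx hx0 hxj hx'.1 hx0' hl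
    exact ⟨ζ, key _ (sub_mem hx'.1 (Submodule.smul_mem _ _ hx)) hζ⟩

lemma exists_lev_eq_of_not_mem (hg : 1 < ‖g‖) (hN : N.Monic) (hd : 1 ≤ N.natDegree) {j : ℕ} {x : E}
    (hx : x ∈ torsionLe g N (lvl F j)) (hx' : x ∉ torsionLe g N (lvl F (j + 1))) :
    x ≠ 0 ∧ lev g x = lvl F j := by
  have hx0 : x ≠ 0 := by rintro rfl; exact hx' (zero_mem _)
  refine ⟨hx0, ?_⟩
  rw [mem_torsionLe hg hx0] at hx hx'
  rcases lev_le_levBot_or hg hN hd hx.1 hx0 with h1 | ⟨i, hi, h1⟩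
  · exact absurd ⟨hx.1, h1.trans (levBot_lt_lvl F _).le⟩ hx'
  · rw [h1] at hx hx' ⊢
    have h2 := (lvl_strictAnti F).le_iff_ge.mp hx.2
    have h3 : ¬ j + 1 ≤ i := fun h => hx' ⟨hx.1, (lvl_strictAnti F).antitone h⟩
    rw [show i = j by omega]

variable [FiniteDimensional F (torsion g N)]

instance (r : ℝ) : FiniteDimensional F (torsionLe g N r) :=
  Submodule.finiteDimensional_of_le torsionLe_le_torsion

lemma finrank_torsionLe_le (hg : 1 < ‖g‖) (hN : N.Monic) (hd : 1 ≤ N.natDegree) (j : ℕ) :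
    finrank F (torsionLe g N (lvl F j)) ≤ finrank F (torsionLe g N (lvl F (j + 1))) + 1 := by
  by_cases h : torsionLe g N (lvl F j) ≤ torsionLe g N (lvl F (j + 1))
  · exact (Submodule.finrank_mono h).trans (Nat.le_succ _)
  obtain ⟨x, hx, hx'⟩ := SetLike.not_le_iff_exists.mp h
  obtain ⟨hx0, hxj⟩ := exists_lev_eq_of_not_mem hg hN hd hx hx'
  have hle : torsionLe g N (lvl F j) ≤
      torsionLe g N (lvl F (j + 1)) ⊔ Submodule.span F {x} := by
    intro y hy
    obtain ⟨ζ, hζ⟩ := exists_smul_sub_mem hg hN hd hx.1 hx0 hxj hy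
    rw [← sub_add_cancel y (ζ • x)]
    exact add_mem (Submodule.mem_sup_left hζ)
      (Submodule.mem_sup_right (Submodule.smul_mem _ _ (Submodule.mem_span_singleton_self x)))
  have h1 := Submodule.finrank_add_le_finrank_add_finrank (torsionLe g N (lvl F (j + 1)))
    (Submodule.span F {x})
  have h2 := Submodule.finrank_mono hle
  have h3 := finrank_span_singleton (K := F) hx0
  omega

lemma aeval_theta_mem_torsionLe (hg : 1 < ‖g‖) (b : F[X]) {x : E}
    (hx : x ∈ torsionLe g N (levBot F)) :
    aeval (theta F g) b x ∈ torsionLe g N (levBot F) :=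
  ⟨aeval_theta_mem b hx.1, (norm_aeval_theta_le hg (fun h0 =>
    ((mem_torsionLe hg h0).mp hx).2) b).trans hx.2⟩

lemma exists_inverse_mod (hNi : Irreducible N) {b : F[X]} (hb : ¬ N ∣ b) :
    ∃ u : F[X], ∀ x ∈ torsion g N, aeval (theta F g) u (aeval (theta F g) b x) = x ∧
      aeval (theta F g) b (aeval (theta F g) u x) = x := by
  obtain ⟨v, u, h⟩ := (hNi.coprime_iff_not_dvd.mpr hb : IsCoprime N b)
  refine ⟨u, fun x hx => ?_⟩
  have h1 := congrArg (fun p => aeval (theta F g) p x) h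
  simp only [map_add, map_mul, map_one, LinearMap.add_apply, Module.End.mul_apply,
    mem_torsion.mp hx, map_zero, zero_add, Module.End.one_apply] at h1
  refine ⟨h1, ?_⟩
  rw [← Module.End.mul_apply, ← map_mul, mul_comm, map_mul, Module.End.mul_apply, h1]

/-- For `x` above the generic level the residues `φ_b x`, `deg b < deg N`, are independent modulo
the generic level. -/
lemma dvd_of_aeval_theta_mem (hg : 1 < ‖g‖) (hNi : Irreducible N) {x : E} (hx : x ∈ torsion g N)
    (hxW : x ∉ torsionLe g N (levBot F)) {b : F[X]}
    (hb : aeval (theta F g) b x ∈ torsionLe g N (levBot F)) : N ∣ b := by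
  by_contra h
  obtain ⟨u, hu⟩ := exists_inverse_mod (g := g) hNi h
  apply hxW
  rw [← (hu x hx).1]
  exact aeval_theta_mem_torsionLe hg u hb

/-- The map `b ↦ φ_b x` modulo the generic level. -/
noncomputable def resMap (g : E) (N : F[X]) (x : E) :
    degreeLT F N.natDegree →ₗ[F] E ⧸ torsionLe g N (levBot F) :=
  (torsionLe g N (levBot F)).mkQ ∘ₗ LinearMap.applyₗ x ∘ₗ
    (aeval (theta F g)).toLinearMap ∘ₗ (degreeLT F N.natDegree).subtype

lemma resMap_apply (x : E) (b : degreeLT F N.natDegree) :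
    resMap g N x b = (torsionLe g N (levBot F)).mkQ (aeval (theta F g) (b : F[X]) x) := rfl

lemma resMap_injective (hg : 1 < ‖g‖) (hNi : Irreducible N) {x : E} (hx : x ∈ torsion g N)
    (hxW : x ∉ torsionLe g N (levBot F)) : Function.Injective (resMap g N x) := by
  rw [← LinearMap.ker_eq_bot, Submodule.eq_bot_iff]
  intro b hb
  rw [LinearMap.mem_ker, resMap_apply, Submodule.mkQ_apply, Submodule.Quotient.mk_eq_zero] at hb
  have h1 := dvd_of_aeval_theta_mem hg hNi hx hxW hb
  have h2 := mem_degreeLT.mp b.2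
  by_contra h0
  have h3 : (b : F[X]) ≠ 0 := fun h => h0 (Subtype.ext h)
  rw [← degree_eq_natDegree hNi.ne_zero] at h2
  exact absurd (degree_le_of_dvd h1 h3) (not_le.mpr h2)

lemma finrank_map_mkQ :
    finrank F ((torsion g N).map (torsionLe g N (levBot F)).mkQ) +
      finrank F (torsionLe g N (levBot F)) = finrank F (torsion g N) := by
  have h := LinearMap.finrank_range_add_finrank_ker
    ((torsionLe g N (levBot F)).mkQ ∘ₗ (torsion g N).subtype)
  rw [LinearMap.range_comp, Submodule.range_subtype, LinearMap.ker_comp, Submodule.ker_mkQ] at h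
  rw [← h, add_right_inj]
  exact (Submodule.comapSubtypeEquivOfLe (torsionLe_le_torsion (g := g) (N := N))).finrank_eq.symm

variable (hg : 1 < ‖g‖) (hNi : Irreducible N) (hN : N.Monic) (hd : 1 ≤ N.natDegree)
  (hV : finrank F (torsion g N) = 3 * N.natDegree)

include hg hNi hN hd hV

lemma finrank_torsionLe_ge (j : ℕ) :
    3 * N.natDegree ≤ finrank F (torsionLe g N (lvl F j)) + j := by
  induction j with
  | zero => rw [torsionLe_zero hg hN hd, hV]; omega
  | succ j ih => have := finrank_torsionLe_le hg hN hd j; omega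

lemma range_resMap_eq {x : E} (hx : x ∈ torsion g N) (hxW : x ∉ torsionLe g N (levBot F)) :
    finrank F (torsionLe g N (levBot F)) = 2 * N.natDegree ∧
      LinearMap.range (resMap g N x) = (torsion g N).map (torsionLe g N (levBot F)).mkQ := by
  have h1 := finrank_torsionLe_ge hg hNi hN hd hV N.natDegree
  rw [torsionLe_natDegree hg hN hd] at h1
  have h2 := finrank_map_mkQ (g := g) (N := N)
  have hle : LinearMap.range (resMap g N x) ≤
      (torsion g N).map (torsionLe g N (levBot F)).mkQ := by
    rintro _ ⟨b, rfl⟩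
    exact Submodule.mem_map_of_mem (aeval_theta_mem _ hx)
  have h3 : finrank F (LinearMap.range (resMap g N x)) = N.natDegree := by
    rw [LinearMap.finrank_range_of_inj (resMap_injective hg hNi hx hxW),
      (degreeLTEquiv F N.natDegree).finrank_eq]; simp
  have h4 := Submodule.finrank_mono hle
  refine ⟨by omega, Submodule.eq_of_le_of_finrank_eq hle (by omega)⟩

lemma exists_aeval_theta_sub_mem {x y : E} (hx : x ∈ torsion g N)
    (hxW : x ∉ torsionLe g N (levBot F)) (hy : y ∈ torsion g N) :
    ∃ b : F[X], aeval (theta F g) b x - y ∈ torsionLe g N (levBot F) := by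
  have h := (range_resMap_eq hg hNi hN hd hV hx hxW).2
  have h1 : (torsionLe g N (levBot F)).mkQ y ∈ LinearMap.range (resMap g N x) := by
    rw [h]; exact Submodule.mem_map_of_mem hy
  obtain ⟨b, hb⟩ := h1
  refine ⟨b, ?_⟩
  rw [resMap_apply] at hb
  exact (Submodule.Quotient.eq _).mp hb

lemma finrank_torsionLe_eq {x : E} (hx : x ∈ torsion g N) (hxW : x ∉ torsionLe g N (levBot F)) :
    finrank F (torsionLe g N (lvl F (N.natDegree - 1))) = 2 * N.natDegree + 1 := by
  have h1 := finrank_torsionLe_ge hg hNi hN hd hV (N.natDegree - 1)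
  have h2 := finrank_torsionLe_le hg hN hd (N.natDegree - 1)
  rw [Nat.sub_add_cancel hd, torsionLe_natDegree hg hN hd,
    (range_resMap_eq hg hNi hN hd hV hx hxW).1] at h2
  omega

/-- The lowest step above the generic level is a line. -/
lemma exists_generator {x : E} (hx : x ∈ torsion g N) (hxW : x ∉ torsionLe g N (levBot F)) :
    ∃ v ∈ torsion g N, v ∉ torsionLe g N (levBot F) ∧ v ≠ 0 ∧
      lev g v = lvl F (N.natDegree - 1) ∧
      ∀ y ∈ torsionLe g N (lvl F (N.natDegree - 1)), ∃ ζ : F,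
        y - ζ • v ∈ torsionLe g N (levBot F) := by
  have h1 := finrank_torsionLe_eq hg hNi hN hd hV hx hxW
  have h2 := (range_resMap_eq hg hNi hN hd hV hx hxW).1
  have hnle : ¬ torsionLe g N (lvl F (N.natDegree - 1)) ≤ torsionLe g N (levBot F) := fun h => by
    have := Submodule.finrank_mono h; omega
  obtain ⟨v, hv, hvW⟩ := SetLike.not_le_iff_exists.mp hnle
  have hstep : torsionLe g N (lvl F (N.natDegree - 1 + 1)) = torsionLe g N (levBot F) := by
    rw [Nat.sub_add_cancel hd, torsionLe_natDegree hg hN hd]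
  obtain ⟨hv0, hvl⟩ := exists_lev_eq_of_not_mem hg hN hd hv (by rwa [hstep])
  refine ⟨v, hv.1, hvW, hv0, hvl, fun y hy => ?_⟩
  obtain ⟨ζ, hζ⟩ := exists_smul_sub_mem hg hN hd hv.1 hv0 hvl hy
  exact ⟨ζ, by rwa [hstep] at hζ⟩

end TorsionDim

end

section

open Polynomial Module

section Galois

variable {F : Type} [Field F] [Fintype F] {E : Type} [NormedField E] [IsUltrametricDist E]
  [Algebra F E] {N : F[X]} {k : Type} [Field k] [Algebra F k] [Algebra k E] [IsScalarTower F k E]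
  {g : k}

local notation "q" => Fintype.card F

lemma algEquiv_aeval_theta (σ : E ≃ₐ[k] E) (b : F[X]) (x : E) :
    σ (aeval (theta F (algebraMap k E g)) b x) =
      aeval (theta F (algebraMap k E g)) b (σ x) := by
  have := map_aeval_theta (F := F) (σ.toAlgHom.restrictScalars F) (algebraMap k E g) x b
  simpa using this

lemma algEquiv_mem_torsion (σ : E ≃ₐ[k] E) {x : E} :
    σ x ∈ torsion (algebraMap k E g) N ↔ x ∈ torsion (algebraMap k E g) N := by
  rw [mem_torsion, mem_torsion, ← algEquiv_aeval_theta]; simp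

lemma algEquiv_mem_torsionLe {σ : E ≃ₐ[k] E} (hσ : ∀ x, ‖σ x‖ = ‖x‖) {r : ℝ} {x : E} :
    σ x ∈ torsionLe (algebraMap k E g) N r ↔ x ∈ torsionLe (algebraMap k E g) N r := by
  change (_ ∧ _) ↔ (_ ∧ _)
  rw [hσ]
  exact and_congr_left fun _ => algEquiv_mem_torsion σ

lemma exists_algebraMap_eq_prod [FiniteDimensional k E] [IsGalois k E] (S : Finset E)
    (hS : ∀ σ : E ≃ₐ[k] E, ∀ x ∈ S, σ x ∈ S) : ∃ z : k, algebraMap k E z = ∏ x ∈ S, x := by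
  have h : (∏ x ∈ S, x) ∈ IntermediateField.fixedField (⊤ : Subgroup (E ≃ₐ[k] E)) := by
    rintro ⟨σ, -⟩
    change σ (∏ x ∈ S, x) = _
    rw [map_prod]
    refine Finset.prod_nbij σ (hS σ) σ.injective.injOn ?_ fun _ _ => rfl
    intro x hx
    exact ⟨σ.symm x, hS σ.symm x hx, by simp⟩
  have h2 : IntermediateField.fixedField (⊤ : Subgroup (E ≃ₐ[k] E)) = ⊥ := by
    rw [← IntermediateField.fixingSubgroup_bot, IsGalois.fixedField_fixingSubgroup]
  rw [h2, IntermediateField.mem_bot] at h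
  exact h

variable (F) in
lemma card_mul_lvl (d : ℕ) (hd : 1 ≤ d) : ∃ c : ℤ, IsCoprime c (((q : ℤ) - 1) * q ^ (2 * d)) ∧
    (((q : ℝ) - 1) * q ^ (2 * d)) * lvl F (d - 1) = c := by
  have hq := two_le_card F
  obtain ⟨e, rfl⟩ : ∃ e, d = e + 1 := ⟨d - 1, by omega⟩
  refine ⟨1 - (q : ℤ) ^ 2 * (q - 1) * ∑ i ∈ Finset.range e, ((q : ℤ) ^ 2) ^ i, ?_, ?_⟩
  · have h : IsCoprime (1 - (q : ℤ) ^ 2 * (q - 1) * ∑ i ∈ Finset.range e, ((q : ℤ) ^ 2) ^ i)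
        ((q : ℤ) ^ 2 * (q - 1)) := ⟨1, ∑ i ∈ Finset.range e, ((q : ℤ) ^ 2) ^ i, by ring⟩
    refine (h.pow_right (n := e + 1)).of_isCoprime_of_dvd_right ⟨((q : ℤ) - 1) ^ e, ?_⟩
    rw [mul_pow, ← pow_mul]
    ring
  · have hs := mul_geom_sum ((q : ℝ) ^ 2) e
    have h1 : (q : ℝ) ^ 2 - 1 ≠ 0 := by nlinarith
    have h3 : (q : ℝ) - 1 ≠ 0 := by linarith
    have h2 : (q : ℝ) ≠ 0 := by linarith
    have h4 : (q : ℝ) ^ 3 - q ^ 2 = q ^ 2 * (q - 1) := by ring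
    have h5 : (∑ i ∈ Finset.range e, ((q : ℝ) ^ 2) ^ i) = (((q : ℝ) ^ 2) ^ e - 1) / (q ^ 2 - 1) := by
      rw [eq_div_iff h1, ← hs]; ring
    push_cast
    rw [h5, lvl, levBot, levTop, h4]
    have h6 : (q : ℝ) ^ (2 * (e + 1)) = q ^ 2 * (q ^ 2) ^ e := by ring
    rw [h6]
    have h7 : ((q : ℝ) ^ 2) ^ e ≠ 0 := by positivity
    field_simp
    ring

variable [FiniteDimensional F (torsion (algebraMap k E g) N)]

lemma natCard_torsionLe (r : ℝ) : Nat.card (torsionLe (algebraMap k E g) N r) =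
    q ^ finrank F (torsionLe (algebraMap k E g) N r) := by
  rw [Module.natCard_eq_pow_finrank (K := F), Nat.card_eq_fintype_card]

instance (r : ℝ) : Finite (torsionLe (algebraMap k E g) N r) := Module.finite_of_finite F

lemma finite_torsionLe (r : ℝ) : (torsionLe (algebraMap k E g) N r : Set E).Finite :=
  Set.finite_coe_iff.mp (inferInstanceAs (Finite (torsionLe (algebraMap k E g) N r)))

variable [FiniteDimensional k E] [IsGalois k E]
  (hg : 1 < ‖algebraMap k E g‖) (hNi : Irreducible N) (hN : N.Monic) (hd : 1 ≤ N.natDegree)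
  (hV : finrank F (torsion (algebraMap k E g) N) = 3 * N.natDegree)
  (hval : ∀ z : k, z ≠ 0 → ∃ j : ℤ, ‖algebraMap k E z‖ = ‖algebraMap k E g‖ ^ j)
  (hσ : ∀ (σ : E ≃ₐ[k] E) (x : E), ‖σ x‖ = ‖x‖)

include hg hNi hN hd hV hval hσ

lemma exists_algEquiv_of_lev_eq {u u' : E} (hu : u ∈ torsionLe (algebraMap k E g) N (lvl F (N.natDegree - 1)))
    (huW : u ∉ torsionLe (algebraMap k E g) N (levBot F))
    (hu' : u' ∈ torsionLe (algebraMap k E g) N (lvl F (N.natDegree - 1)))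
    (huW' : u' ∉ torsionLe (algebraMap k E g) N (levBot F)) : ∃ σ : E ≃ₐ[k] E, σ u = u' := by
  classical
  set V₁ := torsionLe (algebraMap k E g) N (lvl F (N.natDegree - 1)) with hV₁
  set W := torsionLe (algebraMap k E g) N (levBot F) with hW
  have hlev : ∀ y ∈ V₁, y ∉ W → y ≠ 0 ∧ lev (algebraMap k E g) y = lvl F (N.natDegree - 1) := by
    intro y hy hyW
    apply exists_lev_eq_of_not_mem hg hN hd hy
    rw [Nat.sub_add_cancel hd, torsionLe_natDegree hg hN hd]
    exact hyW
  have hWV : (W : Set E) ⊆ V₁ := fun y hy => ⟨hy.1, hy.2.trans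
    (Real.rpow_le_rpow_of_exponent_le hg.le (levBot_lt_lvl F _).le)⟩
  have hfV : (V₁ : Set E).Finite := finite_torsionLe _
  have hfW : (W : Set E).Finite := finite_torsionLe _
  set S : Finset E := hfV.toFinset \ hfW.toFinset with hS
  have hmemS : ∀ y, y ∈ S ↔ y ∈ V₁ ∧ y ∉ W := fun y => by simp [hS]
  have hcardS : S.card = (q - 1) * q ^ (2 * N.natDegree) := by
    rw [hS, Finset.card_sdiff_of_subset (by simpa using hWV), ← Nat.card_eq_card_finite_toFinset,
      ← Nat.card_eq_card_finite_toFinset]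
    have h1 : Nat.card (V₁ : Set E) = q ^ (2 * N.natDegree + 1) := by
      rw [← finrank_torsionLe_eq hg hNi hN hd hV hu.1 huW]; exact natCard_torsionLe _
    have h2 : Nat.card (W : Set E) = q ^ (2 * N.natDegree) := by
      rw [← (range_resMap_eq hg hNi hN hd hV hu.1 huW).1]; exact natCard_torsionLe _
    rw [h1, h2, pow_succ, Nat.sub_mul, one_mul, mul_comm q]
  set O : Finset E := Finset.univ.image fun σ : E ≃ₐ[k] E => σ u with hO
  have hOS : O ⊆ S := by
    intro y hy
    obtain ⟨σ, -, rfl⟩ := Finset.mem_image.mp hy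
    rw [hmemS, hV₁, hW, algEquiv_mem_torsionLe (hσ σ), algEquiv_mem_torsionLe (hσ σ)]
    exact ⟨hu, huW⟩
  obtain ⟨z, hz⟩ := exists_algebraMap_eq_prod (k := k) O (by
    intro σ x hx
    obtain ⟨τ, -, rfl⟩ := Finset.mem_image.mp hx
    exact Finset.mem_image.mpr ⟨σ * τ, Finset.mem_univ _, rfl⟩)
  have hne : ∀ y ∈ O, y ≠ 0 ∧ lev (algebraMap k E g) y = lvl F (N.natDegree - 1) := fun y hy =>
    hlev y ((hmemS y).mp (hOS hy)).1 ((hmemS y).mp (hOS hy)).2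
  have hz0 : z ≠ 0 := by
    rintro rfl
    rw [map_zero] at hz
    exact Finset.prod_ne_zero_iff.mpr (fun y hy => (hne y hy).1) hz.symm
  obtain ⟨j, hj⟩ := hval z hz0
  have hgp : (0 : ℝ) < ‖algebraMap k E g‖ := by linarith
  have h1 : (O.card : ℝ) * lvl F (N.natDegree - 1) = j := by
    have : ‖algebraMap k E z‖ = ‖algebraMap k E g‖ ^ ((O.card : ℝ) * lvl F (N.natDegree - 1)) := by
      rw [hz, norm_prod, Finset.prod_congr rfl fun y hy => by
        rw [norm_eq_rpow_lev hg (hne y hy).1, (hne y hy).2], Finset.prod_const, mul_comm,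
        Real.rpow_mul hgp.le, Real.rpow_natCast]
    rw [hj, ← Real.rpow_intCast] at this
    exact ((Real.strictMono_rpow_of_base_gt_one hg).injective this).symm
  obtain ⟨c, hc, hc'⟩ := card_mul_lvl F N.natDegree hd
  have hq1 : 1 ≤ q := Fintype.card_pos
  have hdvd : (q - 1) * q ^ (2 * N.natDegree) ∣ O.card := by
    have h2 : (O.card : ℤ) * c = j * (((q : ℤ) - 1) * q ^ (2 * N.natDegree)) := by
      have : ((O.card : ℝ) * c) = j * (((q : ℝ) - 1) * q ^ (2 * N.natDegree)) := by
        rw [← hc', ← h1]; ring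
      exact_mod_cast this
    have h3 : (((q : ℤ) - 1) * q ^ (2 * N.natDegree)) ∣ (O.card : ℤ) :=
      hc.symm.dvd_of_dvd_mul_right ⟨j, by rw [h2]; ring⟩
    have h4 : (((q - 1) * q ^ (2 * N.natDegree) : ℕ) : ℤ) = ((q : ℤ) - 1) * q ^ (2 * N.natDegree) := by
      push_cast [Nat.cast_sub hq1]; ring
    rw [← h4] at h3
    exact_mod_cast h3
  have hOpos : 0 < O.card := Finset.card_pos.mpr ⟨u, Finset.mem_image.mpr ⟨1, Finset.mem_univ _, rfl⟩⟩
  have hOeq : O = S := Finset.eq_of_subset_of_card_le hOS (by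
    rw [hcardS]; exact Nat.le_of_dvd hOpos hdvd)
  have : u' ∈ O := by rw [hOeq, hmemS]; exact ⟨hu', huW'⟩
  obtain ⟨σ, -, h⟩ := Finset.mem_image.mp this
  exact ⟨σ, h⟩

/-- Elements outside the bottom level are represented by lowest-level generators. -/
lemma exists_aeval_theta_eq {u x : E}
    (hu : u ∈ torsionLe (algebraMap k E g) N (lvl F (N.natDegree - 1)))
    (huW : u ∉ torsionLe (algebraMap k E g) N (levBot F))
    (hx : x ∈ torsion (algebraMap k E g) N)
    (hxW : x ∉ torsionLe (algebraMap k E g) N (levBot F)) :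
    ∃ b : F[X], ¬ N ∣ b ∧ ∃ u₁ ∈ torsionLe (algebraMap k E g) N (lvl F (N.natDegree - 1)),
      u₁ ∉ torsionLe (algebraMap k E g) N (levBot F) ∧
      aeval (theta F (algebraMap k E g)) b u₁ = x := by
  obtain ⟨b, hb⟩ := exists_aeval_theta_sub_mem hg hNi hN hd hV hu.1 huW hx
  have hWV : torsionLe (algebraMap k E g) N (levBot F) ≤
    torsionLe (algebraMap k E g) N (lvl F (N.natDegree - 1)) := fun y hy => ⟨hy.1, hy.2.trans
    (Real.rpow_le_rpow_of_exponent_le hg.le (levBot_lt_lvl F _).le)⟩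
  have hNb : ¬ N ∣ b := by
    rintro ⟨c, rfl⟩
    rw [mul_comm, map_mul, Module.End.mul_apply, mem_torsion.mp hu.1, map_zero, zero_sub,
      neg_mem_iff] at hb
    exact hxW hb
  obtain ⟨c, hc⟩ := exists_inverse_mod (g := algebraMap k E g) hNi hNb
  have h2 := aeval_theta_mem_torsionLe hg c hb
  refine ⟨b, hNb, u - aeval (theta F (algebraMap k E g)) c (aeval (theta F (algebraMap k E g)) b u - x),
    sub_mem hu (hWV h2), fun h => huW ?_, ?_⟩
  · simpa using add_mem h h2
  · rw [map_sub, (hc _ hb.1).2, sub_sub_cancel]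

lemma exists_algEquiv_add {x w : E} (hx : x ∈ torsion (algebraMap k E g) N)
    (hxW : x ∉ torsionLe (algebraMap k E g) N (levBot F))
    (hw : w ∈ torsionLe (algebraMap k E g) N (levBot F)) : ∃ σ : E ≃ₐ[k] E, σ x = x + w := by
  obtain ⟨v, hv, hvW, hv0, hlev, -⟩ := exists_generator hg hNi hN hd hV hx hxW
  have hv1 : v ∈ torsionLe (algebraMap k E g) N (lvl F (N.natDegree - 1)) :=
    (mem_torsionLe hg hv0).mpr ⟨hv, hlev.le⟩
  obtain ⟨b, hb, u, hu, huW, rfl⟩ := exists_aeval_theta_eq hg hNi hN hd hV hval hσ hv1 hvW hx hxW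
  obtain ⟨c, hc⟩ := exists_inverse_mod (g := algebraMap k E g) hNi hb
  have h2 := aeval_theta_mem_torsionLe hg c hw
  have hWV : torsionLe (algebraMap k E g) N (levBot F) ≤
    torsionLe (algebraMap k E g) N (lvl F (N.natDegree - 1)) := fun y hy => ⟨hy.1, hy.2.trans
    (Real.rpow_le_rpow_of_exponent_le hg.le (levBot_lt_lvl F _).le)⟩
  obtain ⟨σ, h⟩ := exists_algEquiv_of_lev_eq hg hNi hN hd hV hval hσ hu huW
    (add_mem hu (hWV h2)) (fun h => huW (by simpa using sub_mem h h2))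
  refine ⟨σ, ?_⟩
  rw [algEquiv_aeval_theta, h, map_add, (hc _ hw.1).2]

end Galois

end

section

open Polynomial Module

section GlobalGalois

variable {F : Type} [Field F] [Fintype F] {E : Type} [NormedField E] [IsUltrametricDist E]
  [Algebra F E] {N : F[X]} {k : Type} [Field k] [Algebra F k] [Algebra k E] [IsScalarTower F k E]
  {g : k} [FiniteDimensional F (torsion (algebraMap k E g) N)]

local notation "q" => Fintype.card F

variable [FiniteDimensional k E] [IsGalois k E]
  (hg : 1 < ‖algebraMap k E g‖) (hNi : Irreducible N) (hN : N.Monic) (hd : 1 ≤ N.natDegree)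
  (hV : finrank F (torsion (algebraMap k E g) N) = 3 * N.natDegree)
  (hone : ∀ S : Finset E, (∀ σ : E ≃ₐ[k] E, ∀ x ∈ S, σ x ∈ S) →
    (∀ x ∈ S, x ∈ torsion (algebraMap k E g) N ∧ x ≠ 0) → 1 ≤ ‖∏ x ∈ S, x‖)

include hg hone in
lemma not_subset_torsionLe {S : Finset E} (hS : ∀ σ : E ≃ₐ[k] E, ∀ x ∈ S, σ x ∈ S)
    (hne : S.Nonempty) (h0 : 0 ∉ S) :
    ¬ ∀ x ∈ S, x ∈ torsionLe (algebraMap k E g) N (levBot F) := by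
  intro h
  have h1 := hone S hS fun x hx => ⟨(h x hx).1, by rintro rfl; exact h0 hx⟩
  have h2 : ‖∏ x ∈ S, x‖ < 1 := by
    have hlt : ‖algebraMap k E g‖ ^ levBot F < 1 :=
      Real.rpow_lt_one_of_one_lt_of_neg hg (levBot_neg F)
    have h0' : 0 ≤ ‖algebraMap k E g‖ ^ levBot F := Real.rpow_nonneg (norm_nonneg _) _
    rw [norm_prod]
    calc ∏ x ∈ S, ‖x‖ ≤ ∏ x ∈ S, ‖algebraMap k E g‖ ^ levBot F :=
          Finset.prod_le_prod (fun x _ => norm_nonneg x) fun x hx => (h x hx).2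
      _ = (‖algebraMap k E g‖ ^ levBot F) ^ S.card := by rw [Finset.prod_const]
      _ < 1 := pow_lt_one₀ h0' hlt hne.card_ne_zero
  linarith

include hg hNi hN hd hV hone

lemma exists_algEquiv_of_ne_zero
    (hloc : ∀ x ∈ torsion (algebraMap k E g) N, x ∉ torsionLe (algebraMap k E g) N (levBot F) →
      ∀ w ∈ torsionLe (algebraMap k E g) N (levBot F), ∃ σ : E ≃ₐ[k] E, σ x = x + w)
    {x y : E} (hx : x ∈ torsion (algebraMap k E g) N) (hx0 : x ≠ 0)
    (hy : y ∈ torsion (algebraMap k E g) N) (hy0 : y ≠ 0) : ∃ σ : E ≃ₐ[k] E, σ x = y := by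
  classical
  set W := torsionLe (algebraMap k E g) N (levBot F) with hW
  have hWV : ∀ x ∈ W, x ∈ torsion (algebraMap k E g) N := fun x hx => hx.1
  have hfW : (W : Set E).Finite := finite_torsionLe _
  -- orbits
  have horb : ∀ x ∈ torsion (algebraMap k E g) N, x ≠ 0 → ∃ σ : E ≃ₐ[k] E, σ x ∉ W := by
    intro x _ hx0
    by_contra! h
    refine not_subset_torsionLe hg hone
      (S := Finset.univ.image fun σ : E ≃ₐ[k] E => σ x) ?_ ⟨x, ?_⟩ ?_ ?_
    · intro σ y hy
      obtain ⟨τ, -, rfl⟩ := Finset.mem_image.mp hy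
      exact Finset.mem_image.mpr ⟨σ * τ, Finset.mem_univ _, rfl⟩
    · exact Finset.mem_image.mpr ⟨1, Finset.mem_univ _, rfl⟩
    · intro h0
      obtain ⟨τ, -, h0⟩ := Finset.mem_image.mp h0
      exact hx0 (by simpa using h0)
    · intro y hy
      obtain ⟨τ, -, rfl⟩ := Finset.mem_image.mp hy
      exact h τ
  obtain ⟨σ₀, hσ₀⟩ := horb x hx hx0
  have hdim : finrank F W = 2 * N.natDegree :=
    (range_resMap_eq hg hNi hN hd hV ((algEquiv_mem_torsion σ₀).mpr hx) hσ₀).1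
  obtain ⟨γ, x₀, hx₀, hγ⟩ : ∃ γ : E ≃ₐ[k] E, ∃ x ∈ W, γ x ∉ W := by
    by_contra! h
    refine not_subset_torsionLe hg hone (S := hfW.toFinset.erase 0) ?_ ?_ (by simp) ?_
    · intro σ x hx
      simp only [Finset.mem_erase, Set.Finite.mem_toFinset, SetLike.mem_coe] at hx ⊢
      exact ⟨by simpa using hx.1, h σ x hx.2⟩
    · have hne : W ≠ ⊥ := by
        intro h0; rw [h0, finrank_bot] at hdim; omega
      obtain ⟨w, hw, hw0⟩ := Submodule.exists_mem_ne_zero_of_ne_bot hne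
      exact ⟨w, by simp [hw0, hw]⟩
    · intro x hx
      simp only [Finset.mem_erase, Set.Finite.mem_toFinset, SetLike.mem_coe] at hx
      exact hx.2
  obtain ⟨x₁, hx₁, hγ₁⟩ : ∃ x ∈ W, γ.symm x ∉ W := by
    by_contra! h
    have h1 : hfW.toFinset.image γ.symm ⊆ hfW.toFinset := by
      intro y hy
      obtain ⟨z, hz, rfl⟩ := Finset.mem_image.mp hy
      simp only [Set.Finite.mem_toFinset, SetLike.mem_coe] at hz ⊢
      exact h z hz
    have h2 := Finset.eq_of_subset_of_card_le h1
      (by rw [Finset.card_image_of_injective _ γ.symm.injective])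
    have h3 : x₀ ∈ hfW.toFinset := by simpa using hx₀
    rw [← h2] at h3
    obtain ⟨z, hz, hz'⟩ := Finset.mem_image.mp h3
    apply hγ
    rw [← hz']
    simpa using hz
  have hloc' : ∀ x ∈ torsion (algebraMap k E g) N, γ.symm x ∉ W → ∀ w, γ.symm w ∈ W →
      ∃ σ : E ≃ₐ[k] E, σ x = x + w := by
    intro x hx hxW w hw
    obtain ⟨σ, hσ⟩ := hloc (γ.symm x) ((algEquiv_mem_torsion _).mpr hx) hxW _ hw
    refine ⟨γ * σ * γ.symm, ?_⟩
    change γ (σ (γ.symm x)) = _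
    rw [hσ]; simp
  have hγ₀ : γ x₀ ∈ torsion (algebraMap k E g) N := (algEquiv_mem_torsion _).mpr (hWV _ hx₀)
  have hsum : ∀ z ∈ torsion (algebraMap k E g) N, ∃ w w', w ∈ W ∧ γ.symm w' ∈ W ∧ z = w + w' := by
    intro z hz
    obtain ⟨b, hb⟩ := exists_aeval_theta_sub_mem hg hNi hN hd hV hγ₀ hγ hz
    refine ⟨_, _, neg_mem hb, (?_ : γ.symm (aeval (theta F (algebraMap k E g)) b (γ x₀)) ∈ W), by abel⟩
    rw [algEquiv_aeval_theta, AlgEquiv.symm_apply_apply]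
    exact aeval_theta_mem_torsionLe hg b hx₀
  have hmid : ∀ x ∈ torsion (algebraMap k E g) N, ∀ y ∈ torsion (algebraMap k E g) N,
      x ∉ W → γ.symm y ∉ W → ∃ σ : E ≃ₐ[k] E, σ x = y := by
    intro x hx y hy hxW hyW
    obtain ⟨w, w', hw, hw', h⟩ := hsum (x - y) (sub_mem hx hy)
    obtain ⟨σ, hσ⟩ := hloc x hx hxW (-w) (neg_mem hw)
    obtain ⟨τ, hτ⟩ := hloc' y hy hyW w' hw'
    refine ⟨τ.symm * σ, ?_⟩
    change τ.symm (σ x) = y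
    rw [AlgEquiv.symm_apply_eq, hτ, hσ, ← sub_eq_zero]
    have : x - y - (w + w') = 0 := by rw [h, sub_self]
    rw [← this]; abel
  have hgen : ∀ x ∈ torsion (algebraMap k E g) N, x ≠ 0 → ∃ σ : E ≃ₐ[k] E,
      σ x ∉ W ∧ γ.symm (σ x) ∉ W := by
    have hmain : ∀ x ∈ torsion (algebraMap k E g) N, x ∉ W → ∃ σ : E ≃ₐ[k] E,
        σ x ∉ W ∧ γ.symm (σ x) ∉ W := by
      intro x hx hxW
      by_cases h : γ.symm x ∈ W
      · obtain ⟨σ, hσ⟩ := hloc x hx hxW x₁ hx₁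
        refine ⟨σ, ?_, ?_⟩
        · rw [hσ]; intro h'; exact hxW (by simpa using sub_mem h' hx₁)
        · rw [hσ, map_add]; intro h'; exact hγ₁ (by simpa using sub_mem h' h)
      · exact ⟨1, hxW, h⟩
    intro x hx hx0
    obtain ⟨σ, hσ⟩ := horb x hx hx0
    obtain ⟨τ, hτ⟩ := hmain (σ x) ((algEquiv_mem_torsion _).mpr hx) hσ
    exact ⟨τ * σ, hτ⟩
  obtain ⟨σ, hσ, -⟩ := hgen x hx hx0
  obtain ⟨τ, -, hτ⟩ := hgen y hy hy0
  obtain ⟨ρ, hρ⟩ := hmid (σ x) ((algEquiv_mem_torsion _).mpr hx) (τ y)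
    ((algEquiv_mem_torsion _).mpr hy) hσ hτ
  refine ⟨τ.symm * ρ * σ, ?_⟩
  change τ.symm (ρ (σ x)) = y
  rw [hρ, AlgEquiv.symm_apply_apply]

end GlobalGalois

end

section

open Polynomial Module

section PhiPoly

variable {F : Type} [Field F] [Fintype F] {R S : Type} [CommRing R] [Algebra F R]
  [CommRing S] [Algebra F S]

local notation "q" => Fintype.card F

/-- The `F`-linear polynomial `φ_N`. -/
noncomputable def phiPoly (g : R) (N : F[X]) : R[X] := aeval (theta F (C g)) N X

lemma aeval_phiPoly [Algebra R S] [IsScalarTower F R S] (g : R) (N : F[X]) (x : S) :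
    aeval x (phiPoly g N) = aeval (theta F (algebraMap R S g)) N x := by
  have := map_aeval_theta (F := F) ((aeval x : R[X] →ₐ[R] S).restrictScalars F) (C g) X N
  simpa [phiPoly] using this

lemma eval_phiPoly (g : R) (N : F[X]) (x : R) :
    (phiPoly g N).eval x = aeval (theta F g) N x := by
  have := aeval_phiPoly (S := R) g N x
  simpa using this

lemma map_phiPoly (f : R →ₐ[F] S) (g : R) (N : F[X]) :
    (phiPoly g N).map (f : R →+* S) = phiPoly (f g) N := by
  have := map_aeval_theta (F := F) (mapAlgHom f) (C g) X N
  simpa [phiPoly] using this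

lemma derivative_theta [Nontrivial R] (g : R) (p : R[X]) :
    derivative (theta F (C g) p) = derivative p := by
  have h : ((q : ℕ) : R[X]) = 0 := by
    rw [← map_natCast (algebraMap F R[X]), FiniteField.cast_card_eq_zero, map_zero]
  rw [theta_apply]
  simp [derivative_pow, derivative_mul, Nat.cast_pow, h]

lemma derivative_phiPoly [Nontrivial R] (g : R) (N : F[X]) :
    derivative (phiPoly g N) = C (algebraMap F R (N.eval 1)) := by
  have h : ∀ i, derivative ((theta F (C g) ^ i) (X : R[X])) = 1 := by
    intro i
    induction i with
    | zero => simp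
    | succ i ih => rw [pow_succ', Module.End.mul_apply, derivative_theta, ih]
  rw [phiPoly, aeval_eq_sum_range, LinearMap.sum_apply, derivative_sum, eval_eq_sum_range, map_sum,
    map_sum]
  refine Finset.sum_congr rfl fun i _ => ?_
  rw [LinearMap.smul_apply, Algebra.smul_def, derivative_mul, h]
  simp [IsScalarTower.algebraMap_apply F R R[X]]

lemma monic_theta_pow [Nontrivial R] (g : R) (i : ℕ) :
    ((theta F (C g) ^ i) (X : R[X])).Monic ∧
      ((theta F (C g) ^ i) (X : R[X])).natDegree = q ^ (3 * i) := by
  have hq : 1 < q := Fintype.one_lt_card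
  induction i with
  | zero => simp [monic_X]
  | succ i ih =>
    obtain ⟨hm, hd⟩ := ih
    set p := (theta F (C g) ^ i) (X : R[X]) with hp
    have hm3 : (p ^ q ^ 3).Monic := hm.pow _
    have hd3 : (p ^ q ^ 3).natDegree = q ^ (3 * (i + 1)) := by
      rw [hm.natDegree_pow, hd]; ring
    have hlt : (p + C g * p ^ q ^ 2).degree < (p ^ q ^ 3).degree := by
      rw [degree_eq_natDegree hm3.ne_zero, hd3]
      refine (degree_le_natDegree).trans_lt ?_
      have h1 : p.natDegree < q ^ (3 * (i + 1)) := by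
        rw [hd]; exact Nat.pow_lt_pow_right hq (by omega)
      have h2 : (C g * p ^ q ^ 2).natDegree < q ^ (3 * (i + 1)) := by
        refine (natDegree_C_mul_le _ _).trans_lt ?_
        rw [hm.natDegree_pow, hd, ← pow_add]
        exact Nat.pow_lt_pow_right hq (by omega)
      exact_mod_cast (natDegree_add_le _ _).trans_lt (max_lt h1 h2)
    rw [pow_succ', Module.End.mul_apply, theta_apply, ← hp]
    refine ⟨hm3.add_of_right hlt, ?_⟩
    rw [natDegree_add_eq_right_of_degree_lt hlt, hd3]

lemma monic_phiPoly [Nontrivial R] (g : R) {N : F[X]} (hN : N.Monic) :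
    (phiPoly g N).Monic ∧ (phiPoly g N).natDegree = q ^ (3 * N.natDegree) := by
  have hq : 1 < q := Fintype.one_lt_card
  obtain ⟨hm, hd⟩ := monic_theta_pow (F := F) g N.natDegree
  have hlt : (∑ i ∈ Finset.range N.natDegree, N.coeff i • (theta F (C g) ^ i) (X : R[X])).degree <
      ((theta F (C g) ^ N.natDegree) (X : R[X])).degree := by
    rw [degree_eq_natDegree hm.ne_zero, hd]
    refine lt_of_le_of_lt (b := ((q ^ (3 * N.natDegree) - 1 : ℕ) : WithBot ℕ)) ?_ ?_
    · refine (degree_sum_le _ _).trans (Finset.sup_le fun i hi => ?_)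
      rw [Finset.mem_range] at hi
      refine (degree_smul_le _ _).trans (degree_le_natDegree.trans ?_)
      rw [(monic_theta_pow (F := F) g i).2]
      have := Nat.pow_lt_pow_right hq (show 3 * i < 3 * N.natDegree by omega)
      exact_mod_cast Nat.le_sub_one_of_lt this
    · have : 0 < q ^ (3 * N.natDegree) := by positivity
      exact_mod_cast Nat.sub_one_lt this.ne'
  have he : phiPoly g N = (∑ i ∈ Finset.range N.natDegree, N.coeff i • (theta F (C g) ^ i) (X : R[X])) +
      (theta F (C g) ^ N.natDegree) (X : R[X]) := by
    rw [phiPoly, aeval_eq_sum_range, LinearMap.sum_apply, Finset.sum_range_succ, hN.coeff_natDegree,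
      one_smul]
    rfl
  rw [he]
  exact ⟨hm.add_of_right hlt, by rw [natDegree_add_eq_right_of_degree_lt hlt, hd]⟩

/-- The polynomial whose roots are the nonzero roots of `φ_N`. -/
noncomputable def torPoly (g : R) (N : F[X]) : R[X] := divX (phiPoly g N)

lemma torPoly_mul_X (g : R) (N : F[X]) : torPoly g N * X = phiPoly g N := by
  have h : (phiPoly g N).coeff 0 = 0 := by
    rw [coeff_zero_eq_eval_zero, eval_phiPoly, map_zero]
  have := divX_mul_X_add (phiPoly g N)
  rwa [h, map_zero, add_zero] at this

lemma monic_torPoly [Nontrivial R] (g : R) {N : F[X]} (hN : N.Monic) :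
    (torPoly g N).Monic ∧ (torPoly g N).natDegree = q ^ (3 * N.natDegree) - 1 := by
  obtain ⟨h1, h2⟩ := monic_phiPoly g hN
  rw [torPoly]
  refine ⟨?_, by rw [natDegree_divX_eq_natDegree_tsub_one, h2]⟩
  have h3 := torPoly_mul_X g N
  rw [← h3] at h1
  exact monic_X.of_mul_monic_right h1

lemma map_torPoly (f : R →ₐ[F] S) (g : R) (N : F[X]) :
    (torPoly g N).map (f : R →+* S) = torPoly (f g) N := by
  have h : ((torPoly g N).map (f : R →+* S)) * X = torPoly (f g) N * X := by
    rw [torPoly_mul_X, ← map_phiPoly f, ← torPoly_mul_X, Polynomial.map_mul, map_X]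
  exact monic_X.isRegular.right h

lemma coeff_zero_torPoly [Nontrivial R] (g : R) (N : F[X]) :
    (torPoly g N).coeff 0 = algebraMap F R (N.eval 1) := by
  have h := congrArg (fun p => coeff p 0) (derivative_phiPoly (F := F) g N)
  simp only [coeff_derivative, coeff_C_zero] at h
  rw [torPoly, coeff_divX, ← h]; simp

lemma separable_phiPoly [Nontrivial R] (g : R) {N : F[X]} (h1 : N.eval 1 ≠ 0) :
    (phiPoly g N).Separable := by
  rw [separable_def, derivative_phiPoly]
  exact isCoprime_one_right.of_isCoprime_of_dvd_right (by
    refine (IsUnit.dvd ?_)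
    rw [isUnit_C]
    exact (isUnit_iff_ne_zero.mpr h1).map _)

lemma separable_torPoly [Nontrivial R] (g : R) {N : F[X]} (h1 : N.eval 1 ≠ 0) :
    (torPoly g N).Separable :=
  (separable_phiPoly g h1).of_dvd ⟨X, (torPoly_mul_X g N).symm⟩

end PhiPoly

section Field

variable {F : Type} [Field F] [Fintype F] {E : Type} [Field E] [Algebra F E]

local notation "q" => Fintype.card F

lemma torPoly_eval_eq_zero {g : E} {N : F[X]} (h1 : N.eval 1 ≠ 0) {x : E} :
    (torPoly g N).eval x = 0 ↔ aeval (theta F g) N x = 0 ∧ x ≠ 0 := by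
  have h := congrArg (eval x) (torPoly_mul_X g N)
  rw [eval_mul, eval_X, eval_phiPoly] at h
  rcases eq_or_ne x 0 with rfl | hx
  · rw [← coeff_zero_eq_eval_zero, coeff_zero_torPoly]
    simpa using h1
  · rw [← h]; simp [hx]

lemma card_roots_phiPoly {g : E} {N : F[X]} (hN : N.Monic) (h1 : N.eval 1 ≠ 0)
    (hs : (phiPoly g N).Splits) :
    Nat.card {x : E // aeval (theta F g) N x = 0} = q ^ (3 * N.natDegree) := by
  classical
  have hne := (monic_phiPoly (F := F) g hN).1.ne_zero
  rw [← (monic_phiPoly (F := F) g hN).2, hs.natDegree_eq_card_roots,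
    ← Multiset.toFinset_card_of_nodup (nodup_roots (separable_phiPoly g h1)),
    ← Fintype.card_coe, ← Nat.card_eq_fintype_card]
  refine Nat.card_congr (Equiv.subtypeEquivRight fun x => ?_)
  rw [Multiset.mem_toFinset, mem_roots hne, IsRoot.def, eval_phiPoly]

end Field

end

section Colength

open PowerSeries

variable {κ : Type} [Field κ] {n : Type} [Fintype n] [DecidableEq n]

/-- Dropping the constant coefficient of a power series. -/
noncomputable def shiftMap (κ : Type) [Field κ] : PowerSeries κ →ₗ[κ] PowerSeries κ where
  toFun f := PowerSeries.mk fun i => PowerSeries.coeff (i + 1) f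
  map_add' f g := by ext; simp
  map_smul' c f := by ext; simp

lemma eq_X_mul_shiftMap {f : PowerSeries κ} (h : constantCoeff f = 0) :
    f = X * shiftMap κ f := by
  have := PowerSeries.eq_X_mul_shift_add_const f
  rw [h, map_zero, add_zero] at this
  exact this

/-- The cokernel of a square matrix over `κ⟦X⟧` has dimension at most the order of its
determinant. -/
lemma exists_linearMap_ker_le_range (k : ℕ) : ∀ (M : Matrix n n (PowerSeries κ)) (u : PowerSeries κ),
    IsUnit u → M.det = X ^ k * u → ∃ L : (n → PowerSeries κ) →ₗ[κ] (Fin k → κ),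
      ∀ h, L h = 0 → ∃ z, M.mulVec z = h := by
  induction k with
  | zero =>
    intro M u hu hdet
    rw [pow_zero, one_mul] at hdet
    refine ⟨0, fun h _ => ?_⟩
    have : IsUnit M := (Matrix.isUnit_iff_isUnit_det M).mpr (hdet ▸ hu)
    exact Matrix.mulVec_surjective_iff_isUnit.mpr this h
  | succ k ih =>
    intro M u hu hdet
    have h0 : (M.map (constantCoeff (R := κ))).det = 0 := by
      have := congrArg (constantCoeff (R := κ)) hdet
      rw [RingHom.map_det] at this
      rw [← RingHom.mapMatrix_apply, this]; simp
    obtain ⟨v, hv0, hv⟩ := Matrix.exists_vecMul_eq_zero_iff.mpr h0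
    obtain ⟨j, hj⟩ := Function.ne_iff.mp hv0
    set U : Matrix n n (PowerSeries κ) := (1 : Matrix n n (PowerSeries κ)).updateRow j (fun i => C (v i))
      with hU
    have hUdet : U.det = C (v j) := by
      have h1 : (fun i => C (v i)) = ∑ i, C (v i) • (fun l => (1 : Matrix n n (PowerSeries κ)) i l) := by
        funext l
        simp [Matrix.one_apply]
      rw [hU, h1, Matrix.det_updateRow_sum]; simp
    have hUunit : IsUnit U.det := by
      rw [hUdet]; exact (isUnit_iff_ne_zero.mpr hj).map C
    have hrow : ∀ l, constantCoeff ((U * M) j l) = 0 := by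
      intro l
      have := congrFun hv l
      rw [Matrix.mul_apply, map_sum]
      simpa [hU, Matrix.vecMul, dotProduct] using this
    set M' : Matrix n n (PowerSeries κ) := fun i l => if i = j then shiftMap κ ((U * M) j l) else (U * M) i l
      with hM'
    have hUM : ∀ i l, (U * M) i l = (if i = j then X else 1) * M' i l := by
      intro i l
      by_cases h : i = j
      · subst h; simp only [hM', if_true]; exact eq_X_mul_shiftMap (hrow l)
      · simp [hM', h]
    have hUM' : U * M = Matrix.diagonal (fun i => if i = j then X else 1) * M' := by
      ext1 i l
      rw [Matrix.diagonal_mul]; exact hUM i l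
    have hdet' : M'.det = X ^ k * (C (v j) * u) := by
      have := congrArg Matrix.det hUM'
      rw [Matrix.det_mul, Matrix.det_mul, Matrix.det_diagonal, hUdet, hdet,
        Finset.prod_ite_eq' Finset.univ j (fun _ => (X : PowerSeries κ))] at this
      simp only [Finset.mem_univ, if_true] at this
      refine PowerSeries.X_mul_cancel ?_
      rw [← this]; ring
    obtain ⟨L, hL⟩ := ih M' _ (((isUnit_iff_ne_zero.mpr hj).map C).mul hu) hdet'
    set Ulin : (n → PowerSeries κ) →ₗ[κ] (n → PowerSeries κ) :=
      (Matrix.mulVecLin U).restrictScalars κ with hUlin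
    have hUl : ∀ h, Ulin h = U.mulVec h := fun h => rfl
    set T : (n → PowerSeries κ) →ₗ[κ] (n → PowerSeries κ) :=
      LinearMap.pi fun i => if i = j then shiftMap κ ∘ₗ LinearMap.proj i ∘ₗ Ulin
        else LinearMap.proj i ∘ₗ Ulin with hT
    refine ⟨LinearMap.pi (Fin.cons (PowerSeries.coeff (R := κ) 0 ∘ₗ LinearMap.proj j ∘ₗ Ulin)
      fun l => LinearMap.proj l ∘ₗ L ∘ₗ T), fun h hh => ?_⟩
    have hh0 : constantCoeff (U.mulVec h j) = 0 := by
      simpa [hUl] using congrFun hh 0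
    have hh1 : L (T h) = 0 := by
      funext l; simpa using congrFun hh l.succ
    obtain ⟨z, hz⟩ := hL _ hh1
    refine ⟨z, ?_⟩
    have hUz : U.mulVec (M.mulVec z) = U.mulVec h := by
      rw [Matrix.mulVec_mulVec, hUM', ← Matrix.mulVec_mulVec, hz]
      funext i
      rw [Matrix.mulVec_diagonal]
      by_cases hi : i = j
      · subst hi
        simp only [if_true, hT, LinearMap.pi_apply, LinearMap.comp_apply, hUl]
        exact (eq_X_mul_shiftMap hh0).symm
      · simp [hi, hT, hUl]
    exact Matrix.mulVec_injective_of_isUnit ((Matrix.isUnit_iff_isUnit_det U).mpr hUunit) hUz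

end Colength

section Lattice

open Polynomial Module

variable {κ : Type} [Field κ] {n : Type} [Fintype n] [DecidableEq n]

/-- Expansion of polynomials at infinity. -/
noncomputable def polyInf (κ : Type) [Field κ] : κ[X] →ₐ[κ] LaurentSeries κ :=
  aeval (HahnSeries.single (-1 : ℤ) (1 : κ))

lemma single_mul_single_one (a b : ℤ) :
    (HahnSeries.single a (1 : κ)) * HahnSeries.single b (1 : κ) = HahnSeries.single (a + b) 1 := by
  rw [HahnSeries.single_mul_single, one_mul]

lemma polyInf_reflect {D : ℕ} {h : κ[X]} (hD : h.natDegree ≤ D) :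
    polyInf κ (reflect D h) = HahnSeries.single (-(D : ℤ)) 1 *
      HahnSeries.ofPowerSeries ℤ κ (h : PowerSeries κ) := by
  have h1 : (HahnSeries.single (1 : ℤ) (1 : κ)) * HahnSeries.single (-1) 1 = 1 := by
    rw [single_mul_single_one]; rfl
  let _ : Invertible (HahnSeries.single (1 : ℤ) (1 : κ)) :=
    ⟨HahnSeries.single (-1) 1, by rw [mul_comm, h1], h1⟩
  have h2 := eval₂_reflect_mul_pow (algebraMap κ (LaurentSeries κ))
    (HahnSeries.single (1 : ℤ) (1 : κ)) D h hD
  have h3 : ∀ p : κ[X], eval₂ (algebraMap κ (LaurentSeries κ)) (HahnSeries.single (1 : ℤ) (1 : κ)) p =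
      HahnSeries.ofPowerSeries ℤ κ (p : PowerSeries κ) := by
    intro p
    induction p using Polynomial.induction_on' with
    | add p r hp hr => rw [eval₂_add, hp, hr, coe_add, map_add]
    | monomial i a =>
      rw [eval₂_monomial, ← C_mul_X_pow_eq_monomial, coe_mul, coe_C, coe_pow, coe_X, map_mul,
        map_pow, HahnSeries.ofPowerSeries_X, HahnSeries.ofPowerSeries_C,
        HahnSeries.algebraMap_apply']
      simp
  rw [h3] at h2
  rw [← h2, polyInf, aeval_def, mul_comm, mul_assoc]
  have h4 : (HahnSeries.single (1 : ℤ) (1 : κ)) ^ D = HahnSeries.single (D : ℤ) 1 := by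
    rw [HahnSeries.single_pow]; simp
  rw [h4, single_mul_single_one, add_neg_cancel]
  exact (mul_one _).symm

lemma order_ofPowerSeries_nonneg (f : PowerSeries κ) :
    0 ≤ (HahnSeries.ofPowerSeries ℤ κ f).order := by
  rcases eq_or_ne (HahnSeries.ofPowerSeries ℤ κ f) 0 with h | h
  · rw [h, HahnSeries.order_zero]
  · rw [HahnSeries.le_order_iff_forall h]
    intro j hj
    rw [HahnSeries.ofPowerSeries_apply]
    apply HahnSeries.embDomain_of_notMem_range
    rintro ⟨i, rfl⟩
    simp at hj
    omega

lemma order_ofPowerSeries_unit {f : PowerSeries κ} (hf : IsUnit f) :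
    (HahnSeries.ofPowerSeries ℤ κ f).order = 0 := by
  obtain ⟨u, hu⟩ := hf.exists_right_inv
  have h1 : HahnSeries.ofPowerSeries ℤ κ f * HahnSeries.ofPowerSeries ℤ κ u = 1 := by
    rw [← map_mul, hu, map_one]
  have h2 := HahnSeries.order_mul (left_ne_zero_of_mul_eq_one h1) (right_ne_zero_of_mul_eq_one h1)
  rw [h1, HahnSeries.order_one] at h2
  have := order_ofPowerSeries_nonneg f
  have := order_ofPowerSeries_nonneg u
  omega

lemma exists_eq_X_pow_mul_unit {f : PowerSeries κ} (hf : f ≠ 0) :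
    ∃ (k : ℕ) (u : PowerSeries κ), IsUnit u ∧ f = PowerSeries.X ^ k * u ∧
      (HahnSeries.ofPowerSeries ℤ κ f).order = k := by
  obtain ⟨u, hu⟩ := PowerSeries.X_pow_order_dvd (φ := f)
  have hunit : IsUnit u := by
    rw [PowerSeries.isUnit_iff_constantCoeff, isUnit_iff_ne_zero]
    intro h0
    obtain ⟨w, rfl⟩ := PowerSeries.X_dvd_iff.mpr h0
    have h1 : PowerSeries.X ^ (f.order.toNat + 1) ∣ f := ⟨w, by rw [pow_succ, mul_assoc]; exact hu⟩
    have h2 := PowerSeries.X_pow_dvd_iff.mp h1 f.order.toNat (Nat.lt_succ_self _)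
    exact PowerSeries.coeff_order hf h2
  refine ⟨_, u, hunit, hu, ?_⟩
  rw [hu, map_mul, HahnSeries.ofPowerSeries_X_pow, HahnSeries.order_mul (by simp)
    (by intro h; rw [map_eq_zero_iff _ HahnSeries.ofPowerSeries_injective] at h
        rw [h] at hunit; exact not_isUnit_zero hunit),
    HahnSeries.order_single one_ne_zero, order_ofPowerSeries_unit hunit, ← hu, add_zero]

lemma exists_ofPowerSeries_eq_single_mul {D : ℤ} {f : LaurentSeries κ} (h : 0 ≤ D + f.order) :
    ∃ p : PowerSeries κ, HahnSeries.ofPowerSeries ℤ κ p = HahnSeries.single D 1 * f := by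
  refine ⟨PowerSeries.X ^ (D + f.order).toNat * f.powerSeriesPart, ?_⟩
  conv_rhs => rw [← LaurentSeries.single_order_mul_powerSeriesPart f]
  rw [← mul_assoc, single_mul_single_one, map_mul, HahnSeries.ofPowerSeries_X_pow, Int.toNat_of_nonneg h]

/-- Riemann's inequality for vector bundles on the projective line. -/
lemma exists_injective_polyInf (A : Matrix n n (LaurentSeries κ)) (hA : A.det ≠ 0) :
    ∃ m : ℕ, (Fintype.card n : ℤ) - A.det.order ≤ m ∧ ∃ Ψ : (Fin m → κ) →ₗ[κ] (n → κ[X]),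
      Function.Injective Ψ ∧ ∀ v, ∃ z : n → PowerSeries κ, ∀ i,
        polyInf κ (Ψ v i) = ∑ j, A i j * HahnSeries.ofPowerSeries ℤ κ (z j) := by
  classical
  obtain ⟨D, hD⟩ : ∃ D : ℕ, ∀ i j, 0 ≤ (D : ℤ) + (A i j).order := by
    refine ⟨∑ i, ∑ j, (A i j).order.natAbs, fun i j => ?_⟩
    have h1 : (A i j).order.natAbs ≤ ∑ i, ∑ j, (A i j).order.natAbs :=
      (Finset.single_le_sum (f := fun j => (A i j).order.natAbs) (fun _ _ => Nat.zero_le _)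
        (Finset.mem_univ j)).trans (Finset.single_le_sum
        (f := fun i => ∑ j, (A i j).order.natAbs) (fun _ _ => Nat.zero_le _) (Finset.mem_univ i))
    omega
  choose M hM using fun i j => exists_ofPowerSeries_eq_single_mul (hD i j)
  have hMA : (HahnSeries.ofPowerSeries ℤ κ).mapMatrix (Matrix.of M) =
      HahnSeries.single (D : ℤ) (1 : κ) • A := by
    ext1 i j
    exact hM i j
  have hdet := congrArg Matrix.det hMA
  rw [← RingHom.map_det, Matrix.det_smul] at hdet
  have hs0 : (HahnSeries.single (D : ℤ) (1 : κ)) ≠ 0 := by simp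
  have hdet0 : (Matrix.of M).det ≠ 0 := by
    intro h
    rw [h, map_zero] at hdet
    exact mul_ne_zero (pow_ne_zero _ hs0) hA hdet.symm
  obtain ⟨k, u, hu, hku, hord⟩ := exists_eq_X_pow_mul_unit hdet0
  rw [hdet, HahnSeries.order_mul (pow_ne_zero _ hs0) hA, HahnSeries.order_pow,
    HahnSeries.order_single one_ne_zero] at hord
  obtain ⟨L, hL⟩ := exists_linearMap_ker_le_range k _ u hu hku
  let coeLin : κ[X] →ₗ[κ] PowerSeries κ :=
    { toFun := fun p => (p : PowerSeries κ)
      map_add' := fun p r => coe_add p r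
      map_smul' := fun c p => by simp }
  let pol : (Fin (D + 1) → κ) →ₗ[κ] κ[X] :=
    (degreeLT κ (D + 1)).subtype ∘ₗ (degreeLTEquiv κ (D + 1)).symm.toLinearMap
  have hpol : ∀ v, (pol v).natDegree ≤ D := fun v => by
    have h := mem_degreeLT.mp ((degreeLTEquiv κ (D + 1)).symm v).2
    exact natDegree_le_of_degree_le (Order.le_of_lt_succ (by exact_mod_cast h))
  have hpoli : Function.Injective pol :=
    Subtype.val_injective.comp (degreeLTEquiv κ (D + 1)).symm.injective
  let inc : (n → Fin (D + 1) → κ) →ₗ[κ] (n → PowerSeries κ) :=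
    LinearMap.pi fun i => coeLin ∘ₗ pol ∘ₗ LinearMap.proj i
  obtain ⟨K, hK⟩ : ∃ K, K = LinearMap.ker (L ∘ₗ inc) := ⟨_, rfl⟩
  have hKdim : Fintype.card n * (D + 1) ≤ finrank κ K + k := by
    have h1 := LinearMap.finrank_range_add_finrank_ker (L ∘ₗ inc)
    rw [← hK] at h1
    have h2 : finrank κ (LinearMap.range (L ∘ₗ inc)) ≤ k := by
      refine (Submodule.finrank_le _).trans ?_
      simp
    have h3 : finrank κ (n → Fin (D + 1) → κ) = Fintype.card n * (D + 1) := by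
      rw [Module.finrank_pi_fintype]; simp
    omega
  let refl : κ[X] →ₗ[κ] κ[X] :=
    { toFun := reflect D
      map_add' := fun p r => reflect_add p r D
      map_smul' := fun c p => by
        rw [smul_eq_C_mul, reflect_C_mul, RingHom.id_apply, smul_eq_C_mul] }
  have hrefl : Function.Injective refl := by
    rw [injective_iff_map_eq_zero]
    intro p hp
    exact (reflect_eq_zero_iff).mp hp
  let e := (finBasis κ K).equivFun.symm
  refine ⟨finrank κ K, ?_, (LinearMap.pi fun i => refl ∘ₗ pol ∘ₗ
    LinearMap.proj i) ∘ₗ K.subtype ∘ₗ e.toLinearMap, ?_, fun v => ?_⟩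
  · have : (Fintype.card n : ℤ) * (D + 1) ≤ finrank κ K + k := by exact_mod_cast hKdim
    have h2 : Fintype.card n • (D : ℤ) = (Fintype.card n : ℤ) * D := by simp
    rw [h2] at hord
    linarith
  · rw [injective_iff_map_eq_zero]
    intro v hv
    have h1 : ((e v : K) : n → Fin (D + 1) → κ) = 0 := by
      funext i
      exact (injective_iff_map_eq_zero pol).mp hpoli _
        ((injective_iff_map_eq_zero refl).mp hrefl _ (congrFun hv i))
    have h2 : e v = 0 := Subtype.ext h1
    exact e.map_eq_zero_iff.mp h2
  · obtain ⟨z, hz⟩ := hL (inc (e v)) (LinearMap.mem_ker.mp (hK ▸ (e v).2))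
    refine ⟨z, fun i => ?_⟩
    have h1 : ((pol (((e v : K) : n → Fin (D + 1) → κ) i) : κ[X]) : PowerSeries κ) =
        ∑ j, M i j * z j := (congrFun hz i).symm
    change polyInf κ (reflect D (pol (((e v : K) : n → Fin (D + 1) → κ) i))) = _
    rw [polyInf_reflect (hpol _), h1, map_sum, Finset.mul_sum]
    refine Finset.sum_congr rfl fun j _ => ?_
    rw [map_mul, hM, ← mul_assoc, ← mul_assoc, single_mul_single_one, neg_add_cancel]
    congr 1
    exact one_mul _

end Lattice

section Vandermonde

open Polynomial Module

variable {E : Type} [NormedField E]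

lemma lev_prod {I : Type} (g : E) (s : Finset I) {f : I → E} (hf : ∀ i ∈ s, f i ≠ 0) :
    lev g (∏ i ∈ s, f i) = ∑ i ∈ s, lev g (f i) := by
  rw [lev, norm_prod, Real.logb_prod _ _ fun i hi => norm_ne_zero_iff.mpr (hf i hi)]
  rfl

lemma lev_neg (g x : E) : lev g (-x) = lev g x := by rw [lev, norm_neg]; rfl

lemma lev_sub_comm (g x y : E) : lev g (x - y) = lev g (y - x) := by
  rw [← neg_sub, lev_neg]

lemma two_mul_lev_det_vandermonde (g : E) {k : ℕ} {v : Fin k → E} (hv : Function.Injective v) :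
    2 * lev g (Matrix.vandermonde v).det = ∑ i, ∑ j ∈ {i}ᶜ, lev g (v i - v j) := by
  rw [Matrix.det_vandermonde, lev_prod, ← Finset.sum_sum_Ioi_add_eq_sum_sum_off_diag, two_mul,
    ← Finset.sum_add_distrib]
  · refine Finset.sum_congr rfl fun i _ => ?_
    rw [lev_prod, ← Finset.sum_add_distrib]
    · exact Finset.sum_congr rfl fun j _ => by rw [lev_sub_comm g (v i)]
    · exact fun j hj => sub_ne_zero.mpr (hv.ne (Finset.mem_Ioi.mp hj).ne')
  · exact fun i _ => Finset.prod_ne_zero_iff.mpr fun j hj =>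
      sub_ne_zero.mpr (hv.ne (Finset.mem_Ioi.mp hj).ne')

lemma two_mul_lev_det_of_bijective (g : E) {J : Type} [Fintype J] [DecidableEq J] {u : J → E}
    (hu : Function.Injective u) {a : J → ℕ} (ha : Function.Injective a)
    (hlt : ∀ j, a j < Fintype.card J) :
    (Matrix.of fun i j => u i ^ a j).det ≠ 0 ∧
    2 * lev g (Matrix.of fun i j => u i ^ a j).det = ∑ i, ∑ j ∈ {i}ᶜ, lev g (u i - u j) := by
  let e : J ≃ Fin (Fintype.card J) := Equiv.ofBijective (fun j => ⟨a j, hlt j⟩)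
    ((Fintype.bijective_iff_injective_and_card _).mpr
      ⟨fun i j h => ha (Fin.mk.inj_iff.mp h), by simp⟩)
  have h1 : (Matrix.of fun i j => u i ^ a j) =
      (Matrix.vandermonde (u ∘ e.symm)).submatrix e e := by
    ext i j
    simp [Matrix.vandermonde, e]
  rw [h1, Matrix.det_submatrix_equiv_self]
  refine ⟨Matrix.det_vandermonde_ne_zero_iff.mpr (hu.comp e.symm.injective), ?_⟩
  rw [two_mul_lev_det_vandermonde g (hu.comp e.symm.injective)]
  refine Fintype.sum_equiv e.symm _ _ fun i => ?_
  refine Finset.sum_bij (fun j _ => e.symm j) ?_ ?_ ?_ ?_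
  · intro j hj; simpa using hj
  · intro j _ j' _ h; exact e.symm.injective h
  · intro j hj; exact ⟨e j, by simpa [Equiv.eq_symm_apply] using hj, by simp⟩
  · intro j _; rfl

lemma two_mul_lev_det_block (g : E) (hg : g ≠ 0) {I α : Type} [Fintype I] [DecidableEq I]
    [Fintype α] [DecidableEq α] {u : I → E} {l : I → α} (hu : ∀ i j, l i = l j → u i = u j → i = j)
    {a : I → ℕ} (ha : ∀ i j, l i = l j → a i = a j → i = j)
    (hlt : ∀ i, a i < Fintype.card {j // l j = l i}) (τ : I → ℤ) :
    (Matrix.of fun i j => if l i = l j then g ^ τ j * u i ^ a j else 0).det ≠ 0 ∧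
    2 * lev g (Matrix.of fun i j => if l i = l j then g ^ τ j * u i ^ a j else 0).det =
      2 * ∑ j, (τ j : ℝ) * lev g g + ∑ i, ∑ j with j ≠ i ∧ l j = l i, lev g (u i - u j) := by
  classical
  let B : Matrix I I E := Matrix.of fun i j => if l i = l j then u i ^ a j else 0
  have h0 : (Matrix.of fun i j => if l i = l j then g ^ τ j * u i ^ a j else 0) =
      Matrix.of fun i j => g ^ τ j * B i j := by
    ext i j
    simp only [Matrix.of_apply, B]
    split_ifs <;> simp
  rw [h0, show (Matrix.of fun i j => g ^ τ j * B i j).det = (∏ j, g ^ τ j) * B.det from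
    Matrix.det_mul_row (fun j => g ^ τ j) B]
  let _ : LinearOrder α := IsWellOrder.linearOrder WellOrderingRel
  have htri : B.BlockTriangular l := by
    intro i j hij
    simp only [Matrix.of_apply, B]
    rw [if_neg (ne_of_gt hij)]
  have hdet := htri.det_fintype
  have hblock : ∀ k, (B.toSquareBlock l k).det ≠ 0 ∧ 2 * lev g (B.toSquareBlock l k).det =
      ∑ i : {i // l i = k}, ∑ j ∈ {i}ᶜ, lev g (u i - u j) := by
    intro k
    have h1 : B.toSquareBlock l k = Matrix.of fun (i j : {i // l i = k}) => u i ^ a j := by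
      ext i j
      rw [Matrix.toSquareBlock_def]
      simp only [Matrix.of_apply, B]
      rw [if_pos (i.2.trans j.2.symm)]
    rw [h1]
    have h2 := two_mul_lev_det_of_bijective g (J := {i // l i = k}) (u := fun i => u i)
      (a := fun i => a i)
      (fun i j h => Subtype.ext (hu _ _ (i.2.trans j.2.symm) h))
      (fun i j h => Subtype.ext (ha _ _ (i.2.trans j.2.symm) h)) (fun j => by
        obtain ⟨j, rfl⟩ := j
        convert hlt j)
    convert h2
  have hB0 : B.det ≠ 0 := by
    rw [hdet]
    exact Finset.prod_ne_zero_iff.mpr fun k _ => (hblock k).1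
  have hp0 : (∏ j, g ^ τ j) ≠ 0 := Finset.prod_ne_zero_iff.mpr fun j _ => zpow_ne_zero _ hg
  refine ⟨mul_ne_zero hp0 hB0, ?_⟩
  have hmul : lev g ((∏ j, g ^ τ j) * B.det) = lev g (∏ j, g ^ τ j) + lev g B.det := by
    rw [lev, norm_mul, Real.logb_mul (norm_ne_zero_iff.mpr hp0) (norm_ne_zero_iff.mpr hB0)]
    rfl
  rw [hmul, mul_add]
  congr 1
  · rw [lev_prod _ _ fun j _ => zpow_ne_zero _ hg]
    congr 1
    refine Finset.sum_congr rfl fun j _ => ?_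
    rw [lev, norm_zpow, ← Real.rpow_intCast, Real.logb_rpow_eq_mul_logb_of_pos (norm_pos_iff.mpr hg)]
    rfl
  · rw [hdet, lev_prod _ _ fun k _ => (hblock k).1, Finset.mul_sum,
      ← Finset.sum_fiberwise_of_maps_to (t := Finset.univ) (g := l) (fun _ _ => Finset.mem_univ _)]
    refine Finset.sum_congr rfl fun k _ => ?_
    rw [(hblock k).2]
    rw [Finset.sum_subtype (F := inferInstance) (p := fun i => l i = k)
      (Finset.univ.filter fun i => l i = k) (by simp)
      (f := fun i => ∑ j with j ≠ i ∧ l j = l i, lev g (u i - u j))]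
    refine Finset.sum_congr (by ext; simp) fun i _ => ?_
    refine Finset.sum_bij (fun j _ => (j : I)) ?_ ?_ ?_ ?_
    · intro j hj
      simp only [Finset.mem_compl, Finset.mem_singleton] at hj
      simp only [Finset.mem_filter, Finset.mem_univ, true_and]
      exact ⟨fun h => hj (Subtype.ext h), j.2.trans i.2.symm⟩
    · intro j _ j' _ h; exact Subtype.ext h
    · intro j hj
      simp only [Finset.mem_filter, Finset.mem_univ, true_and] at hj
      exact ⟨⟨j, hj.2.trans i.2⟩, by simpa [Subtype.ext_iff] using hj.1, rfl⟩
    · intro j _; rfl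

end Vandermonde

section Interpolation

open Polynomial Module

variable {κ : Type} [Field κ] {E : Type} [NormedField E] [IsUltrametricDist E]
  [Algebra (LaurentSeries κ) E]

lemma norm_algebraMap_ofPowerSeries_le {g : E} (hg : 1 < ‖g‖)
    (hord : ∀ z : LaurentSeries κ, z ≠ 0 → ‖algebraMap (LaurentSeries κ) E z‖ = ‖g‖ ^ (-z.order))
    (f : PowerSeries κ) : ‖algebraMap (LaurentSeries κ) E (HahnSeries.ofPowerSeries ℤ κ f)‖ ≤ 1 := by
  rcases eq_or_ne (HahnSeries.ofPowerSeries ℤ κ f) 0 with h | h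
  · rw [h, map_zero, norm_zero]; exact zero_le_one
  · rw [hord _ h]
    exact zpow_le_one_of_nonpos₀ hg.le (neg_nonpos.mpr (order_ofPowerSeries_nonneg f))

/-- Interpolation at a Galois-stable set of points by a polynomial over the base field. -/
lemma exists_interpolation {k L : Type} [Field k] [Field L] [Algebra k L] [FiniteDimensional k L]
    [IsGalois k L] {I : Type} [Fintype I] [DecidableEq I] {x : I → L} (hx : Function.Injective x)
    (b : I → L) (hb : ∀ (σ : L ≃ₐ[k] L) i, ∃ j, x j = σ (x i) ∧ b j = σ (b i)) :
    ∃ c : Fin (Fintype.card I) → k, ∀ i, ∑ j, algebraMap k L (c j) * x i ^ (j : ℕ) = b i := by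
  let p := Lagrange.interpolate Finset.univ x b
  have hinj : Set.InjOn x (Finset.univ : Finset I) := hx.injOn
  have hp : ∀ i, p.eval (x i) = b i := fun i =>
    Lagrange.eval_interpolate_at_node b hinj (Finset.mem_univ i)
  have hdeg : p.degree < Fintype.card I := Lagrange.degree_interpolate_lt b hinj
  have hfix : ∀ σ : L ≃ₐ[k] L, p.map (σ : L →+* L) = p := by
    intro σ
    refine Polynomial.eq_of_degrees_lt_of_eval_index_eq Finset.univ hinj
      ((degree_map_le).trans_lt hdeg) hdeg fun i _ => ?_
    obtain ⟨j, hj, hj'⟩ := hb σ.symm i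
    have h1 : x i = σ (x j) := by rw [hj]; simp
    have h2 : b i = σ (b j) := by rw [hj']; simp
    rw [hp, h2, ← hp, h1]
    exact eval_map_apply (σ : L →+* L) (x j)
  have hc : ∀ j, ∃ c : k, algebraMap k L c = p.coeff j := by
    intro j
    refine (IsGalois.mem_range_algebraMap_iff_fixed _).mpr fun σ => ?_
    conv_rhs => rw [← hfix σ, coeff_map]
    rfl
  choose c hc using hc
  refine ⟨fun j => c j, fun i => ?_⟩
  have hnat : p.natDegree < Fintype.card I := by
    rcases eq_or_ne p 0 with h | h
    · rw [h, natDegree_zero]; exact Fintype.card_pos_iff.mpr ⟨i⟩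
    · exact (natDegree_lt_iff_degree_lt h).mpr hdeg
  rw [← hp, eval_eq_sum_range' hnat, Finset.sum_range]
  exact Finset.sum_congr rfl fun j _ => by rw [hc]

lemma exists_bounded_family [FiniteDimensional (LaurentSeries κ) E] [IsGalois (LaurentSeries κ) E]
    {g : LaurentSeries κ} (hg : 1 < ‖algebraMap (LaurentSeries κ) E g‖)
    (hord : ∀ z : LaurentSeries κ, z ≠ 0 →
      ‖algebraMap (LaurentSeries κ) E z‖ = ‖algebraMap (LaurentSeries κ) E g‖ ^ (-z.order))
    {I α : Type} [Fintype I] [DecidableEq I] [Fintype α] [DecidableEq α] {x u : I → E} {l : I → α}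
    (hx : Function.Injective x) (hu : ∀ i j, l i = l j → u i = u j → i = j)
    {a : I → ℕ} (ha : ∀ i j, l i = l j → a i = a j → i = j)
    (hlt : ∀ i, a i < Fintype.card {j // l j = l i}) (τ : I → ℤ)
    (hgal : ∀ (σ : E ≃ₐ[LaurentSeries κ] E) i, ∃ j, x j = σ (x i) ∧ l j = l i ∧ u j = σ (u i))
    {R : ℝ} (hR : 0 ≤ R)
    (hbd : ∀ i j, l i = l j → ‖algebraMap (LaurentSeries κ) E g ^ τ j * u i ^ a j‖ ≤ R) :
    ∃ m : ℕ, (Fintype.card I + ∑ j, (τ j : ℝ) +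
      (∑ i, ∑ j with j ≠ i ∧ l j = l i, lev (algebraMap (LaurentSeries κ) E g) (u i - u j)) / 2 -
      (∑ i, ∑ j with j ≠ i, lev (algebraMap (LaurentSeries κ) E g) (x i - x j)) / 2 : ℝ) ≤ m ∧
      ∃ Ψ : (Fin m → κ) →ₗ[κ] (Fin (Fintype.card I) → κ[X]), Function.Injective Ψ ∧
        ∀ v i, ‖∑ j, algebraMap (LaurentSeries κ) E (polyInf κ (Ψ v j)) * x i ^ (j : ℕ)‖ ≤ R := by
  classical
  obtain ⟨G, hG⟩ : ∃ G, G = algebraMap (LaurentSeries κ) E g := ⟨_, rfl⟩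
  simp only [← hG] at hg hbd hord ⊢
  have hG0 : G ≠ 0 := ne_zero_of_one_lt_norm hg
  let B : Matrix I I E := Matrix.of fun i j => if l i = l j then G ^ τ j * u i ^ a j else 0
  have hB := two_mul_lev_det_block G hG0 hu ha hlt τ
  have hcol : ∀ j, ∃ c : Fin (Fintype.card I) → LaurentSeries κ, ∀ i,
      ∑ k, algebraMap (LaurentSeries κ) E (c k) * x i ^ (k : ℕ) = B i j := by
    intro j
    refine exists_interpolation hx (fun i => B i j) fun σ i => ?_
    obtain ⟨i', h1, h2, h3⟩ := hgal σ i
    refine ⟨i', h1, ?_⟩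
    simp only [B, Matrix.of_apply]
    rw [h2, h3]
    split_ifs
    · rw [map_mul, map_zpow₀, map_pow, hG, AlgEquiv.commutes]
    · rw [map_zero]
  choose c hc using hcol
  let e := Fintype.equivFin I
  let A : Matrix (Fin (Fintype.card I)) (Fin (Fintype.card I)) (LaurentSeries κ) :=
    Matrix.of fun k j => c (e.symm j) k
  have hmul : Matrix.vandermonde (x ∘ e.symm) * (algebraMap (LaurentSeries κ) E).mapMatrix A =
      B.submatrix e.symm e.symm := by
    ext i j
    rw [Matrix.mul_apply, Matrix.submatrix_apply, ← hc]
    refine Finset.sum_congr rfl fun k _ => ?_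
    rw [mul_comm]
    rfl
  have hdet := congrArg Matrix.det hmul
  rw [Matrix.det_mul, Matrix.det_submatrix_equiv_self, ← RingHom.map_det] at hdet
  have hV0 : (Matrix.vandermonde (x ∘ e.symm)).det ≠ 0 :=
    Matrix.det_vandermonde_ne_zero_iff.mpr (hx.comp e.symm.injective)
  have hA0 : A.det ≠ 0 := by
    intro h
    rw [h, map_zero, mul_zero] at hdet
    exact hB.1 hdet.symm
  have hlevA : lev G (algebraMap (LaurentSeries κ) E A.det) = -A.det.order := by
    rw [lev, hord _ hA0, ← Real.rpow_intCast, Real.logb_rpow (by linarith) hg.ne']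
    push_cast; rfl
  have hlev := congrArg (lev G) hdet
  rw [lev_mul hV0 ((_root_.map_ne_zero _).mpr hA0), hlevA] at hlev
  have hVlev := two_mul_lev_det_vandermonde G (v := x ∘ e.symm) (hx.comp e.symm.injective)
  have hVsum : ∑ i, ∑ j ∈ {i}ᶜ, lev G ((x ∘ e.symm) i - (x ∘ e.symm) j) =
      ∑ i, ∑ j with j ≠ i, lev G (x i - x j) := by
    refine Fintype.sum_equiv e.symm _ _ fun i => ?_
    refine Finset.sum_bij (fun j _ => e.symm j) ?_ ?_ ?_ ?_
    · intro j hj; simpa using hj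
    · intro j _ j' _ h; exact e.symm.injective h
    · intro j hj; exact ⟨e j, by simpa [Equiv.eq_symm_apply] using hj, by simp⟩
    · intro j _; rfl
  obtain ⟨m, hm, Ψ, hΨ, hΨ'⟩ := exists_injective_polyInf A hA0
  refine ⟨m, ?_, Ψ, hΨ, fun v i => ?_⟩
  · have h1 : ((Fintype.card I : ℝ) - A.det.order) ≤ m := by
      rw [Fintype.card_fin] at hm; exact_mod_cast hm
    have h2 := hB.2
    rw [lev_self hg] at h2
    simp only [mul_one] at h2
    change 2 * lev G B.det = _ at h2
    rw [hVsum] at hVlev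
    linarith
  · obtain ⟨z, hz⟩ := hΨ' v
    have h1 : ∑ j, algebraMap (LaurentSeries κ) E (polyInf κ (Ψ v j)) * x i ^ (j : ℕ) =
        ∑ j, B i (e.symm j) *
          algebraMap (LaurentSeries κ) E (HahnSeries.ofPowerSeries ℤ κ (z j)) := by
      simp only [hz, map_sum, map_mul, Finset.sum_mul]
      rw [Finset.sum_comm]
      refine Finset.sum_congr rfl fun j _ => ?_
      rw [← hc, Finset.sum_mul]
      exact Finset.sum_congr rfl fun k _ => by simp only [A, Matrix.of_apply]; ring
    rw [h1]
    refine IsUltrametricDist.norm_sum_le_of_forall_le_of_nonneg hR fun j _ => ?_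
    rw [norm_mul]
    refine (mul_le_of_le_one_right (norm_nonneg _)
      (norm_algebraMap_ofPowerSeries_le hg hord _)).trans ?_
    simp only [B, Matrix.of_apply]
    split_ifs with h
    · exact hbd _ _ h
    · rw [norm_zero]; exact hR

end Interpolation

section Enumeration

lemma exists_enumeration {I α : Type} [Fintype I] [DecidableEq α] (l : I → α) :
    ∃ a : I → ℕ, (∀ i j, l i = l j → a i = a j → i = j) ∧
      (∀ i, a i < Fintype.card {j // l j = l i}) ∧
      ∀ (c : α) (f : ℕ → ℝ), ∑ j with l j = c, f (a j) =
        ∑ i ∈ Finset.range (Fintype.card {j // l j = c}), f i := by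
  let e : ∀ c, {j // l j = c} ≃ Fin (Fintype.card {j // l j = c}) := fun c => Fintype.equivFin _
  have he : ∀ c (i : I) (h : l i = c), ((e (l i) ⟨i, rfl⟩ : ℕ)) = e c ⟨i, h⟩ := by
    rintro _ i rfl; rfl
  refine ⟨fun i => e (l i) ⟨i, rfl⟩, fun i j hij h => ?_, fun i => (e (l i) ⟨i, rfl⟩).2,
    fun c f => ?_⟩
  · simp only at h
    rw [he (l j) i hij] at h
    exact congrArg Subtype.val ((e (l j)).injective (Fin.ext h))
  · rw [Finset.sum_subtype (F := inferInstance) (p := fun i => l i = c)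
      (Finset.univ.filter fun i => l i = c) (by simp), Finset.sum_range]
    refine Fintype.sum_equiv (e c) _ _ fun j => ?_
    exact congrArg f (he c j j.2)

lemma sum_floor_ge (r : ℝ) (k : ℕ) :
    -(k * (k - 1) / 2 * r) - k ≤ ∑ i ∈ Finset.range k, (⌊-(i * r)⌋ : ℝ) := by
  induction k with
  | zero => simp
  | succ k ih =>
    rw [Finset.sum_range_succ]
    have := Int.lt_floor_add_one (-(k * r))
    push_cast
    linarith

lemma sum_floor_ge_of_int (r : ℝ) (k : ℕ) (hk : 1 ≤ k) (c : ℤ) (hc : k * r = c) :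
    -(k * (k - 1) / 2 * r) - (k - 1) / 2 ≤ ∑ i ∈ Finset.range k, (⌊-(i * r)⌋ : ℝ) := by
  obtain ⟨e, rfl⟩ : ∃ e, k = e + 1 := ⟨k - 1, by omega⟩
  rw [Finset.sum_range_succ']
  have h1 : ∑ i ∈ Finset.range e, (⌊-(((i + 1 : ℕ) : ℝ) * r)⌋ : ℝ) +
      ∑ i ∈ Finset.range e, (⌊-(((e - 1 - i + 1 : ℕ) : ℝ) * r)⌋ : ℝ) ≥ e * (-c - 1 : ℝ) := by
    rw [← Finset.sum_add_distrib, ← nsmul_eq_mul]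
    refine (Finset.card_nsmul_le_sum _ _ _ ?_).trans' (by rw [Finset.card_range])
    intro i hi
    have hi := Finset.mem_range.mp hi
    have h2 : -(((e - 1 - i + 1 : ℕ) : ℝ) * r) = ((i + 1 : ℕ) : ℝ) * r - c := by
      rw [← hc]
      have : ((e - 1 - i + 1 : ℕ) : ℝ) = e - i := by
        rw [eq_sub_iff_add_eq]; norm_cast; omega
      rw [this]; push_cast; ring
    rw [h2, Int.floor_sub_intCast]
    have h3 : -1 ≤ ⌊-(((i + 1 : ℕ) : ℝ) * r)⌋ + ⌊((i + 1 : ℕ) : ℝ) * r⌋ := by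
      rw [Int.floor_neg]
      have := Int.ceil_le_floor_add_one (((i + 1 : ℕ) : ℝ) * r)
      omega
    have h4 : (-1 : ℝ) ≤ ⌊-(((i + 1 : ℕ) : ℝ) * r)⌋ + ⌊((i + 1 : ℕ) : ℝ) * r⌋ := by
      exact_mod_cast h3
    push_cast at h4 ⊢
    linarith
  have h5 := Finset.sum_range_reflect (fun i => (⌊-(((i + 1 : ℕ) : ℝ) * r)⌋ : ℝ)) e
  rw [h5] at h1
  have h6 : (e : ℝ) * c = e * ((e + 1) * r) := by rw [← hc]; push_cast; ring
  simp only [Nat.cast_zero, zero_mul, neg_zero, Int.floor_zero, Int.cast_zero, add_zero]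
  push_cast at h1 ⊢
  linarith

end Enumeration

section

open Polynomial Module

section Classes

variable {F : Type} [Field F] [Fintype F] {E : Type} [NormedField E] [IsUltrametricDist E]
  [Algebra F E] {N : F[X]} {k : Type} [Field k] [Algebra F k] [Algebra k E] [IsScalarTower F k E]
  {g : k}

local notation "q" => Fintype.card F

variable [FiniteDimensional F (torsion (algebraMap k E g) N)]
  [FiniteDimensional k E] [IsGalois k E]

/-- The equivalence class of a torsion point modulo the generic level and scalars. -/
noncomputable def torClass (F : Type) [Field F] [Fintype F] {E : Type} [NormedField E]
    [IsUltrametricDist E] [Algebra F E] (g : E) (N : F[X]) (x : E) : Submodule F E :=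
  torsionLe g N (levBot F) ⊔ Submodule.span F {x}

lemma torClass_of_mem {x : E} {G : E} (hx : x ∈ torsionLe G N (levBot F)) :
    torClass F G N x = torsionLe G N (levBot F) :=
  sup_eq_left.mpr ((Submodule.span_singleton_le_iff_mem _ _).mpr hx)

lemma mem_torClass (G x : E) : x ∈ torClass F G N x :=
  Submodule.mem_sup_right (Submodule.mem_span_singleton_self x)

lemma mem_of_torClass_eq {G x y : E} (h : torClass F G N x = torClass F G N y)
    (hy : y ∈ torsionLe G N (levBot F)) : x ∈ torsionLe G N (levBot F) := by
  rw [← torClass_of_mem hy, ← h]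
  exact mem_torClass _ _

lemma exists_sub_mem_of_torClass_eq {G x y : E} (h : torClass F G N y = torClass F G N x) :
    ∃ ζ : F, y - ζ • x ∈ torsionLe G N (levBot F) := by
  have h1 : y ∈ torClass F G N x := h ▸ mem_torClass G y
  obtain ⟨w, hw, s, hs, hy⟩ := Submodule.mem_sup.mp h1
  obtain ⟨ζ, rfl⟩ := Submodule.mem_span_singleton.mp hs
  exact ⟨ζ, by rw [← hy, add_sub_cancel_right]; exact hw⟩

lemma torClass_eq {G x y : E} {ζ : F} (hζ : ζ ≠ 0) (h : y - ζ • x ∈ torsionLe G N (levBot F)) :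
    torClass F G N y = torClass F G N x := by
  apply le_antisymm
  · refine sup_le le_sup_left ((Submodule.span_singleton_le_iff_mem _ _).mpr ?_)
    rw [← sub_add_cancel y (ζ • x)]
    exact Submodule.add_mem_sup h (Submodule.smul_mem _ _ (Submodule.mem_span_singleton_self x))
  · refine sup_le le_sup_left ((Submodule.span_singleton_le_iff_mem _ _).mpr ?_)
    have h1 : x = -(ζ⁻¹ • (y - ζ • x)) + ζ⁻¹ • y := by
      rw [smul_sub, smul_smul, inv_mul_cancel₀ hζ, one_smul]; ring
    rw [h1]
    exact Submodule.add_mem_sup (Submodule.neg_mem _ (Submodule.smul_mem _ _ h))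
      (Submodule.smul_mem _ _ (Submodule.mem_span_singleton_self y))

lemma torsionLe_bot_le (G : E) (hg : 1 < ‖G‖) (j : ℕ) :
    torsionLe G N (levBot F) ≤ torsionLe G N (lvl F j) := fun _ hy => ⟨hy.1, hy.2.trans
  (Real.rpow_le_rpow_of_exponent_le hg.le (levBot_lt_lvl F _).le)⟩

lemma torClass_smul_sub {G : E} (hg : 1 < ‖G‖) (hNi : Irreducible N) (hN : N.Monic)
    (hd : 1 ≤ N.natDegree) [FiniteDimensional F (torsion G N)]
    (hV : finrank F (torsion G N) = 3 * N.natDegree) {x : E} (hx : x ∈ torsion G N)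
    (hxW : x ∉ torsionLe G N (levBot F)) :
    Nat.card {y // (y ∈ torsion G N ∧ y ≠ 0) ∧ torClass F G N y = torClass F G N x} =
      (q - 1) * q ^ (2 * N.natDegree) := by
  have hx0 : x ≠ 0 := by rintro rfl; exact hxW (zero_mem _)
  have hW := (range_resMap_eq hg hNi hN hd hV hx hxW).1
  have hWc : Nat.card (torsionLe G N (levBot F)) = q ^ (2 * N.natDegree) := by
    rw [← hW, Module.natCard_eq_pow_finrank (K := F), Nat.card_eq_fintype_card]
  have hle : torClass F G N x ≤ torsion G N := sup_le torsionLe_le_torsion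
    ((Submodule.span_singleton_le_iff_mem _ _).mpr hx)
  have : FiniteDimensional F (torClass F G N x) := by
    exact Submodule.finiteDimensional_of_le hle
  have : FiniteDimensional F (torsionLe G N (levBot F)) :=
    Submodule.finiteDimensional_of_le torsionLe_le_torsion
  have hdis : torsionLe G N (levBot F) ⊓ Submodule.span F {x} = ⊥ := by
    rw [← disjoint_iff, Submodule.disjoint_span_singleton' hx0]
    exact hxW
  have hC : finrank F (torClass F G N x) = 2 * N.natDegree + 1 := by
    have h1 := Submodule.finrank_sup_add_finrank_inf_eq (torsionLe G N (levBot F))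
      (Submodule.span F {x})
    rw [hdis, finrank_bot, finrank_span_singleton hx0, hW] at h1
    exact h1
  have hCc : Nat.card (torClass F G N x) = q ^ (2 * N.natDegree + 1) := by
    rw [← hC, Module.natCard_eq_pow_finrank (K := F), Nat.card_eq_fintype_card]
  have hset : {y | (y ∈ torsion G N ∧ y ≠ 0) ∧ torClass F G N y = torClass F G N x} =
      (torClass F G N x : Set E) \ (torsionLe G N (levBot F) : Set E) := by
    ext y
    constructor
    · rintro ⟨⟨hy, hy0⟩, h⟩
      refine ⟨h ▸ mem_torClass G y, fun hyW => hxW (mem_of_torClass_eq h.symm hyW)⟩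
    · rintro ⟨hy, hyW⟩
      refine ⟨⟨hle hy, ?_⟩, ?_⟩
      · rintro rfl; exact hyW (zero_mem _)
      · obtain ⟨w, hw, s, hs, hys⟩ := Submodule.mem_sup.mp hy
        obtain ⟨ζ, rfl⟩ := Submodule.mem_span_singleton.mp hs
        have h2 : y - ζ • x ∈ torsionLe G N (levBot F) := by
          rw [← hys, add_sub_cancel_right]; exact hw
        refine torClass_eq (ζ := ζ) ?_ h2
        rintro rfl
        rw [zero_smul, sub_zero] at h2
        exact hyW h2
  have h3 := Set.ncard_sdiff (s := (torsionLe G N (levBot F) : Set E)) (t := (torClass F G N x : Set E))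
    (fun y hy => Submodule.mem_sup_left hy)
    (Set.finite_coe_iff.mp (show Finite (torsionLe G N (levBot F)) from Module.finite_of_finite F))
  rw [← hset] at h3
  change Set.ncard {y | (y ∈ torsion G N ∧ y ≠ 0) ∧ torClass F G N y = torClass F G N x} = _
  rw [h3]
  change Nat.card (torClass F G N x) - Nat.card (torsionLe G N (levBot F)) = _
  rw [hCc, hWc, pow_succ, Nat.sub_mul, one_mul, mul_comm]

/-- Local multipliers carrying a class to the lowest step above the generic level. -/
lemma exists_multiplier
    (hg : 1 < ‖algebraMap k E g‖) (hNi : Irreducible N) (hN : N.Monic) (hd : 1 ≤ N.natDegree)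
    (hV : finrank F (torsion (algebraMap k E g) N) = 3 * N.natDegree)
    (hval : ∀ z : k, z ≠ 0 → ∃ j : ℤ, ‖algebraMap k E z‖ = ‖algebraMap k E g‖ ^ j)
    (hσ : ∀ (σ : E ≃ₐ[k] E) (x : E), ‖σ x‖ = ‖x‖)
    {x : E} (hx : x ∈ torsion (algebraMap k E g) N)
    (hxW : x ∉ torsionLe (algebraMap k E g) N (levBot F)) :
    (∀ σ : E ≃ₐ[k] E, torClass F (algebraMap k E g) N (σ x) = torClass F (algebraMap k E g) N x) ∧
    ∃ b : F[X], ¬ N ∣ b ∧ ∀ y ∈ torsion (algebraMap k E g) N,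
      torClass F (algebraMap k E g) N y = torClass F (algebraMap k E g) N x →
      aeval (theta F (algebraMap k E g)) b y ∈
        torsionLe (algebraMap k E g) N (lvl F (N.natDegree - 1)) := by
  obtain ⟨v, hv, hvW, hv0, hlev, hgen⟩ := exists_generator hg hNi hN hd hV hx hxW
  have hv1 := (mem_torsionLe hg hv0).mpr ⟨hv, hlev.le⟩
  obtain ⟨b, hb, u, hu, huW, rfl⟩ := exists_aeval_theta_eq hg hNi hN hd hV hval hσ hv1 hvW hx hxW
  obtain ⟨c, hc⟩ := exists_inverse_mod (g := algebraMap k E g) hNi hb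
  constructor
  · intro σ
    obtain ⟨ζ, hζ⟩ := hgen u hu
    have hσu : σ u ∈ torsionLe (algebraMap k E g) N (lvl F (N.natDegree - 1)) :=
      (algEquiv_mem_torsionLe (hσ σ)).mpr hu
    have hσuW : σ u ∉ torsionLe (algebraMap k E g) N (levBot F) :=
      fun h => huW ((algEquiv_mem_torsionLe (hσ σ)).mp h)
    obtain ⟨ξ, hξ⟩ := hgen _ hσu
    have hζ0 : ζ ≠ 0 := by rintro rfl; rw [zero_smul, sub_zero] at hζ; exact huW hζ
    have hξ0 : ξ ≠ 0 := by rintro rfl; rw [zero_smul, sub_zero] at hξ; exact hσuW hξ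
    have h1 : σ u - (ξ * ζ⁻¹) • u ∈ torsionLe (algebraMap k E g) N (levBot F) := by
      have : σ u - (ξ * ζ⁻¹) • u = (σ u - ξ • v) - (ξ * ζ⁻¹) • (u - ζ • v) := by
        rw [smul_sub, smul_smul, mul_assoc, inv_mul_cancel₀ hζ0, mul_one]; ring
      rw [this]
      exact sub_mem hξ (Submodule.smul_mem _ _ hζ)
    refine torClass_eq (mul_ne_zero hξ0 (inv_ne_zero hζ0)) ?_
    rw [algEquiv_aeval_theta, ← map_smul, ← map_sub]
    exact aeval_theta_mem_torsionLe hg b h1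
  · refine ⟨c, ?_, fun y hy h => ?_⟩
    · rintro ⟨e, rfl⟩
      have h1 := (hc u hu.1).1
      rw [mul_comm, map_mul, Module.End.mul_apply,
        mem_torsion.mp (aeval_theta_mem b hu.1), map_zero] at h1
      rw [← h1] at huW
      exact huW (zero_mem _)
    · obtain ⟨ζ, hζ⟩ := exists_sub_mem_of_torClass_eq h
      have h1 := aeval_theta_mem_torsionLe hg c hζ
      rw [map_sub, map_smul, (hc u hu.1).1] at h1
      have h2 := torsionLe_bot_le _ hg (N.natDegree - 1) h1
      have h3 := add_mem h2 (Submodule.smul_mem _ ζ hu)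
      rwa [sub_add_cancel] at h3

end Classes

end

section

open Polynomial Module

section Sections

variable {F : Type} [Field F] [Fintype F] {E : Type} [NormedField E] [IsUltrametricDist E]
  [Algebra F E] {N : F[X]}

local notation "q" => Fintype.card F

variable (F) in
/-- Loss in Riemann's inequality per point. -/
noncomputable def loss : ℝ :=
  (1 / ((q : ℝ) - 1) + 1 / ((q : ℝ) ^ 2 - 1)) / 2

lemma card_mul_lvl_sub (d : ℕ) (hd : 1 ≤ d) :
    (q : ℝ) ^ (2 * d) * (lvl F (d - 1) - levBot F) = 1 + 2 * loss F := by
  have hq := two_le_card F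
  obtain ⟨e, rfl⟩ : ∃ e, d = e + 1 := ⟨d - 1, by omega⟩
  have h1 : (q : ℝ) ^ 2 - 1 ≠ 0 := by nlinarith
  have h3 : (q : ℝ) - 1 ≠ 0 := by linarith
  have h4 : (q : ℝ) ^ 3 - q ^ 2 = q ^ 2 * (q - 1) := by ring
  rw [Nat.add_sub_cancel, lvl, levBot, levTop, h4, loss]
  have h6 : (q : ℝ) ^ (2 * (e + 1)) = q ^ 2 * (q ^ 2) ^ e := by ring
  rw [h6]
  have h7 : ((q : ℝ) ^ 2) ^ e ≠ 0 := by positivity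
  field_simp
  ring

lemma aeval_theta_injOn {G : E} [FiniteDimensional F (torsion G N)] (hNi : Irreducible N) {b : F[X]} (hb : ¬ N ∣ b) {x y : E}
    (hx : x ∈ torsion G N) (hy : y ∈ torsion G N)
    (h : aeval (theta F G) b x = aeval (theta F G) b y) : x = y := by
  obtain ⟨c, hc⟩ := exists_inverse_mod (g := G) hNi hb
  rw [← (hc x hx).1, h, (hc y hy).1]

lemma sum_lev_sub_eq {G : E} {I : Type} [Fintype I] [DecidableEq I] (x : I → E)
    (hx : Function.Injective x) (hmem : ∀ y, (y ∈ torsion G N ∧ y ≠ 0) ↔ ∃ i, x i = y)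
    (hsum : ∑ i, lev G (x i) = 0) : ∑ i, ∑ j with j ≠ i, lev G (x i - x j) = 0 := by
  have h : ∀ i, ∑ j with j ≠ i, lev G (x i - x j) = ∑ j with j ≠ i, lev G (x j) := by
    intro i
    have hi := (hmem _).mpr ⟨i, rfl⟩
    have hex : ∀ j, j ≠ i → ∃ k, x k = x i - x j := fun j hj => (hmem _).mp
      ⟨sub_mem hi.1 ((hmem _).mpr ⟨j, rfl⟩).1, sub_ne_zero.mpr (hx.ne hj.symm)⟩
    choose f hf using id hex
    refine Finset.sum_bij (fun j hj => f j (by simpa using hj)) ?_ ?_ ?_ ?_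
    · intro j hj
      simp only [Finset.mem_filter, Finset.mem_univ, true_and] at hj ⊢
      intro h
      have h2 := hf j hj
      rw [h] at h2
      exact ((hmem _).mpr ⟨j, rfl⟩).2 (by linear_combination h2)
    · intro j hj j' hj' h
      have h1 := hf j (by simpa using hj)
      have h2 := hf j' (by simpa using hj')
      rw [h, h2] at h1
      exact hx (by linear_combination h1)
    · intro j hj
      simp only [Finset.mem_filter, Finset.mem_univ, true_and] at hj
      obtain ⟨k, hk⟩ := hex j hj
      have hki : k ≠ i := by
        rintro rfl
        exact ((hmem _).mpr ⟨j, rfl⟩).2 (by linear_combination hk)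
      refine ⟨k, by simpa using hki, hx ?_⟩
      rw [hf k hki, hk]; ring
    · intro j hj
      rw [hf j (by simpa using hj)]
  have h2 : ∀ i, ∑ j with j ≠ i, lev G (x j) = -lev G (x i) := by
    intro i
    rw [Finset.filter_ne']
    have := Finset.sum_erase_add Finset.univ (fun i => lev G (x i)) (Finset.mem_univ i)
    rw [hsum] at this
    linarith
  simp only [h, h2, Finset.sum_neg_distrib, hsum, neg_zero]

end Sections

end

section

open Polynomial Module

section RiemannInequality

variable {F : Type} [Field F] [Fintype F] {κ : Type} [Field κ] [Algebra F κ]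
  {E : Type} [NormedField E] [IsUltrametricDist E]
  [Algebra F E] {N : F[X]} [Algebra (LaurentSeries κ) E] [@IsScalarTower F (LaurentSeries κ) E Algebra.toSMul _ _]
  {g : LaurentSeries κ}

local notation "q" => Fintype.card F
local notation "G" => algebraMap (LaurentSeries κ) E g

variable (F) in
lemma loss_nonneg : 0 ≤ loss F := by
  have hq := two_le_card F
  have h1 : (0 : ℝ) < (q : ℝ) ^ 2 - 1 := by nlinarith
  have h3 : (0 : ℝ) < (q : ℝ) - 1 := by linarith
  rw [loss]; positivity

theorem exists_bounded_sections [FiniteDimensional F (torsion G N)]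
    [FiniteDimensional (LaurentSeries κ) E] [IsGalois (LaurentSeries κ) E]
    (hg : 1 < ‖G‖)
    (hord : ∀ z : LaurentSeries κ, z ≠ 0 →
      ‖algebraMap (LaurentSeries κ) E z‖ = ‖G‖ ^ (-z.order))
    (hNi : Irreducible N) (hN : N.Monic) (hd : 1 ≤ N.natDegree) (h1 : N.eval 1 ≠ 0)
    (hV : finrank F (torsion G N) = 3 * N.natDegree)
    (hσ : ∀ (σ : E ≃ₐ[LaurentSeries κ] E) (x : E), ‖σ x‖ = ‖x‖)
    {I : Type} [Fintype I] [DecidableEq I] (x : I → E)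
    (hx : Function.Injective x) (hmem : ∀ y, (y ∈ torsion G N ∧ y ≠ 0) ↔ ∃ i, x i = y)
    (hsum : ∑ i, lev G (x i) = 0) (t : ℕ) :
    ∃ m : ℕ, (Fintype.card I * t - Fintype.card I * loss F : ℝ) ≤ m ∧
      ∃ Ψ : (Fin m → κ) →ₗ[κ] (Fin (Fintype.card I) → κ[X]), Function.Injective Ψ ∧
        ∀ v i, ‖∑ j, algebraMap (LaurentSeries κ) E (polyInf κ (Ψ v j)) * x i ^ (j : ℕ)‖ ≤
          ‖G‖ ^ t := by
  classical
  obtain ⟨W, hW⟩ : ∃ W, W = torsionLe G N (levBot F) := ⟨_, rfl⟩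
  obtain ⟨V₁, hV₁⟩ : ∃ V₁, V₁ = torsionLe G N (lvl F (N.natDegree - 1)) := ⟨_, rfl⟩
  have hval : ∀ z : LaurentSeries κ, z ≠ 0 → ∃ j : ℤ, ‖algebraMap (LaurentSeries κ) E z‖ = ‖G‖ ^ j :=
    fun z hz => ⟨_, hord z hz⟩
  have hxV : ∀ i, x i ∈ torsion G N := fun i => ((hmem _).mpr ⟨i, rfl⟩).1
  have hx0 : ∀ i, x i ≠ 0 := fun i => ((hmem _).mpr ⟨i, rfl⟩).2
  let L : Set (Submodule F E) := Set.range fun i => torClass F G N (x i)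
  let _ : Fintype L := Fintype.ofFinite L
  let l : I → L := fun i => ⟨torClass F G N (x i), i, rfl⟩
  have hl : ∀ i j, l i = l j ↔ torClass F G N (x i) = torClass F G N (x j) := fun i j =>
    Subtype.ext_iff
  have hlW : ∀ i j, l i = l j → (x i ∈ W ↔ x j ∈ W) := fun i j h => by
    rw [hW]
    exact ⟨mem_of_torClass_eq ((hl i j).mp h).symm, mem_of_torClass_eq ((hl i j).mp h)⟩
  have hb : ∀ c : L, ∃ b : F[X], ¬ N ∣ b ∧ ∀ i, l i = c → x i ∉ W →
      aeval (theta F G) b (x i) ∈ V₁ := by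
    rintro ⟨_, i₀, rfl⟩
    by_cases h : x i₀ ∈ W
    · refine ⟨1, fun h => hNi.not_isUnit (isUnit_of_dvd_one h), fun i hi hiW => ?_⟩
      exact absurd ((hlW i i₀ hi).mpr h) hiW
    · obtain ⟨b, hb, hb'⟩ := (exists_multiplier hg hNi hN hd hV hval hσ (hxV i₀) (hW ▸ h)).2
      exact ⟨b, hb, fun i hi _ => hV₁ ▸ hb' _ (hxV i) ((hl i i₀).mp hi)⟩
  choose b hbN hbV using hb
  let u : I → E := fun i => aeval (theta F G) (b (l i)) (x i)
  have huV : ∀ i, u i ∈ torsion G N := fun i => aeval_theta_mem _ (hxV i)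
  have huW : ∀ i, x i ∈ W → u i ∈ W := fun i h => by
    rw [hW] at h ⊢; exact aeval_theta_mem_torsionLe hg _ h
  have huV₁ : ∀ i, x i ∉ W → u i ∈ V₁ := fun i h => hbV _ _ rfl h
  have hu0 : ∀ i, u i ≠ 0 := fun i h => hx0 i
    (aeval_theta_injOn hNi (hbN (l i)) (hxV i) (zero_mem _) (h.trans (map_zero _).symm))
  have hu : ∀ i j, l i = l j → u i = u j → i = j := fun i j hij h => by
    simp only [u] at h
    rw [hij] at h
    exact hx (aeval_theta_injOn hNi (hbN (l j)) (hxV i) (hxV j) h)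
  obtain ⟨a, ha, hlt, hasum⟩ := exists_enumeration l
  let r : I → ℝ := fun i => if x i ∈ W then levBot F else lvl F (N.natDegree - 1)
  have hr : ∀ i j, l i = l j → r i = r j := fun i j h => by
    simp only [r, hlW i j h]
  have hulev : ∀ i, lev G (u i) ≤ r i := by
    intro i
    simp only [r]
    split_ifs with h
    · have := huW i h
      rw [hW, mem_torsionLe hg (hu0 i)] at this
      exact this.2
    · have := huV₁ i h
      rw [hV₁, mem_torsionLe hg (hu0 i)] at this
      exact this.2
  have hWlev : ∀ z ∈ W, z ≠ 0 → lev G z = levBot F := by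
    intro z hz hz0
    rw [hW, mem_torsionLe hg hz0] at hz
    exact lev_eq_levBot hg h1 hz.1 hz0 hz.2
  have hV₁lev : ∀ z ∈ V₁, z ∉ W → lev G z = lvl F (N.natDegree - 1) := by
    intro z hz hzW
    rw [hV₁] at hz
    refine (exists_lev_eq_of_not_mem hg hN hd hz ?_).2
    rw [Nat.sub_add_cancel hd, torsionLe_natDegree hg hN hd, ← hW]
    exact hzW
  let τ : I → ℤ := fun j => t + ⌊-(a j * r j)⌋
  let K : I → ℕ := fun i => Fintype.card {j // l j = l i}
  have hKcard : ∀ i, ((Finset.univ.filter fun j => j ≠ i ∧ l j = l i).card : ℝ) = K i - 1 := by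
    intro i
    have h2 : (Finset.univ.filter fun j => j ≠ i ∧ l j = l i) =
        (Finset.univ.filter fun j => l j = l i).erase i := by
      ext j; simp
    have h3 : i ∈ Finset.univ.filter fun j => l j = l i := by simp
    rw [h2, eq_sub_iff_add_eq]
    have h4 := Finset.card_erase_add_one h3
    have h5 : (Finset.univ.filter fun j => l j = l i).card = K i := by
      rw [← Fintype.card_subtype]
    rw [h5] at h4
    exact_mod_cast h4
  let S : I → ℝ := fun i => ∑ j with j ≠ i ∧ l j = l i, lev G (u i - u j)
  have hSW : ∀ i, x i ∈ W → S i = (K i - 1) * levBot F := by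
    intro i hi
    rw [← hKcard, ← nsmul_eq_mul]
    refine Finset.sum_eq_card_nsmul fun j hj => ?_
    simp only [Finset.mem_filter, Finset.mem_univ, true_and] at hj
    exact hWlev _ (sub_mem (huW i hi) (huW j ((hlW j i hj.2).mpr hi)))
      (sub_ne_zero.mpr fun h => hj.1 (hu _ _ hj.2 h.symm))
  have hlvl := levBot_lt_lvl F (N.natDegree - 1)
  have hSV : ∀ i, x i ∉ W → (K i - 1) * lvl F (N.natDegree - 1) - (1 + 2 * loss F) ≤ S i := by
    intro i hi
    have hWc : Nat.card W = q ^ (2 * N.natDegree) := by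
      rw [hW, ← (range_resMap_eq hg hNi hN hd hV (hxV i) (hW ▸ hi)).1]
      exact natCard_torsionLe _
    have hWfin : (W : Set E).Finite := by rw [hW]; exact finite_torsionLe _
    have hle : ∀ j ∈ Finset.univ.filter (fun j => j ≠ i ∧ l j = l i),
        lvl F (N.natDegree - 1) - (if u i - u j ∈ W then
          (lvl F (N.natDegree - 1) - levBot F) else 0) ≤ lev G (u i - u j) := by
      intro j hj
      simp only [Finset.mem_filter, Finset.mem_univ, true_and] at hj
      split_ifs with h
      · rw [hWlev _ h (sub_ne_zero.mpr fun h => hj.1 (hu _ _ hj.2 h.symm))]; linarith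
      · rw [hV₁lev _ (sub_mem (huV₁ i hi) (huV₁ j fun hh => hi ((hlW j i hj.2).mp hh))) h]
        linarith
    refine (Finset.sum_le_sum hle).trans' ?_
    rw [Finset.sum_sub_distrib, Finset.sum_const, nsmul_eq_mul, hKcard, ← Finset.sum_filter,
      Finset.sum_const, nsmul_eq_mul]
    have hcard : ((Finset.univ.filter (fun j => j ≠ i ∧ l j = l i)).filter
        (fun j => u i - u j ∈ W)).card ≤ q ^ (2 * N.natDegree) := by
      rw [← hWc]
      change _ ≤ Nat.card (W : Set E)
      rw [Nat.card_eq_card_finite_toFinset hWfin]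
      refine Finset.card_le_card_of_injOn (fun j => u i - u j) ?_ ?_
      · intro j hj
        have := (Finset.mem_filter.mp hj).2
        simpa using this
      · intro j hj j' hj' h
        have h2 := (Finset.mem_filter.mp (Finset.mem_filter.mp hj).1).2.2
        have h3 := (Finset.mem_filter.mp (Finset.mem_filter.mp hj').1).2.2
        exact hu _ _ (h2.trans h3.symm) (sub_right_injective h)
    have h2 : ((((Finset.univ.filter (fun j => j ≠ i ∧ l j = l i)).filter
        (fun j => u i - u j ∈ W)).card : ℕ) : ℝ) ≤ (q : ℝ) ^ (2 * N.natDegree) := by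
      exact_mod_cast hcard
    have h3 := card_mul_lvl_sub (F := F) N.natDegree hd
    nlinarith
  have hclass : ∀ c : L, ∑ j with l j = c, ((t : ℝ) - 1 - loss F) ≤
      ∑ j with l j = c, ((τ j : ℝ) + S j / 2) := by
    rintro ⟨_, i₀, rfl⟩
    change ∑ j with l j = l i₀, _ ≤ ∑ j with l j = l i₀, _
    have hloss := loss_nonneg F
    have hcK : (Finset.univ.filter fun j => l j = l i₀).card = K i₀ := by
      rw [← Fintype.card_subtype]
    have hKj : ∀ j, l j = l i₀ → K j = K i₀ := fun j hj => by
      simp only [K, hj]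
    have hτ : ∑ j with l j = l i₀, (τ j : ℝ) =
        K i₀ * t + ∑ i ∈ Finset.range (K i₀), (⌊-(i * r i₀)⌋ : ℝ) := by
      rw [← hasum (l i₀) (fun i => (⌊-(i * r i₀)⌋ : ℝ)), ← hcK, ← nsmul_eq_mul, ← Finset.sum_const,
        ← Finset.sum_add_distrib]
      refine Finset.sum_congr rfl fun j hj => ?_
      simp only [τ, hr j i₀ (Finset.mem_filter.mp hj).2]
      push_cast; rfl
    rw [Finset.sum_add_distrib, hτ, Finset.sum_const, nsmul_eq_mul, hcK]
    by_cases hi : x i₀ ∈ W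
    · have h2 : ∑ j with l j = l i₀, S j / 2 = K i₀ * ((K i₀ - 1) * levBot F / 2) := by
        rw [← hcK, ← nsmul_eq_mul]
        refine Finset.sum_eq_card_nsmul fun j hj => ?_
        have hj := (Finset.mem_filter.mp hj).2
        rw [hSW j ((hlW j i₀ hj).mpr hi), hKj j hj, hcK]
      have h3 : r i₀ = levBot F := if_pos hi
      have h4 := sum_floor_ge (r i₀) (K i₀)
      rw [h2]
      have h5 : (0 : ℝ) ≤ K i₀ * loss F := by positivity
      rw [h3] at h4 ⊢
      linarith
    · have h2 : K i₀ * (((K i₀ - 1) * lvl F (N.natDegree - 1) - (1 + 2 * loss F)) / 2) ≤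
          ∑ j with l j = l i₀, S j / 2 := by
        rw [← hcK, ← nsmul_eq_mul]
        refine Finset.card_nsmul_le_sum _ _ _ fun j hj => ?_
        have hj := (Finset.mem_filter.mp hj).2
        have := hSV j (fun h => hi ((hlW j i₀ hj).mp h))
        rw [hKj j hj, ← hcK] at this
        linarith
      have h3 : r i₀ = lvl F (N.natDegree - 1) := if_neg hi
      have hKq : K i₀ = (q - 1) * q ^ (2 * N.natDegree) := by
        rw [← torClass_smul_sub hg hNi hN hd hV (hxV i₀) (hW ▸ hi)]
        simp only [K]
        rw [← Nat.card_eq_fintype_card]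
        refine Nat.card_congr (Equiv.ofBijective (fun j => ⟨x j, (hmem _).mpr ⟨j, rfl⟩,
          (hl _ _).mp j.2⟩) ⟨fun i j h => Subtype.ext (hx (Subtype.ext_iff.mp h)), ?_⟩)
        rintro ⟨y, hy, hy'⟩
        obtain ⟨i, rfl⟩ := (hmem y).mp hy
        exact ⟨⟨i, (hl _ _).mpr hy'⟩, rfl⟩
      obtain ⟨c, -, hc⟩ := card_mul_lvl F N.natDegree hd
      have hKr : (K i₀ : ℝ) * r i₀ = c := by
        rw [← hc, h3, hKq]
        push_cast [Nat.cast_sub (Fintype.card_pos (α := F))]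
        rfl
      have hK1 : 1 ≤ K i₀ := Fintype.card_pos_iff.mpr ⟨⟨i₀, rfl⟩⟩
      have h4 := sum_floor_ge_of_int (r i₀) (K i₀) hK1 c hKr
      rw [h3] at h4 ⊢
      linarith
  have hgal : ∀ (σ : E ≃ₐ[LaurentSeries κ] E) i, ∃ j, x j = σ (x i) ∧ l j = l i ∧ u j = σ (u i) := by
    intro σ i
    obtain ⟨j, hj⟩ := (hmem (σ (x i))).mp ⟨(algEquiv_mem_torsion σ).mpr (hxV i),
      (map_ne_zero_iff _ σ.injective).mpr (hx0 i)⟩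
    have hji : l j = l i := by
      rw [hl, hj]
      by_cases hi : x i ∈ W
      · rw [torClass_of_mem ((algEquiv_mem_torsionLe (hσ σ)).mpr (hW ▸ hi)),
          torClass_of_mem (hW ▸ hi)]
      · exact (exists_multiplier hg hNi hN hd hV hval hσ (hxV i) (hW ▸ hi)).1 σ
    refine ⟨j, hj, hji, ?_⟩
    simp only [u]
    rw [hji, hj, algEquiv_aeval_theta]
  have hbd : ∀ i j, l i = l j → ‖G ^ τ j * u i ^ a j‖ ≤ ‖G‖ ^ t := by
    intro i j hij
    have hG0 : G ≠ 0 := ne_zero_of_one_lt_norm hg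
    have h2 := norm_eq_rpow_lev hg (hu0 i)
    rw [norm_mul, norm_zpow, norm_pow, h2, ← Real.rpow_intCast, ← Real.rpow_natCast,
      ← Real.rpow_mul (norm_nonneg _), ← Real.rpow_add (by linarith), ← Real.rpow_natCast]
    refine Real.rpow_le_rpow_of_exponent_le hg.le ?_
    have h3 := Int.floor_le (-(a j * r j))
    have h4 := hulev i
    rw [hr i j hij] at h4
    have h5 : lev G (u i) * a j ≤ a j * r j := by
      rw [mul_comm]; exact mul_le_mul_of_nonneg_left h4 (Nat.cast_nonneg _)
    simp only [τ]
    push_cast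
    linarith
  obtain ⟨m, hm, Ψ, hΨ, hΨ'⟩ := exists_bounded_family hg hord hx hu ha hlt τ hgal
    (by positivity) hbd
  refine ⟨m, ?_, Ψ, hΨ, hΨ'⟩
  refine hm.trans' ?_
  rw [sum_lev_sub_eq x hx hmem hsum]
  have h2 := Finset.sum_le_sum fun c (_ : c ∈ (Finset.univ : Finset L)) => hclass c
  rw [Finset.sum_fiberwise_of_maps_to (fun _ _ => Finset.mem_univ _),
    Finset.sum_fiberwise_of_maps_to (fun _ _ => Finset.mem_univ _), Finset.sum_const,
    Finset.card_univ, nsmul_eq_mul, Finset.sum_add_distrib, ← Finset.sum_div] at h2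
  simp only [S] at h2
  linarith

end RiemannInequality

end

section

open Polynomial Module

section SpectralExtension

lemma exists_spectral_splitting_field {k : Type} [NontriviallyNormedField k] [IsUltrametricDist k]
    [CompleteSpace k] (p : k[X]) (hp : p.Separable) :
    ∃ (E : Type) (_ : NormedField E) (_ : Algebra k E),
      IsUltrametricDist E ∧ FiniteDimensional k E ∧ IsGalois k E ∧
        (p.map (algebraMap k E)).Splits ∧ (∀ z : k, ‖algebraMap k E z‖ = ‖z‖) ∧
        ∀ (σ : E ≃ₐ[k] E) (x : E), ‖σ x‖ = ‖x‖ := by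
  refine ⟨p.SplittingField, spectralNorm.normedField k p.SplittingField, 
    inferInstanceAs (Algebra k p.SplittingField), ?_, inferInstanceAs (FiniteDimensional k p.SplittingField), 
    IsGalois.of_separable_splitting_field hp, SplittingField.splits p, spectralNorm_extends,
    fun σ x => (spectralNorm_eq_of_equiv σ x).symm⟩
  let _ := spectralNorm.normedField k p.SplittingField
  exact IsUltrametricDist.isUltrametricDist_of_isNonarchimedean_norm isNonarchimedean_spectralNorm

variable {κ : Type} [Field κ]

open scoped Valued in
lemma exists_normed_splitting_field (p : (LaurentSeries κ)[X]) (hp : p.Separable) :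
    ∃ (E : Type) (_ : NormedField E) (_ : Algebra (LaurentSeries κ) E) (c : ℝ), 1 < c ∧
      IsUltrametricDist E ∧ FiniteDimensional (LaurentSeries κ) E ∧ IsGalois (LaurentSeries κ) E ∧
        (p.map (algebraMap (LaurentSeries κ) E)).Splits ∧
        (∀ z : LaurentSeries κ, z ≠ 0 → ‖algebraMap (LaurentSeries κ) E z‖ = c ^ (-z.order)) ∧
        ∀ (σ : E ≃ₐ[LaurentSeries κ] E) (x : E), ‖σ x‖ = ‖x‖ := by
  have hX : Valued.v (HahnSeries.single (-1) 1 : LaurentSeries κ) = WithZero.exp 1 := by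
    have := LaurentSeries.valuation_single_zpow κ (-1)
    simpa using this
  have h1 : (1 : WithZero (Multiplicative ℤ)) < WithZero.exp 1 := by
    rw [← WithZero.exp_zero]; exact WithZero.exp_lt_exp.mpr one_pos
  have hnt : (Valued.v : Valuation (LaurentSeries κ) (WithZero (Multiplicative ℤ))).IsNontrivial :=
    ⟨_, by rw [hX]; exact WithZero.exp_ne_zero, by rw [hX]; exact h1.ne'⟩
  obtain ⟨hrk⟩ : Nonempty
      (Valued.v : Valuation (LaurentSeries κ) (WithZero (Multiplicative ℤ))).RankOne := by
    rw [Valuation.nonempty_rankOne_iff_mulArchimedean]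
    infer_instance
  obtain ⟨E, iE, iA, hE, hfin, hgal, hsp, hext, hinv⟩ := @exists_spectral_splitting_field _
    (Valued.toNontriviallyNormedField (LaurentSeries κ) (WithZero (Multiplicative ℤ)))
    (inferInstanceAs (IsUltrametricDist (LaurentSeries κ))) 
    LaurentSeries.instLaurentSeriesComplete p hp
  refine ⟨E, iE, iA, ‖(HahnSeries.single (-1) 1 : LaurentSeries κ)‖, ?_, hE, hfin, hgal, hsp, ?_, hinv⟩
  · rw [Valued.toNormedField.one_lt_norm_iff, hX]
    exact h1
  · intro z hz
    refine (hext z).trans ?_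
    rw [← norm_zpow]
    have h2 : Valued.v ((HahnSeries.single (-1) 1 : LaurentSeries κ) ^ (-z.order)) =
        WithZero.exp (-z.order) := by
      rw [map_zpow₀, hX, ← WithZero.exp_zsmul]; simp
    refine le_antisymm ?_ ?_
    · rw [Valued.toNormedField.norm_le_iff, h2, LaurentSeries.valuation_le_iff_coeff_lt_eq_zero]
      exact fun n hn => HahnSeries.coeff_eq_zero_of_lt_order hn
    · rw [Valued.toNormedField.norm_le_iff, h2]
      by_contra! h3
      have h4 : Valued.v z ≤ WithZero.exp (-(z.order + 1)) := by
        have hv0 := (map_ne_zero (Valued.v : Valuation (LaurentSeries κ) _)).mpr hz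
        rw [← WithZero.log_lt_iff_lt_exp hv0] at h3
        rw [← WithZero.log_le_iff_le_exp hv0]
        lia
      rw [LaurentSeries.valuation_le_iff_coeff_lt_eq_zero] at h4
      exact HahnSeries.coeff_order_eq_zero.not.mpr hz (h4 _ (lt_add_one _))

end SpectralExtension

end

section

open Polynomial Module

section Torsion

variable {F : Type} [Field F] [Fintype F] {E : Type} [NormedField E] [IsUltrametricDist E]
  [Algebra F E] {g : E} {N : F[X]}

local notation "q" => Fintype.card F

lemma finrank_torsion (hN : N.Monic) (h1 : N.eval 1 ≠ 0) (hs : (phiPoly g N).Splits) :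
    FiniteDimensional F (torsion g N) ∧ finrank F (torsion g N) = 3 * N.natDegree := by
  have hc : Nat.card (torsion g N) = q ^ (3 * N.natDegree) := card_roots_phiPoly hN h1 hs
  have hq := Fintype.one_lt_card (α := F)
  have hfin : Finite (torsion g N) := Nat.finite_of_card_ne_zero (by rw [hc]; positivity)
  have hfd : FiniteDimensional F (torsion g N) := inferInstance
  refine ⟨hfd, ?_⟩
  rw [Module.natCard_eq_pow_finrank (K := F), Nat.card_eq_fintype_card] at hc
  exact Nat.pow_right_injective hq hc

end Torsion

section PolyInf

variable {κ : Type} [Field κ]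

lemma order_polyInf {p : κ[X]} (hp : p ≠ 0) :
    polyInf κ p ≠ 0 ∧ (polyInf κ p).order = -p.natDegree := by
  have hu : IsUnit ((p.reverse : κ[X]) : PowerSeries κ) := by
    rw [PowerSeries.isUnit_iff_constantCoeff]
    simp [hp]
  have h := polyInf_reflect (D := p.natDegree) (h := p.reverse) (reverse_natDegree_le _)
  rw [reverse, reflect_reflect, ← reverse] at h
  have h1 : (HahnSeries.single (-(p.natDegree : ℤ)) (1 : κ)) ≠ 0 :=
    HahnSeries.single_ne_zero one_ne_zero
  have h2 : HahnSeries.ofPowerSeries ℤ κ (p.reverse : κ[X]) ≠ 0 :=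
    (hu.map (HahnSeries.ofPowerSeries ℤ κ)).ne_zero
  refine ⟨by rw [h]; exact mul_ne_zero h1 h2, ?_⟩
  rw [h, HahnSeries.order_mul h1 h2, HahnSeries.order_single one_ne_zero, order_ofPowerSeries_unit hu,
    add_zero]

end PolyInf

section Irreducibility

variable {F : Type} [Field F] [Fintype F] {κ : Type} [Field κ] [Algebra F κ]
  {E : Type} [NormedField E] [IsUltrametricDist E]
  [Algebra F E] {N : F[X]} [Algebra (LaurentSeries κ) E]
  [@IsScalarTower F (LaurentSeries κ) E Algebra.toSMul _ _]
  {k : Type} [Field k] [Algebra κ[X] k] [IsFractionRing κ[X] k] [Algebra F k]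
  [IsScalarTower F κ[X] k] [Algebra k E] [IsScalarTower F k E]

local notation "q" => Fintype.card F
local notation "G" => algebraMap (LaurentSeries κ) E (polyInf κ X)
local notation "γ" => algebraMap κ[X] k X

lemma exists_algEquiv_global 
    [FiniteDimensional (LaurentSeries κ) E] [IsGalois (LaurentSeries κ) E]
    (hg : 1 < ‖G‖)
    (hord : ∀ z : LaurentSeries κ, z ≠ 0 →
      ‖algebraMap (LaurentSeries κ) E z‖ = ‖G‖ ^ (-z.order))
    (hNi : Irreducible N) (hN : N.Monic) (hd : 1 ≤ N.natDegree) (h1 : N.eval 1 ≠ 0)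
    (hσ : ∀ (σ : E ≃ₐ[LaurentSeries κ] E) (x : E), ‖σ x‖ = ‖x‖)
    (hι : ∀ p : κ[X], algebraMap k E (algebraMap κ[X] k p) =
      algebraMap (LaurentSeries κ) E (polyInf κ p))
    (hfix : ∀ (σ : E ≃ₐ[LaurentSeries κ] E) (z : k), σ (algebraMap k E z) = algebraMap k E z)
    {E₀ : Type} [NormedField E₀] [IsUltrametricDist E₀] [Algebra k E₀] [FiniteDimensional k E₀]
    [IsGalois k E₀] [Algebra F E₀] [IsScalarTower F k E₀] [Algebra κ[X] E₀]
    [IsScalarTower κ[X] k E₀] [IsScalarTower F κ[X] E₀]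
    (hs : (phiPoly (algebraMap k E₀ γ) N).Splits)
    (φ : E₀ →ₐ[k] E) (hφ : ∀ x, ‖φ x‖ = ‖x‖) {x y : E₀}
    (hx : x ∈ torsion (algebraMap k E₀ γ) N) (hx0 : x ≠ 0)
    (hy : y ∈ torsion (algebraMap k E₀ γ) N) (hy0 : y ≠ 0) : ∃ σ : E₀ ≃ₐ[k] E₀, σ x = y := by
  classical
  let φF : E₀ →ₐ[F] E := φ.restrictScalars F
  have hG : algebraMap k E γ = G := hι X
  have hφG : φF (algebraMap k E₀ γ) = G := (φ.commutes _).trans hG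
  have hφp : (phiPoly (algebraMap k E₀ γ) N).map (φF : E₀ →+* E) = phiPoly G N := by
    rw [map_phiPoly, hφG]
  obtain ⟨hfd, hV⟩ := finrank_torsion (E := E) hN h1 (hφp ▸ hs.map _)
  obtain ⟨hfd₀, hV₀⟩ := finrank_torsion hN h1 hs
  have htor : ∀ x, φ x ∈ torsion G N ↔ x ∈ torsion (algebraMap k E₀ γ) N := by
    intro x
    rw [mem_torsion, mem_torsion, ← hφG]
    change aeval (theta F (φF (algebraMap k E₀ γ))) N (φF x) = 0 ↔ _
    rw [← map_aeval_theta]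
    exact map_eq_zero_iff _ φ.injective
  have hnG : ‖algebraMap k E₀ γ‖ = ‖G‖ := by rw [← hφG]; exact (hφ _).symm
  have htorLe : ∀ x r, φ x ∈ torsionLe G N r ↔ x ∈ torsionLe (algebraMap k E₀ γ) N r := by
    intro x r
    change _ ∧ _ ↔ _ ∧ _
    rw [htor, hφ, hnG]
  refine exists_algEquiv_of_ne_zero (hnG ▸ hg) hNi hN hd hV₀ ?_ ?_ hx hx0 hy hy0
  · intro S hS hS0
    obtain ⟨z, hz⟩ := exists_algebraMap_eq_prod S hS
    have hinteg : IsIntegral κ[X] (∏ x ∈ S, x) := by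
      refine IsIntegral.prod _ fun x hx => ?_
      refine ⟨phiPoly X N, (monic_phiPoly X hN).1, ?_⟩
      rw [← aeval_def, aeval_phiPoly, ← mem_torsion, IsScalarTower.algebraMap_apply κ[X] k E₀]
      exact (hS0 x hx).1
    rw [← hz] at hinteg
    obtain ⟨p, rfl⟩ := IsIntegrallyClosed.isIntegral_iff.mp
      ((isIntegral_algebraMap_iff (algebraMap k E₀).injective).mp hinteg)
    have hp0 : p ≠ 0 := by
      rintro rfl
      rw [map_zero, map_zero, eq_comm, Finset.prod_eq_zero_iff] at hz
      obtain ⟨x, hx, rfl⟩ := hz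
      exact (hS0 _ hx).2 rfl
    obtain ⟨hp1, hp2⟩ := order_polyInf hp0
    rw [← hz, ← hφ, φ.commutes, hι, hord _ hp1, hp2, neg_neg]
    exact one_le_zpow₀ hg.le (Int.natCast_nonneg _)
  · intro x hx hxW w hw
    obtain ⟨σ, hσx⟩ := exists_algEquiv_add hg hNi hN hd hV (fun z hz => ⟨_, hord z hz⟩) hσ
      ((htor x).mpr hx) (fun h => hxW ((htorLe _ _).mp h)) ((htorLe _ _).mpr hw)
    let σ' : E ≃ₐ[k] E := AlgEquiv.ofRingEquiv (f := (σ : E ≃+* E)) (hfix σ)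
    have hmin : minpoly k x = minpoly k (x + w) := by
      rw [← minpoly.algHom_eq φ φ.injective x, ← minpoly.algHom_eq φ φ.injective (x + w),
        map_add, ← hσx]
      exact (minpoly.algEquiv_eq σ' _).symm
    obtain ⟨τ, hτ⟩ := (Normal.minpoly_eq_iff_mem_orbit E₀).mp hmin.symm
    exact ⟨τ, hτ⟩

end Irreducibility

end

section

open Polynomial Module

section Irreducibility

lemma exists_normed_splitting_subfield {k E : Type} [Field k] [NormedField E] [IsUltrametricDist E]
    [Algebra k E] (p : k[X]) (hs : (p.map (algebraMap k E)).Splits) :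
    ∃ (E₀ : Type) (_ : NormedField E₀) (_ : Algebra k E₀), IsUltrametricDist E₀ ∧
      p.IsSplittingField k E₀ ∧ ∃ φ : E₀ →ₐ[k] E, ∀ x, ‖φ x‖ = ‖x‖ := by
  let φ : p.SplittingField →ₐ[k] E := SplittingField.lift p hs
  let inst := NormedField.induced p.SplittingField E φ φ.injective
  refine ⟨p.SplittingField, inst, inferInstanceAs (Algebra k p.SplittingField), ?_,
    inferInstanceAs (p.IsSplittingField k p.SplittingField), φ, fun _ => rfl⟩
  exact IsUltrametricDist.isUltrametricDist_of_isNonarchimedean_norm fun x y => by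
    change ‖φ (x + y)‖ ≤ max ‖φ x‖ ‖φ y‖
    rw [map_add]
    exact IsUltrametricDist.norm_add_le_max _ _

variable {F : Type} [Field F] [Fintype F] {κ : Type} [Field κ] [Algebra F κ]
  {E : Type} [NormedField E] [IsUltrametricDist E]
  [Algebra F E] {N : F[X]} [Algebra (LaurentSeries κ) E]
  [@IsScalarTower F (LaurentSeries κ) E Algebra.toSMul _ _]

local notation "q" => Fintype.card F
local notation "G" => algebraMap (LaurentSeries κ) E (polyInf κ X)

lemma algebraMap_laurentSeries (a : F) :
    algebraMap F (LaurentSeries κ) a = polyInf κ (C (algebraMap F κ a)) := by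
  rw [polyInf, aeval_C, HahnSeries.algebraMap_apply', PowerSeries.algebraMap_apply,
    HahnSeries.ofPowerSeries_C, HahnSeries.algebraMap_apply', PowerSeries.algebraMap_apply,
    HahnSeries.ofPowerSeries_C]
  rfl

lemma eval₂_ne_zero_of_mem_torsion [FiniteDimensional (LaurentSeries κ) E]
    [IsGalois (LaurentSeries κ) E] (hg : 1 < ‖G‖)
    (hord : ∀ z : LaurentSeries κ, z ≠ 0 →
      ‖algebraMap (LaurentSeries κ) E z‖ = ‖G‖ ^ (-z.order))
    (hNi : Irreducible N) (hN : N.Monic) (hd : 1 ≤ N.natDegree) (h1 : N.eval 1 ≠ 0)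
    (hσ : ∀ (σ : E ≃ₐ[LaurentSeries κ] E) (x : E), ‖σ x‖ = ‖x‖)
    (hs : (phiPoly G N).Splits) {f : κ[X][X]} (hf : f ≠ 0)
    (hdeg : f.natDegree < q ^ (3 * N.natDegree) - 1) {x : E} (hx : x ∈ torsion G N) (hx0 : x ≠ 0) :
    f.eval₂ ((algebraMap (LaurentSeries κ) E).comp (polyInf κ : κ[X] →+* LaurentSeries κ)) x ≠ 0 := by
  classical
  obtain ⟨ι, hι⟩ : ∃ ι, ι = (algebraMap (LaurentSeries κ) E).comp
    (polyInf κ : κ[X] →+* LaurentSeries κ) := ⟨_, rfl⟩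
  have hιi : Function.Injective ι := by
    rw [injective_iff_map_eq_zero]
    intro p hp
    by_contra h
    refine (order_polyInf h).1 ?_
    rw [hι] at hp
    exact (map_eq_zero_iff _ (algebraMap (LaurentSeries κ) E).injective).mp hp
  let k := FractionRing κ[X]
  let lft : k →+* E := IsFractionRing.lift hιi
  let _ : Algebra k E := lft.toAlgebra
  have hlft : ∀ p, algebraMap k E (algebraMap κ[X] k p) =
      algebraMap (LaurentSeries κ) E (polyInf κ p) := fun p => by
    refine (IsFractionRing.lift_algebraMap hιi p).trans ?_
    rw [hι]; rfl
  have : IsScalarTower F k E := IsScalarTower.of_algebraMap_eq fun a => by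
    rw [IsScalarTower.algebraMap_apply F κ[X] k, hlft,
      IsScalarTower.algebraMap_apply F (LaurentSeries κ) E, algebraMap_laurentSeries]
    rfl
  have hfix : ∀ (σ : E ≃ₐ[LaurentSeries κ] E) (z : k), σ (algebraMap k E z) = algebraMap k E z := by
    intro σ z
    obtain ⟨a, b, hb, rfl⟩ := IsFractionRing.div_surjective (A := κ[X]) z
    rw [map_div₀, hlft, hlft, map_div₀, AlgEquiv.commutes, AlgEquiv.commutes]
  obtain ⟨p, hp⟩ : ∃ p : k[X], p = phiPoly (algebraMap κ[X] k X) N := ⟨_, rfl⟩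
  have hpE : p.map (algebraMap k E) = phiPoly G N := by
    have := map_phiPoly (IsScalarTower.toAlgHom F k E) (algebraMap κ[X] k X) N
    rw [hp]
    refine this.trans ?_
    rw [← hlft]; rfl
  obtain ⟨E₀, _, _, _, hsp, φ, hφ⟩ := exists_normed_splitting_subfield p (hpE ▸ hs)
  let _ : Algebra F E₀ := ((algebraMap k E₀).comp (algebraMap F k)).toAlgebra
  have : IsScalarTower F k E₀ := IsScalarTower.of_algebraMap_eq fun _ => rfl
  let _ : Algebra κ[X] E₀ := ((algebraMap k E₀).comp (algebraMap κ[X] k)).toAlgebra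
  have : IsScalarTower κ[X] k E₀ := IsScalarTower.of_algebraMap_eq fun _ => rfl
  have : IsScalarTower F κ[X] E₀ := IsScalarTower.of_algebraMap_eq fun a => by
    rw [IsScalarTower.algebraMap_apply F k E₀, IsScalarTower.algebraMap_apply κ[X] k E₀,
      IsScalarTower.algebraMap_apply F κ[X] k]
  have hpE₀ : p.map (algebraMap k E₀) = phiPoly (algebraMap k E₀ (algebraMap κ[X] k X)) N := by
    have := map_phiPoly (IsScalarTower.toAlgHom F k E₀) (algebraMap κ[X] k X) N
    rw [hp]
    exact this
  have hsep : p.Separable := by rw [hp]; exact separable_phiPoly _ h1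
  have := IsSplittingField.finiteDimensional E₀ p
  have := IsGalois.of_separable_splitting_field (E := E₀) hsep
  have hs₀ : (phiPoly (algebraMap k E₀ (algebraMap κ[X] k X)) N).Splits := by
    rw [← hpE₀]; exact hsp.splits
  have htor : ∀ y, φ y ∈ torsion G N ↔
      y ∈ torsion (algebraMap k E₀ (algebraMap κ[X] k X)) N := by
    intro y
    rw [mem_torsion, mem_torsion, ← eval_phiPoly, ← eval_phiPoly, ← hpE, ← hpE₀, eval_map_algebraMap,
      eval_map_algebraMap, aeval_algHom_apply]
    exact map_eq_zero_iff _ φ.injective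
  obtain ⟨γ, hγ⟩ : ∃ γ : E₀, γ = algebraMap k E₀ (algebraMap κ[X] k X) := ⟨_, rfl⟩
  have hne : phiPoly γ N ≠ 0 := (monic_phiPoly (F := F) γ hN).1.ne_zero
  obtain ⟨y, rfl⟩ : ∃ y, φ y = x := by
    refine (hγ ▸ hs₀).mem_range_of_isRoot hne (i := (φ : E₀ →+* E)) ?_
    have h2 : (phiPoly γ N).map (φ : E₀ →+* E) = phiPoly G N := by
      rw [hγ, ← hpE₀, ← hpE, Polynomial.map_map]
      congr 1
      exact φ.comp_algebraMap
    rw [h2, IsRoot.def, eval_phiPoly]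
    exact hx
  intro h
  change eval₂ _ (φ y) f = 0 at h
  obtain ⟨f', hf'⟩ : ∃ f' : k[X], f' = f.map (algebraMap κ[X] k) := ⟨_, rfl⟩
  have hf'0 : f' ≠ 0 := by
    rw [hf']
    exact (Polynomial.map_ne_zero_iff (IsFractionRing.injective κ[X] k)).mpr hf
  have hy' : aeval y f' = 0 := by
    refine φ.injective ?_
    have hcomp : (algebraMap k E).comp (algebraMap κ[X] k) = ι :=
      RingHom.ext fun p => (hlft p).trans (by rw [hι]; rfl)
    rw [map_zero]
    refine (aeval_algHom_apply φ y f').symm.trans ?_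
    rw [hf', aeval_def, eval₂_map, hcomp, hι, h]
  have hcard := card_roots_phiPoly hN h1 (hγ ▸ hs₀ : (phiPoly γ N).Splits)
  have hfin : {z : E₀ | aeval (theta F γ) N z = 0}.Finite := by
    refine Nat.finite_of_card_ne_zero (α := {z : E₀ // aeval (theta F γ) N z = 0}) ?_
    rw [hcard]
    have := Fintype.card_pos (α := F)
    positivity
  have hcard' : hfin.toFinset.card = q ^ (3 * N.natDegree) := by
    rw [← hcard, ← Nat.card_eq_card_finite_toFinset hfin]
    rfl
  rw [htor] at hx
  refine hf'0 ((Polynomial.map_eq_zero_iff (algebraMap k E₀).injective).mp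
    (eq_zero_of_natDegree_lt_card_of_eval_eq_zero' (f'.map (algebraMap k E₀))
    (hfin.toFinset.erase 0) ?_ ?_))
  · intro z hz
    obtain ⟨hz0, hz⟩ := Finset.mem_erase.mp hz
    obtain ⟨σ, rfl⟩ := exists_algEquiv_global hg hord hNi hN hd h1 hσ hlft hfix hs₀ φ hφ hx
      (fun hy0 => hx0 (by rw [hy0, map_zero])) (mem_torsion.mpr (hγ ▸ hfin.mem_toFinset.mp hz)) hz0
    rw [eval_map_algebraMap, aeval_algHom_apply, hy', map_zero]
  · rw [Finset.card_erase_of_mem (hfin.mem_toFinset.mpr (by simp)), hcard']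
    refine lt_of_le_of_lt ?_ hdeg
    rw [hf']
    exact natDegree_map_le.trans natDegree_map_le

end Irreducibility

end

section

open Polynomial Module

section PlaceAtInfinity

variable {F : Type} [Field F] [Fintype F] {N : F[X]}

local notation "q" => Fintype.card F

lemma torPoly_eq_prod {E : Type} [Field E] [Algebra F E] {G : E} (hN : N.Monic)
    (h1 : N.eval 1 ≠ 0) (hs : (phiPoly G N).Splits) {n : ℕ} (hn : n = q ^ (3 * N.natDegree) - 1) :
    ∃ x : Fin n → E, Function.Injective x ∧
      (∀ y, (aeval (theta F G) N y = 0 ∧ y ≠ 0) ↔ ∃ i, x i = y) ∧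
      torPoly G N = ∏ i, (X - C (x i)) := by
  classical
  obtain ⟨hm, hdeg⟩ := monic_torPoly (F := F) G hN
  have hs' : (torPoly G N).Splits :=
    hs.of_dvd (monic_phiPoly (F := F) G hN).1.ne_zero ⟨X, (torPoly_mul_X G N).symm⟩
  have hnd := nodup_roots (separable_torPoly (F := F) G h1)
  have hc : (torPoly G N).roots.toFinset.card = n := by
    rw [Multiset.toFinset_card_of_nodup hnd, ← hs'.natDegree_eq_card_roots, hdeg, hn]
  let e := ((torPoly G N).roots.toFinset.equivFinOfCardEq hc).symm
  have hr : ∀ y, (∃ i, (e i : E) = y) ↔ y ∈ (torPoly G N).roots := fun y => by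
    rw [← Multiset.mem_toFinset]
    exact ⟨fun ⟨i, hi⟩ => hi ▸ (e i).2, fun h => ⟨e.symm ⟨y, h⟩, by simp⟩⟩
  refine ⟨fun i => e i, Subtype.val_injective.comp e.injective, fun y => ?_, ?_⟩
  · rw [hr, mem_roots hm.ne_zero, IsRoot.def, torPoly_eval_eq_zero h1]
  · rw [Equiv.prod_comp e (fun y => X - C (y : E)), Finset.prod_coe_sort _ (fun y => X - C y)]
    conv_lhs => rw [hs'.eq_prod_roots_of_monic hm]
    rw [Finset.prod_eq_multiset_prod, Multiset.toFinset_val, hnd.dedup]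

/-- The place at infinity of the curve `torPoly`, with its bounded sections. -/
theorem exists_place_at_infinity (κ : Type) [Field κ] [Algebra F κ]
    (hNi : Irreducible N) (hN : N.Monic) (hd : 1 ≤ N.natDegree) (h1 : N.eval 1 ≠ 0)
    {n : ℕ} (hn : n = q ^ (3 * N.natDegree) - 1) :
    ∃ (E : Type) (_ : NormedField E) (ι : κ[X] →+* E) (x : Fin n → E) (c : ℝ),
      IsUltrametricDist E ∧ 1 < c ∧ (∀ p : κ[X], p ≠ 0 → ‖ι p‖ = c ^ p.natDegree) ∧
      (torPoly (X : κ[X]) N).map ι = ∏ i, (X - C (x i)) ∧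
      (∀ f : κ[X][X], f ≠ 0 → f.natDegree < n → ∀ i, f.eval₂ ι (x i) ≠ 0) ∧
      ∀ t : ℕ, ∃ m : ℕ, (n * t - n * loss F : ℝ) ≤ m ∧
        ∃ Ψ : (Fin m → κ) →ₗ[κ] (Fin n → κ[X]), Function.Injective Ψ ∧
          ∀ v i, ‖∑ j, ι (Ψ v j) * x i ^ (j : ℕ)‖ ≤ c ^ t := by
  classical
  obtain ⟨E, _, _, c, hc, _, _, _, hs, hord, hσ⟩ := exists_normed_splitting_field
    (phiPoly (polyInf κ X) N) (separable_phiPoly _ h1)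
  let _ : Algebra F E :=
    ((algebraMap (LaurentSeries κ) E).comp (algebraMap F (LaurentSeries κ))).toAlgebra
  have : @IsScalarTower F (LaurentSeries κ) E Algebra.toSMul _ _ :=
    IsScalarTower.of_algebraMap_eq fun _ => rfl
  obtain ⟨G, hG⟩ : ∃ G, G = algebraMap (LaurentSeries κ) E (polyInf κ X) := ⟨_, rfl⟩
  have hp : ∀ p : κ[X], p ≠ 0 →
      ‖algebraMap (LaurentSeries κ) E (polyInf κ p)‖ = c ^ p.natDegree := fun p hp => by
    rw [hord _ (order_polyInf hp).1, (order_polyInf hp).2, neg_neg, zpow_natCast]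
  have hGc : ‖G‖ = c := by rw [hG, hp X X_ne_zero, natDegree_X, pow_one]
  have hs' : (phiPoly G N).Splits := by
    have := map_phiPoly (IsScalarTower.toAlgHom F (LaurentSeries κ) E) (polyInf κ X) N
    rw [hG]
    refine this ▸ hs
  obtain ⟨x, hx, hmem, hprod⟩ := torPoly_eq_prod hN h1 hs' hn
  obtain ⟨hfd, hV⟩ := finrank_torsion hN h1 hs'
  obtain ⟨ι, hι⟩ : ∃ ι, ι = (algebraMap (LaurentSeries κ) E).comp
    (polyInf κ : κ[X] →+* LaurentSeries κ) := ⟨_, rfl⟩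
  have hsum : ∑ i, lev G (x i) = 0 := by
    have h := congrArg (fun p => ‖coeff p 0‖) hprod
    simp only [coeff_zero_torPoly, coeff_zero_prod, coeff_sub, coeff_X_zero, coeff_C_zero, zero_sub,
      norm_algebraMap_eq_one h1, norm_prod, norm_neg] at h
    simp only [lev]
    rw [← Real.logb_prod _ _ fun i _ => norm_ne_zero_iff.mpr ((hmem _).mpr ⟨i, rfl⟩).2, ← h,
      Real.logb_one]
  refine ⟨E, inferInstance, ι, x, c, inferInstance, hc, fun p h => ?_, ?_, ?_, fun t => ?_⟩
  · rw [hι, ← hp p h]; rfl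
  · rw [← hprod]
    let ιF : κ[X] →ₐ[F] E := ⟨ι, fun a => by
      rw [hι]
      exact congrArg (algebraMap (LaurentSeries κ) E) (algebraMap_laurentSeries a).symm⟩
    have := map_torPoly ιF (X : κ[X]) N
    refine this.trans ?_
    rw [hG]
    congr 1
    change ι X = _
    rw [hι]; rfl
  · intro f hf hfn i
    rw [hι]
    subst hG
    exact eval₂_ne_zero_of_mem_torsion (hGc ▸ hc) (hGc ▸ hord) hNi hN hd h1 hσ hs' hf
      (hn ▸ hfn) (mem_torsion.mpr ((hmem _).mpr ⟨i, rfl⟩).1) ((hmem _).mpr ⟨i, rfl⟩).2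
  · subst hG
    have := exists_bounded_sections (hGc ▸ hc) (hGc ▸ hord) hNi hN hd h1 hV hσ x hx hmem hsum t
    rw [Fintype.card_fin, hGc] at this
    rw [hι]
    exact this

end PlaceAtInfinity

end

section

open Polynomial Module

section values

variable {R S : Type*} [CommRing R] [CommRing S] [IsDomain S] {ι : Type*} [Fintype ι]

lemma map_resultant_eq_prod (φ : R →+* S) {P : R[X]} {x : ι → S}
    (hP : P.map φ = ∏ i, (X - C (x i))) (f : R[X]) {k : ℕ} (hk : f.natDegree ≤ k) :
    φ (resultant P f (Fintype.card ι) k) = ∏ i, f.eval₂ φ (x i) := by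
  classical
  have hd : (∏ i : ι, (X - C (x i))).natDegree = Fintype.card ι := by
    rw [natDegree_prod_of_monic _ _ fun i _ => monic_X_sub_C _]
    simp
  have hk' : (f.map φ).natDegree ≤ k := natDegree_map_le.trans hk
  rw [← resultant_map_map, hP, ← hd, resultant_prod_left _ _ _ _ (by simp) hk']
  refine Finset.prod_congr rfl fun i _ => ?_
  rw [natDegree_X_sub_C, resultant_X_sub_C_left _ _ _ hk', eval_map]

/-- The polynomial whose roots are the values of `f` at the roots of `P`. -/
noncomputable def valuePoly (P f : R[X]) (n : ℕ) : R[X] :=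
  resultant (P.map C) (C X - f.map C) n f.natDegree

lemma map_valuePoly (φ : R →+* S) {P : R[X]} {x : ι → S}
    (hP : P.map φ = ∏ i, (X - C (x i))) (f : R[X]) :
    (valuePoly P f (Fintype.card ι)).map φ = ∏ i, (X - C (f.eval₂ φ (x i))) := by
  have h1 : (P.map C).map (mapRingHom φ) = ∏ i, (X - C (C (x i))) := by
    rw [Polynomial.map_map, mapRingHom_comp_C, ← Polynomial.map_map, hP, Polynomial.map_prod]
    simp
  have := map_resultant_eq_prod (mapRingHom φ) h1 (C X - f.map C) (k := f.natDegree)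
    ((natDegree_sub_le _ _).trans (by simpa using natDegree_map_le))
  rw [coe_mapRingHom] at this
  rw [valuePoly, this]
  refine Finset.prod_congr rfl fun i _ => ?_
  rw [eval₂_sub, eval₂_C, eval₂_map, mapRingHom_comp_C, ← hom_eval₂]
  simp

lemma valuePoly_map {R' : Type*} [CommRing R'] (σ : R →+* R') (hσ : Function.Injective σ)
    (P f : R[X]) (n : ℕ) :
    valuePoly (P.map σ) (f.map σ) n = (valuePoly P f n).map σ := by
  have := resultant_map_map (P.map C) (C X - f.map C) n f.natDegree (mapRingHom σ)
  have hc (g : R[X]) : (g.map C).map (mapRingHom σ) = (g.map σ).map C := by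
    rw [Polynomial.map_map, Polynomial.map_map, mapRingHom_comp_C]
  rw [Polynomial.map_sub, map_C, hc, hc, coe_mapRingHom, map_X] at this
  rw [valuePoly, valuePoly, natDegree_map_eq_of_injective hσ, ← this]

end values

section ultrametric

variable {E : Type*} [NormedField E] [IsUltrametricDist E] {ι : Type*} [Fintype ι]

lemma norm_coeff_prod_X_sub_C_le (s : Finset ι) (v : ι → E) {c : ℝ} (hc : 0 < c)
    (h : ∀ i, ‖v i‖ ≤ c) (k : ℕ) :
    ‖(∏ i ∈ s, (X - C (v i))).coeff k‖ * c ^ k ≤ c ^ s.card := by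
  classical
  induction s using Finset.induction generalizing k with
  | empty =>
    rw [Finset.prod_empty, coeff_one]
    split_ifs with h0
    · simp [h0]
    · simp
  | insert a s ha ih =>
    rw [Finset.prod_insert ha, Finset.card_insert_of_notMem ha, sub_mul, coeff_sub, coeff_C_mul]
    have h1 : ‖(X * ∏ i ∈ s, (X - C (v i))).coeff k‖ * c ^ k ≤ c ^ (s.card + 1) := by
      rcases k with _ | k
      · simp; positivity
      · rw [coeff_X_mul, pow_succ, ← mul_assoc, pow_succ]
        exact mul_le_mul_of_nonneg_right (ih k) hc.le
    have h2 : ‖v a * (∏ i ∈ s, (X - C (v i))).coeff k‖ * c ^ k ≤ c ^ (s.card + 1) := by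
      rw [norm_mul, mul_assoc, pow_succ']
      exact mul_le_mul (h a) (ih k) (by positivity) hc.le
    have h3 := IsUltrametricDist.norm_add_le_max ((X * ∏ i ∈ s, (X - C (v i))).coeff k)
      (-(v a * (∏ i ∈ s, (X - C (v i))).coeff k))
    rw [norm_neg, ← sub_eq_add_neg] at h3
    rcases le_max_iff.mp h3 with h3 | h3
    · exact (mul_le_mul_of_nonneg_right h3 (by positivity)).trans h1
    · exact (mul_le_mul_of_nonneg_right h3 (by positivity)).trans h2

lemma norm_le_of_coeff_prod_X_sub_C (v : ι → E) {c : ℝ} (hc : 0 < c)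
    (h : ∀ k, ‖(∏ i, (X - C (v i))).coeff k‖ * c ^ k ≤ c ^ Fintype.card ι) (i : ι) :
    ‖v i‖ ≤ c := by
  classical
  by_contra! hlt
  have hd : (∏ i : ι, (X - C (v i))).natDegree = Fintype.card ι := by
    rw [natDegree_prod_of_monic _ _ fun i _ => monic_X_sub_C _]
    simp
  have hm : (∏ i : ι, (X - C (v i))).Monic := monic_prod_of_monic _ _ fun i _ => monic_X_sub_C _
  have h0 : (∏ i : ι, (X - C (v i))).eval (v i) = 0 := by
    rw [eval_prod]; exact Finset.prod_eq_zero (Finset.mem_univ i) (by simp)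
  rw [eval_eq_sum_range, hd, Finset.sum_range_succ, ← hd, hm.coeff_natDegree, one_mul, hd,
    add_eq_zero_iff_eq_neg] at h0
  have hpos : 0 < ‖v i‖ := hc.trans hlt
  have hn : Fintype.card ι ≠ 0 := (Fintype.card_pos_iff.mpr ⟨i⟩).ne'
  obtain ⟨j, hj, hle⟩ := IsUltrametricDist.exists_norm_finsetSum_le_of_nonempty
    (Finset.nonempty_range_iff.mpr hn)
    (fun k => (∏ i : ι, (X - C (v i))).coeff k * v i ^ k)
  rw [h0, norm_neg, norm_pow, norm_mul, norm_pow] at hle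
  have hj' := Finset.mem_range.mp hj
  obtain ⟨r, hr⟩ := Nat.exists_eq_add_of_lt hj'
  have h1 : ‖(∏ i, (X - C (v i))).coeff j‖ ≤ c ^ (r + 1) := by
    have := h j
    rw [hr, show j + r + 1 = r + 1 + j by ring, pow_add] at this
    exact le_of_mul_le_mul_right this (by positivity)
  have h2 : ‖v i‖ ^ Fintype.card ι ≤ c ^ (r + 1) * ‖v i‖ ^ j :=
    hle.trans (mul_le_mul_of_nonneg_right h1 (by positivity))
  rw [hr, show j + r + 1 = r + 1 + j by ring, pow_add] at h2
  exact absurd (le_of_mul_le_mul_right h2 (by positivity))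
    (not_le.mpr (pow_lt_pow_left₀ hlt hc.le (by omega)))

/-- Boundedness of the values of `f` can be read off from the degrees of the coefficients of
`valuePoly`. -/
lemma norm_eval₂_le_iff {κ : Type*} [Field κ] (φ : κ[X] →+* E) {P : κ[X][X]} {x : ι → E}
    (hP : P.map φ = ∏ i, (X - C (x i))) {c : ℝ} (hc : 1 < c)
    (hφ : ∀ p, p ≠ 0 → ‖φ p‖ = c ^ p.natDegree) (f : κ[X][X]) (t : ℕ) :
    (∀ i, ‖f.eval₂ φ (x i)‖ ≤ c ^ t) ↔
      ∀ k, (valuePoly P f (Fintype.card ι)).coeff k ≠ 0 →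
        ((valuePoly P f (Fintype.card ι)).coeff k).natDegree + t * k ≤ t * Fintype.card ι := by
  have hc0 : 0 < c := zero_lt_one.trans hc
  have key : ∀ k, ((valuePoly P f (Fintype.card ι)).coeff k ≠ 0 →
        ((valuePoly P f (Fintype.card ι)).coeff k).natDegree + t * k ≤ t * Fintype.card ι) ↔
      ‖(∏ i, (X - C (f.eval₂ φ (x i)))).coeff k‖ * (c ^ t) ^ k ≤ (c ^ t) ^ Fintype.card ι := by
    intro k
    rw [← map_valuePoly φ hP, coeff_map]
    by_cases h0 : (valuePoly P f (Fintype.card ι)).coeff k = 0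
    · simp [h0]; positivity
    · rw [hφ _ h0, ← pow_mul, ← pow_mul, ← pow_add, pow_le_pow_iff_right₀ hc]
      simp [h0]
  rw [forall_congr' key]
  constructor
  · intro h k
    simpa using norm_coeff_prod_X_sub_C_le Finset.univ _ (by positivity) h k
  · intro h i
    exact norm_le_of_coeff_prod_X_sub_C _ (by positivity) h i

lemma norm_eval₂_map_le {κ : Type*} [Field κ] (φ : κ[X] →+* E) {P : κ[X][X]} {x : ι → E}
    (hP : P.map φ = ∏ i, (X - C (x i))) {c : ℝ} (hc : 1 < c)
    (hφ : ∀ p, p ≠ 0 → ‖φ p‖ = c ^ p.natDegree) (σ : κ →+* κ)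
    (hσ : P.map (mapRingHom σ) = P) (f : κ[X][X]) (t : ℕ)
    (h : ∀ i, ‖f.eval₂ φ (x i)‖ ≤ c ^ t) (i : ι) :
    ‖(f.map (mapRingHom σ)).eval₂ φ (x i)‖ ≤ c ^ t := by
  have hinj : Function.Injective (mapRingHom σ) := map_injective σ σ.injective
  revert i
  rw [norm_eval₂_le_iff φ hP hc hφ] at h ⊢
  conv => enter [k]; rw [← hσ]
  intro k
  rw [valuePoly_map _ hinj, coeff_map, coe_mapRingHom, natDegree_map]
  intro h0
  exact h k fun h1 => h0 (by rw [h1, Polynomial.map_zero])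

end ultrametric

end

section

open Polynomial Module

/-- A plane curve over `κ[X]` together with its places at infinity (valued in `E`) and its
places above `X = 0`. -/
structure CurveData {κ Pt E : Type} [Field κ] [Fintype Pt] [NormedField E] (P : κ[X][X]) (n : ℕ)
    (ι : κ[X] →+* E) (x : Fin n → E) (c : ℝ) (z : Pt → PowerSeries κ) : Prop where
  pos : 0 < n
  one_lt : 1 < c
  norm_eq : ∀ p, p ≠ 0 → ‖ι p‖ = c ^ p.natDegree
  map_inf : P.map ι = ∏ i, (X - C (x i))
  eval_ne_zero : ∀ f : κ[X][X], f ≠ 0 → f.natDegree < n → ∀ i, f.eval₂ ι (x i) ≠ 0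
  map_origin : P.map coeToPowerSeries.ringHom = ∏ y, (X - C (z y))
  injective : Function.Injective fun y => PowerSeries.constantCoeff (z y)

namespace CurveData

variable {κ Pt E : Type} [Field κ] [Fintype Pt] [NormedField E] {P : κ[X][X]} {n : ℕ}
    {ι : κ[X] →+* E} {x : Fin n → E} {c : ℝ} {z : Pt → PowerSeries κ}

lemma norm_pos (h : CurveData P n ι x c z) : 0 < c := zero_lt_one.trans h.one_lt

lemma ι_injective (h : CurveData P n ι x c z) : Function.Injective ι := by
  rw [injective_iff_map_eq_zero]
  intro p hp
  by_contra h0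
  have := h.norm_eq p h0
  rw [hp, norm_zero] at this
  exact (pow_pos h.norm_pos _).ne this

lemma monic (h : CurveData P n ι x c z) : P.Monic := by
  refine monic_of_injective h.ι_injective ?_
  rw [h.map_inf]
  exact monic_prod_of_monic _ _ fun i _ => monic_X_sub_C _

lemma natDegree_eq (h : CurveData P n ι x c z) : P.natDegree = n := by
  rw [← natDegree_map_eq_of_injective h.ι_injective, h.map_inf,
    natDegree_prod_of_monic _ _ fun i _ => monic_X_sub_C _]
  simp

lemma card_eq (h : CurveData P n ι x c z) : Fintype.card Pt = n := by
  rw [← h.natDegree_eq, ← natDegree_map_eq_of_injective (f := coeToPowerSeries.ringHom)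
    (coe_injective κ), h.map_origin,
    natDegree_prod_of_monic _ _ fun i _ => monic_X_sub_C _]
  simp

lemma eval_inf (h : CurveData P n ι x c z) (i : Fin n) : P.eval₂ ι (x i) = 0 := by
  rw [← eval_map, h.map_inf, eval_prod]
  exact Finset.prod_eq_zero (Finset.mem_univ i) (by simp)

lemma eval_origin (h : CurveData P n ι x c z) (y : Pt) :
    P.eval₂ coeToPowerSeries.ringHom (z y) = 0 := by
  rw [← eval_map, h.map_origin, eval_prod]
  exact Finset.prod_eq_zero (Finset.mem_univ y) (by simp)

lemma z_injective (h : CurveData P n ι x c z) : Function.Injective z :=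
  fun _ _ hab => h.injective (congrArg PowerSeries.constantCoeff hab)

lemma dvd_of_eval_origin (h : CurveData P n ι x c z) (f : κ[X][X])
    (h0 : ∀ y, f.eval₂ coeToPowerSeries.ringHom (z y) = 0) : P ∣ f := by
  rw [← modByMonic_eq_zero_iff_dvd h.monic]
  have hinj : Function.Injective (coeToPowerSeries.ringHom : κ[X] →+* PowerSeries κ) :=
    coe_injective κ
  apply map_injective _ hinj
  rw [Polynomial.map_zero]
  refine eq_zero_of_natDegree_lt_card_of_eval_eq_zero _ h.z_injective (fun y => ?_) ?_
  · rw [eval_map]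
    have h1 := congrArg (eval₂ coeToPowerSeries.ringHom (z y)) (modByMonic_add_div f P)
    rwa [eval₂_add, eval₂_mul, h.eval_origin, zero_mul, add_zero, h0] at h1
  · rw [h.card_eq]
    refine natDegree_map_le.trans_lt ?_
    rw [← h.natDegree_eq]
    refine natDegree_modByMonic_lt _ h.monic fun h1 => ?_
    have := h.natDegree_eq
    rw [h1, natDegree_one] at this
    exact h.pos.ne this

lemma eval_inf_modByMonic (h : CurveData P n ι x c z) (f : κ[X][X]) (i : Fin n) :
    (f %ₘ P).eval₂ ι (x i) = f.eval₂ ι (x i) := by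
  conv_rhs => rw [← modByMonic_add_div f P, eval₂_add, eval₂_mul, h.eval_inf, zero_mul, add_zero]

lemma eval_origin_modByMonic (h : CurveData P n ι x c z) (f : κ[X][X]) (y : Pt) :
    (f %ₘ P).eval₂ coeToPowerSeries.ringHom (z y) = f.eval₂ coeToPowerSeries.ringHom (z y) := by
  conv_rhs =>
    rw [← modByMonic_add_div f P, eval₂_add, eval₂_mul, h.eval_origin, zero_mul, add_zero]

lemma natDegree_modByMonic_lt (h : CurveData P n ι x c z) (f : κ[X][X]) :
    (f %ₘ P).natDegree < n := by
  rw [← h.natDegree_eq]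
  refine Polynomial.natDegree_modByMonic_lt _ h.monic fun h1 => ?_
  have := h.natDegree_eq
  rw [h1, natDegree_one] at this
  exact h.pos.ne this

lemma norm_C_le (h : CurveData P n ι x c z) (a : κ) : ‖ι (C a)‖ ≤ 1 := by
  by_cases ha : a = 0
  · simp [ha]
  · rw [h.norm_eq _ (C_ne_zero.mpr ha)]; simp

variable [IsUltrametricDist E]

/-- The expansions above the origin of the functions whose poles at infinity are of order at
most `t`. -/
noncomputable def space (h : CurveData P n ι x c z) (t : ℕ) :
    Submodule κ (Pt → PowerSeries κ) where
  carrier := {F | ∃ f : κ[X][X], (∀ i, ‖f.eval₂ ι (x i)‖ ≤ c ^ t) ∧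
    ∀ y, f.eval₂ coeToPowerSeries.ringHom (z y) = F y}
  zero_mem' := ⟨0, fun i => by simpa using (pow_pos h.norm_pos t).le, fun y => by simp⟩
  add_mem' := by
    rintro F H ⟨f, hf, hf'⟩ ⟨g, hg, hg'⟩
    refine ⟨f + g, fun i => ?_, fun y => ?_⟩
    · rw [eval₂_add]
      exact (IsUltrametricDist.norm_add_le_max _ _).trans (max_le (hf i) (hg i))
    · rw [eval₂_add, hf', hg', Pi.add_apply]
  smul_mem' := by
    rintro a F ⟨f, hf, hf'⟩
    refine ⟨C (C a) * f, fun i => ?_, fun y => ?_⟩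
    · rw [eval₂_mul, eval₂_C, norm_mul]
      exact (mul_le_of_le_one_left (norm_nonneg _) (h.norm_C_le a)).trans (hf i)
    · rw [eval₂_mul, eval₂_C, hf', Pi.smul_apply, PowerSeries.smul_eq_C_mul]
      simp

lemma exists_of_mem_space (h : CurveData P n ι x c z) {t : ℕ} {F : Pt → PowerSeries κ}
    (hF : F ∈ h.space t) : ∃ f : κ[X][X], f.natDegree < n ∧ (∀ i, ‖f.eval₂ ι (x i)‖ ≤ c ^ t) ∧
      ∀ y, f.eval₂ coeToPowerSeries.ringHom (z y) = F y := by
  obtain ⟨f, hf, hf'⟩ := hF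
  exact ⟨f %ₘ P, h.natDegree_modByMonic_lt f, fun i => (h.eval_inf_modByMonic f i).symm ▸ hf i,
    fun y => (h.eval_origin_modByMonic f y).trans (hf' y)⟩

lemma mul_mem_space (h : CurveData P n ι x c z) {s t : ℕ} {F H : Pt → PowerSeries κ}
    (hF : F ∈ h.space s) (hH : H ∈ h.space t) : F * H ∈ h.space (s + t) := by
  obtain ⟨f, hf, hf'⟩ := hF
  obtain ⟨g, hg, hg'⟩ := hH
  refine ⟨f * g, fun i => ?_, fun y => ?_⟩
  · rw [eval₂_mul, norm_mul, pow_add]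
    exact mul_le_mul (hf i) (hg i) (norm_nonneg _) (pow_pos h.norm_pos _).le
  · rw [eval₂_mul, hf', hg', Pi.mul_apply]

lemma coe_mul_mem_space (h : CurveData P n ι x c z) {t : ℕ} (p : κ[X]) {F : Pt → PowerSeries κ}
    (hF : F ∈ h.space t) :
    (fun y => (p : PowerSeries κ) * F y) ∈ h.space (t + p.natDegree) := by
  obtain ⟨f, hf, hf'⟩ := hF
  refine ⟨C p * f, fun i => ?_, fun y => ?_⟩
  · rw [eval₂_mul, eval₂_C, norm_mul, pow_add, mul_comm]
    refine mul_le_mul (hf i) ?_ (norm_nonneg _) (pow_pos h.norm_pos _).le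
    by_cases hp : p = 0
    · simp [hp]
    · exact (h.norm_eq p hp).le
  · rw [eval₂_mul, hf', eval₂_C]; rfl

lemma mem_space_of_coe_mul (h : CurveData P n ι x c z) {t : ℕ} {p : κ[X]} (hp : p ≠ 0)
    {F : Pt → PowerSeries κ} {f : κ[X][X]}
    (hf : ∀ y, f.eval₂ coeToPowerSeries.ringHom (z y) = F y)
    (hF : (fun y => (p : PowerSeries κ) * F y) ∈ h.space (t + p.natDegree)) :
    F ∈ h.space t := by
  obtain ⟨f', hf', hf''⟩ := hF
  refine ⟨f, fun i => ?_, hf⟩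
  obtain ⟨u, hu⟩ := h.dvd_of_eval_origin (f' - C p * f) fun y => by
    rw [eval₂_sub, eval₂_mul, eval₂_C, hf'', hf]
    exact sub_self _
  have h1 := congrArg (eval₂ ι (x i)) hu
  rw [eval₂_mul, h.eval_inf, zero_mul, eval₂_sub, eval₂_mul, eval₂_C, sub_eq_zero] at h1
  have h2 := hf' i
  rw [h1, norm_mul, h.norm_eq p hp, pow_add, mul_comm] at h2
  exact le_of_mul_le_mul_right h2 (pow_pos h.norm_pos _)

lemma space_mono (h : CurveData P n ι x c z) (t : ℕ) : h.space t ≤ h.space (t + 1) := by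
  rintro F ⟨f, hf, hf'⟩
  exact ⟨f, fun i => (hf i).trans (pow_le_pow_right₀ h.one_lt.le t.le_succ), hf'⟩

lemma exists_X_mul (h : CurveData P n ι x c z) {f : κ[X][X]} (hd : f.natDegree < n)
    (h0 : ∀ y, (PowerSeries.X : PowerSeries κ) ∣ f.eval₂ coeToPowerSeries.ringHom (z y)) :
    ∃ f', f = C X * f' := by
  suffices C X ∣ f from this
  rw [C_dvd_iff_dvd_coeff]
  intro k
  rw [X_dvd_iff, ← constantCoeff_apply, ← coeff_map]
  suffices f.map constantCoeff = 0 by rw [this, coeff_zero]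
  refine eq_zero_of_natDegree_lt_card_of_eval_eq_zero _ h.injective (fun y => ?_) ?_
  · have := PowerSeries.X_dvd_iff.mp (h0 y)
    rw [hom_eval₂] at this
    rw [eval_map, ← this]
    congr 1
  · rw [h.card_eq]
    exact natDegree_map_le.trans_lt hd

lemma mem_space_of_X_mul (h : CurveData P n ι x c z) {t : ℕ} {F : Pt → PowerSeries κ}
    (hF : (fun y => (PowerSeries.X : PowerSeries κ) * F y) ∈ h.space (t + 1)) :
    F ∈ h.space t := by
  obtain ⟨f, hd, hf, hf'⟩ := h.exists_of_mem_space hF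
  obtain ⟨f', rfl⟩ := h.exists_X_mul hd fun y => ⟨F y, hf' y⟩
  refine h.mem_space_of_coe_mul (p := X) X_ne_zero (f := f') (fun y => ?_) ?_
  · have := hf' y
    rw [eval₂_mul, eval₂_C] at this
    exact mul_left_cancel₀ (PowerSeries.X_ne_zero (R := κ)) (Eq.trans (by simp) this)
  · simpa using hF

/-- The norm to `κ[X]` of a nonzero function. -/
lemma exists_norm (h : CurveData P n ι x c z) {t : ℕ} {f : κ[X][X]} (hd : f.natDegree < n)
    (h0 : f ≠ 0) (hf : ∀ i, ‖f.eval₂ ι (x i)‖ ≤ c ^ t) : ∃ r : κ[X], r ≠ 0 ∧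
      r.natDegree ≤ t * n ∧
      (r : PowerSeries κ) = ∏ y, f.eval₂ coeToPowerSeries.ringHom (z y) ∧
      ∃ a b, P * a + f * b = C r := by
  obtain ⟨r, hr⟩ : ∃ r, r = resultant P f n f.natDegree := ⟨_, rfl⟩
  have h1 : ι r = ∏ i, f.eval₂ ι (x i) := by
    have := map_resultant_eq_prod ι h.map_inf f le_rfl
    rwa [Fintype.card_fin, ← hr] at this
  have h2 : (r : PowerSeries κ) = ∏ y, f.eval₂ coeToPowerSeries.ringHom (z y) := by
    have := map_resultant_eq_prod coeToPowerSeries.ringHom h.map_origin f le_rfl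
    rwa [h.card_eq, ← hr] at this
  have hr0 : r ≠ 0 := by
    rintro rfl
    rw [map_zero] at h1
    exact Finset.prod_ne_zero_iff.mpr (fun i _ => h.eval_ne_zero f h0 hd i) h1.symm
  refine ⟨r, hr0, ?_, h2, ?_⟩
  · have h3 : ‖ι r‖ ≤ (c ^ t) ^ n := by
      rw [h1, norm_prod]
      refine (Finset.prod_le_prod (fun i _ => norm_nonneg _) fun i _ => hf i).trans ?_
      simp
    rwa [h.norm_eq r hr0, ← pow_mul, pow_le_pow_iff_right₀ h.one_lt] at h3
  · obtain ⟨a, b, -, -, hab⟩ := exists_mul_add_mul_eq_C_resultant P f h.natDegree_eq.le le_rfl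
      (Or.inl h.pos.ne')
    exact ⟨a, b, hr ▸ hab⟩

lemma exists_norm_of_mem (h : CurveData P n ι x c z) {t : ℕ} {F : Pt → PowerSeries κ}
    (hF : F ∈ h.space t) (h0 : F ≠ 0) : ∃ f : κ[X][X],
      (∀ y, f.eval₂ coeToPowerSeries.ringHom (z y) = F y) ∧ ∃ r : κ[X], r ≠ 0 ∧
      r.natDegree ≤ t * n ∧ (r : PowerSeries κ) = ∏ y, F y ∧ ∃ a b, P * a + f * b = C r := by
  obtain ⟨f, hd, hf, hf'⟩ := h.exists_of_mem_space hF
  have hf0 : f ≠ 0 := by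
    rintro rfl
    exact h0 (funext fun y => by rw [← hf' y, eval₂_zero]; rfl)
  obtain ⟨r, h1, h2, h3, h4⟩ := h.exists_norm hd hf0 hf
  exact ⟨f, hf', r, h1, h2, by simpa only [hf'] using h3, h4⟩

lemma apply_ne_zero (h : CurveData P n ι x c z) {t : ℕ} {F : Pt → PowerSeries κ}
    (hF : F ∈ h.space t) (h0 : F ≠ 0) (y : Pt) : F y ≠ 0 := by
  obtain ⟨f, -, r, hr, -, h1, -⟩ := h.exists_norm_of_mem hF h0
  intro hy
  rw [Finset.prod_eq_zero (Finset.mem_univ y) hy] at h1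
  exact hr (coe_injective κ (by simpa using h1))

lemma sum_le (h : CurveData P n ι x c z) {t : ℕ} {F : Pt → PowerSeries κ}
    (hF : F ∈ h.space t) (h0 : F ≠ 0) (μ : Pt → ℕ)
    (hμ : ∀ y, (PowerSeries.X : PowerSeries κ) ^ μ y ∣ F y) : ∑ y, μ y ≤ t * Fintype.card Pt := by
  obtain ⟨f, -, r, hr, hd, h1, -⟩ := h.exists_norm_of_mem hF h0
  rw [h.card_eq]
  refine le_trans ?_ hd
  have h2 : (PowerSeries.X : PowerSeries κ) ^ (∑ y, μ y) ∣ r := by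
    rw [h1, ← Finset.prod_pow_eq_pow_sum]
    exact Finset.prod_dvd_prod_of_dvd _ _ fun y _ => hμ y
  have h3 : (X : κ[X]) ^ (∑ y, μ y) ∣ r := by
    rw [X_pow_dvd_iff]
    intro d hd
    rw [← coeff_coe]
    exact PowerSeries.X_pow_dvd_iff.mp h2 d hd
  simpa using natDegree_le_of_dvd h3 hr

lemma finiteDimensional_space (h : CurveData P n ι x c z) (t : ℕ) :
    FiniteDimensional κ (h.space t) := by
  classical
  obtain ⟨N, hN⟩ : ∃ N, N = t * Fintype.card Pt + 1 := ⟨_, rfl⟩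
  let f : (h.space t) →ₗ[κ] (Pt → Fin N → κ) :=
    (LinearMap.pi fun y => LinearMap.pi fun i : Fin N =>
      (PowerSeries.coeff (R := κ) i) ∘ₗ LinearMap.proj y) ∘ₗ (h.space t).subtype
  refine FiniteDimensional.of_injective f ?_
  rw [injective_iff_map_eq_zero]
  rintro ⟨F, hF⟩ h0
  by_contra hne
  have hF0 : F ≠ 0 := fun hc => hne (by simp [hc])
  have hy : ∀ y, (PowerSeries.X : PowerSeries κ) ^ N ∣ F y := by
    intro y
    rw [PowerSeries.X_pow_dvd_iff]
    intro m hm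
    exact congrFun (congrFun h0 y) ⟨m, hm⟩
  obtain ⟨y⟩ : Nonempty Pt := Fintype.card_pos_iff.mp (h.card_eq.symm ▸ h.pos)
  have := h.sum_le hF hF0 (fun _ => N) hy
  have h1 : N ≤ ∑ _y : Pt, N := Finset.single_le_sum (f := fun _ : Pt => N)
    (fun _ _ => Nat.zero_le _) (Finset.mem_univ y)
  omega

lemma le_finrank_space (h : CurveData P n ι x c z) {t m : ℕ}
    (Ψ : (Fin m → κ) →ₗ[κ] (Fin n → κ[X])) (hΨ : Function.Injective Ψ)
    (hb : ∀ v i, ‖∑ j, ι (Ψ v j) * x i ^ (j : ℕ)‖ ≤ c ^ t) : m ≤ finrank κ (h.space t) := by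
  have := h.finiteDimensional_space t
  let p (v : Fin m → κ) : κ[X][X] := ∑ j : Fin n, monomial (j : ℕ) (Ψ v j)
  let f : (Fin m → κ) →ₗ[κ] (Pt → PowerSeries κ) :=
    { toFun := fun v y => ∑ j, (Ψ v j : PowerSeries κ) * z y ^ (j : ℕ)
      map_add' := fun v w => by
        ext1 y
        simp [add_mul, Finset.sum_add_distrib]
      map_smul' := fun a v => by
        ext1 y
        simp [PowerSeries.smul_eq_C_mul, Finset.mul_sum, mul_assoc, Polynomial.smul_eq_C_mul] }
  have hpf (v y) : (p v).eval₂ coeToPowerSeries.ringHom (z y) = f v y := by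
    simp [p, f, eval₂_finsetSum, eval₂_monomial]
  have hmem (v) : f v ∈ h.space t := by
    refine ⟨p v, fun i => ?_, hpf v⟩
    refine le_of_eq_of_le ?_ (hb v i)
    simp [p, eval₂_finsetSum, eval₂_monomial]
  have hinj : Function.Injective (f.codRestrict (h.space t) hmem) := by
    rw [LinearMap.injective_codRestrict_iff, injective_iff_map_eq_zero]
    intro v hv
    have h1 := h.dvd_of_eval_origin (p v) fun y => by rw [hpf, hv]; rfl
    have h2 : p v = 0 := by
      refine eq_zero_of_dvd_of_degree_lt h1 ?_
      refine (degree_sum_le _ _).trans_lt ?_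
      rw [Finset.sup_lt_iff (by rw [degree_eq_natDegree h.monic.ne_zero]; exact WithBot.bot_lt_coe _)]
      intro j _
      refine (degree_monomial_le _ _).trans_lt ?_
      rw [degree_eq_natDegree h.monic.ne_zero, h.natDegree_eq]
      exact_mod_cast j.2
    apply hΨ
    rw [map_zero]
    funext j
    have h3 := congrArg (fun g => coeff g (j : ℕ)) h2
    simpa [p, finsetSum_coeff, coeff_monomial, Fin.val_inj] using h3
  simpa using LinearMap.finrank_le_finrank_of_injective hinj

lemma cancel (h : CurveData P n ι x c z) {s : ℕ} {H : Pt → PowerSeries κ}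
    (hH : H ∈ h.space s) (h0 : H ≠ 0) : ∃ (p : PowerSeries κ) (e : ℕ), 1 ≤ e ∧
    PowerSeries.constantCoeff p = 1 ∧
    (∀ t F, F ∈ h.space t → (fun y => p * F y) ∈ h.space (t + e)) ∧
    ∀ t F E, F ∈ h.space (t + e) → E ∈ h.space (t + s) → (∀ y, H y * F y = p * E y) →
      ∃ F' ∈ h.space t, ∀ y, F y = p * F' y := by
  obtain ⟨f, hf, r, hr, -, -, a, b, hab⟩ := h.exists_norm_of_mem hH h0
  have hp : (1 + X * r : κ[X]) ≠ 0 := by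
    intro hc
    simpa using congrArg (fun p => coeff p 0) hc
  refine ⟨((1 + X * r : κ[X]) : PowerSeries κ), (1 + X * r).natDegree, ?_, by simp,
    fun t F hF => h.coe_mul_mem_space _ hF, fun t F E hF hE hFE => ?_⟩
  · rw [natDegree_add_eq_right_of_natDegree_lt]
    · rw [natDegree_X_mul hr]; omega
    · rw [natDegree_X_mul hr]; simp
  · obtain ⟨u, hu, hu'⟩ := id hF
    obtain ⟨v, hv, hv'⟩ := hE
    have hval : ∀ y, F y = ((1 + X * r : κ[X]) : PowerSeries κ) *
        (u - C X * b * v).eval₂ coeToPowerSeries.ringHom (z y) := by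
      intro y
      have h1 := congrArg (eval₂ coeToPowerSeries.ringHom (z y)) hab
      rw [eval₂_add, eval₂_mul, h.eval_origin, zero_mul, zero_add, eval₂_mul, hf, eval₂_C] at h1
      have h2 := hFE y
      simp only [eval₂_sub, eval₂_mul, eval₂_C, hu', hv', coeToPowerSeries.ringHom_apply,
        coe_add, coe_mul, coe_one, coe_X] at h1 h2 ⊢
      linear_combination PowerSeries.X * F y * h1 - PowerSeries.X *
        (eval₂ coeToPowerSeries.ringHom (z y) b) * h2
    refine ⟨fun y => (u - C X * b * v).eval₂ coeToPowerSeries.ringHom (z y),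
      h.mem_space_of_coe_mul hp (fun y => rfl) ?_, hval⟩
    convert hF using 2 with y
    exact (hval y).symm

lemma frob_mem (h : CurveData P n ι x c z) (σ : κ →+* κ) (hσ : P.map (mapRingHom σ) = P)
    (φ : κ[X][X]) (hφ : ∀ i, ∃ j, φ.eval₂ ι (x i) = x j)
    (hz : ∀ y, PowerSeries.map σ (z y) = φ.eval₂ coeToPowerSeries.ringHom (z y))
    {t : ℕ} {F : Pt → PowerSeries κ} (hF : F ∈ h.space t) :
    (fun y => PowerSeries.map σ (F y)) ∈ h.space t := by
  obtain ⟨f, hf, hf'⟩ := hF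
  refine ⟨(f.map (mapRingHom σ)).comp φ, fun i => ?_, fun y => ?_⟩
  · obtain ⟨j, hj⟩ := hφ i
    rw [eval₂_comp, hj]
    refine norm_eval₂_map_le ι h.map_inf h.one_lt h.norm_eq σ hσ f t hf j
  · simp only [← hf']
    rw [eval₂_comp, ← hz, hom_eval₂, eval₂_map]
    congr 1
    ext <;> simp

theorem functionSpaces (h : CurveData P n ι x c z) (σ : κ →+* κ) (hσ : P.map (mapRingHom σ) = P)
    (φ : κ[X][X]) (hφ : ∀ i, ∃ j, φ.eval₂ ι (x i) = x j)
    (hz : ∀ y, PowerSeries.map σ (z y) = φ.eval₂ coeToPowerSeries.ringHom (z y)) {g0 : ℕ}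
    (hg : ∀ t, ∃ m : ℕ, n * t ≤ m + g0 ∧ ∃ Ψ : (Fin m → κ) →ₗ[κ] (Fin n → κ[X]),
      Function.Injective Ψ ∧ ∀ v i, ‖∑ j, ι (Ψ v j) * x i ^ (j : ℕ)‖ ≤ c ^ t) :
    FunctionSpaces κ Pt h.space g0 σ where
  mul_mem _ _ _ _ := h.mul_mem_space
  mono := h.space_mono
  X_mul_mem t F hF := by simpa using h.coe_mul_mem_space X hF
  mem_of_X_mul _ _ := h.mem_space_of_X_mul
  apply_ne_zero _ _ := h.apply_ne_zero
  sum_le _ _ := h.sum_le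
  le_finrank t := by
    obtain ⟨m, hm, Ψ, hΨ, hb⟩ := hg t
    have := h.le_finrank_space Ψ hΨ hb
    rw [h.card_eq, mul_comm]
    omega
  cancel _ _ := h.cancel
  frob_mem _ _ := h.frob_mem σ hσ φ hφ hz

end CurveData

end

section

open Polynomial Module

section lift

variable {κ : Type} [Field κ] {n : ℕ}

/-- A monic polynomial whose reduction at the origin has distinct roots in the base field splits
over the power series. -/
lemma exists_powerSeries_roots {P : κ[X][X]} (hP : P.Monic) {y : Fin n → κ}
    (hy : Function.Injective y) (h : P.map constantCoeff = ∏ i, (X - C (y i))) :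
    ∃ z : Fin n → PowerSeries κ, (∀ i, PowerSeries.constantCoeff (z i) = y i) ∧
      P.map coeToPowerSeries.ringHom = ∏ i, (X - C (z i)) := by
  obtain ⟨Q, hQ⟩ : ∃ Q, Q = P.map (coeToPowerSeries.ringHom : κ[X] →+* PowerSeries κ) := ⟨_, rfl⟩
  have hQm : Q.Monic := hQ ▸ hP.map _
  have hred : Q.map PowerSeries.constantCoeff = ∏ i, (X - C (y i)) := by
    rw [← h, hQ, Polynomial.map_map]
    congr 1
  have hdeg : Q.natDegree = n := by
    rw [← hQm.natDegree_map (PowerSeries.constantCoeff (R := κ)), hred,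
      natDegree_prod_of_monic _ _ fun i _ => monic_X_sub_C _]
    simp
  have hcc (p : (PowerSeries κ)[X]) (a : PowerSeries κ) : PowerSeries.constantCoeff (p.eval a) =
      (p.map PowerSeries.constantCoeff).eval (PowerSeries.constantCoeff a) := by
    rw [eval_map, eval₂_at_apply]
  have key (i) : ∃ z : PowerSeries κ, PowerSeries.constantCoeff z = y i ∧ Q.eval z = 0 := by
    have hroot : Q.eval (PowerSeries.C (y i)) ∈ Ideal.span {(PowerSeries.X : PowerSeries κ)} := by
      rw [Ideal.mem_span_singleton, PowerSeries.X_dvd_iff, hcc, hred, eval_prod]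
      exact Finset.prod_eq_zero (Finset.mem_univ i) (by simp)
    have hunit : IsUnit (Q.derivative.eval (PowerSeries.C (y i))) := by
      rw [PowerSeries.isUnit_iff_constantCoeff, isUnit_iff_ne_zero, hcc, ← derivative_map, hred,
        PowerSeries.constantCoeff_C, derivative_prod_finset, eval_finsetSum,
        Finset.sum_eq_single i]
      · simp only [derivative_sub, derivative_X, derivative_C, sub_zero, mul_one]
        rw [eval_prod, Finset.prod_ne_zero_iff]
        intro j hj
        simpa [sub_eq_zero] using fun hc => (Finset.ne_of_mem_erase hj) (hy hc).symm
      · intro j _ hj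
        rw [eval_mul, eval_prod, Finset.prod_eq_zero (Finset.mem_erase.mpr ⟨hj.symm,
          Finset.mem_univ i⟩) (by simp), zero_mul]
      · simp
    obtain ⟨a, ha, ha'⟩ := HenselianRing.is_henselian Q hQm _ hroot (hunit.map _)
    refine ⟨a, ?_, ha⟩
    rw [Ideal.mem_span_singleton, PowerSeries.X_dvd_iff, map_sub, sub_eq_zero] at ha'
    simpa using ha'
  choose z hz hz' using key
  refine ⟨z, hz, ?_⟩
  rw [← hQ]
  have hz'' : Function.Injective z := fun a b hab => hy (by rw [← hz a, hab, hz b])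
  have hprod : (∏ i, (X - C (z i))).Monic := monic_prod_of_monic _ _ fun i _ => monic_X_sub_C _
  have hpd : (∏ i, (X - C (z i))).natDegree = n := by
    rw [natDegree_prod_of_monic _ _ fun i _ => monic_X_sub_C _]
    simp
  rcases Nat.eq_zero_or_pos n with h0 | h0
  · rw [hQm.natDegree_eq_zero.mp (hdeg.trans h0), hprod.natDegree_eq_zero.mp (hpd.trans h0)]
  rw [← sub_eq_zero]
  refine eq_zero_of_natDegree_lt_card_of_eval_eq_zero _ hz'' (fun i => ?_) ?_
  · rw [eval_sub, hz', eval_prod, Finset.prod_eq_zero (Finset.mem_univ i) (by simp), sub_zero]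
  · rw [Fintype.card_fin]
    by_contra! hle
    have h1 : (Q - ∏ i, (X - C (z i))).degree < Q.degree :=
      degree_sub_lt_left (by rw [degree_eq_natDegree hQm.ne_zero, degree_eq_natDegree hprod.ne_zero,
        hdeg, hpd]) hQm.ne_zero (by rw [hQm.leadingCoeff, hprod.leadingCoeff])
    have h2 : (Q - ∏ i, (X - C (z i))).natDegree < Q.natDegree :=
      natDegree_lt_natDegree (fun hc => by rw [hc, natDegree_zero] at hle; omega) h1
    omega

end lift

namespace CurveData

variable {κ Pt E : Type} [Field κ] [Fintype Pt] [NormedField E] {P : κ[X][X]} {n : ℕ}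
    {ι : κ[X] →+* E} {x : Fin n → E} {c : ℝ} {z : Pt → PowerSeries κ}

lemma map_powerSeries_root (h : CurveData P n ι x c z) (σ : κ →+* κ)
    (hσ : P.map (mapRingHom σ) = P) (φ : κ[X][X]) (hφ : ∀ i, ∃ j, φ.eval₂ ι (x i) = x j)
    (h0 : ∀ y, PowerSeries.constantCoeff (φ.eval₂ coeToPowerSeries.ringHom (z y)) =
      σ (PowerSeries.constantCoeff (z y))) (y : Pt) :
    PowerSeries.map σ (z y) = φ.eval₂ coeToPowerSeries.ringHom (z y) := by
  have hroot (a : PowerSeries κ) (ha : P.eval₂ coeToPowerSeries.ringHom a = 0) :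
      ∃ y, a = z y := by
    rw [← eval_map, h.map_origin, eval_prod, Finset.prod_eq_zero_iff] at ha
    obtain ⟨y, -, hy⟩ := ha
    exact ⟨y, sub_eq_zero.mp (by simpa using hy)⟩
  obtain ⟨y₁, hy₁⟩ := hroot (PowerSeries.map σ (z y)) (by
    have h1 := congrArg (PowerSeries.map σ) (h.eval_origin y)
    rw [hom_eval₂, map_zero] at h1
    rw [← h1]
    conv_lhs => rw [← hσ, eval₂_map]
    congr 1
    ext <;> simp)
  obtain ⟨y₂, hy₂⟩ := hroot (φ.eval₂ coeToPowerSeries.ringHom (z y)) (by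
    have h1 : P.comp φ %ₘ P = 0 := by
      by_contra hne
      have hi : Fin n := ⟨0, h.pos⟩
      refine h.eval_ne_zero _ hne (h.natDegree_modByMonic_lt _) hi ?_
      obtain ⟨j, hj⟩ := hφ hi
      rw [h.eval_inf_modByMonic, eval₂_comp, hj, h.eval_inf]
    rw [← eval₂_comp, ← h.eval_origin_modByMonic, h1, eval₂_zero])
  rw [hy₁, hy₂]
  congr 1
  apply h.injective
  show PowerSeries.constantCoeff (z y₁) = PowerSeries.constantCoeff (z y₂)
  rw [← hy₁, ← hy₂, h0, ← PowerSeries.coeff_zero_eq_constantCoeff_apply, PowerSeries.coeff_map,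
    PowerSeries.coeff_zero_eq_constantCoeff_apply]

end CurveData

section torsion

variable {F : Type} [Field F] [Fintype F]

local notation "q" => Fintype.card F

lemma dvd_X_sub_one_pow_sub_one {N : F[X]} (hNi : Irreducible N) (hN : N.Monic)
    (h1 : N.eval 1 ≠ 0) : N ∣ (X - 1) ^ (q ^ N.natDegree - 1) - 1 := by
  have := Fact.mk hNi
  have hfin : Module.Finite F (AdjoinRoot N) := hN.finite_adjoinRoot
  have : Finite (AdjoinRoot N) := Module.finite_of_finite F
  have : Fintype (AdjoinRoot N) := Fintype.ofFinite _
  have hc : Fintype.card (AdjoinRoot N) = q ^ N.natDegree := by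
    rw [Module.card_eq_pow_finrank (K := F), (AdjoinRoot.powerBasis hN.ne_zero).finrank,
      AdjoinRoot.powerBasis_dim]
  rw [← AdjoinRoot.mk_eq_zero, map_sub, map_pow, map_sub, map_one, AdjoinRoot.mk_X, sub_eq_zero,
    ← hc]
  refine FiniteField.pow_card_sub_one_eq_one _ fun h => h1 ?_
  have h2 := AdjoinRoot.eval₂_root N
  rw [sub_eq_zero.mp h, eval₂_at_one] at h2
  exact (map_eq_zero _).mp h2

lemma theta_pow_fixed {S : Type} [CommRing S] [Algebra F S] {N : F[X]} {m : ℕ}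
    (hm : N ∣ (X - 1) ^ m - 1) {y : S} (hy : aeval (theta F (0 : S)) N y = 0) :
    y ^ q ^ (3 * m) = y := by
  have h1 : aeval (theta F (0 : S)) ((X - 1) ^ m - 1 : F[X]) y = 0 := by
    obtain ⟨u, hu⟩ := hm
    rw [hu, mul_comm, map_mul, Module.End.mul_apply, hy, map_zero]
  have h2 (j : ℕ) (w : S) : ((theta F (0 : S) - 1) ^ j) w = w ^ q ^ (3 * j) := by
    induction j generalizing w with
    | zero => simp
    | succ j ih =>
      rw [pow_succ, Module.End.mul_apply, ih, LinearMap.sub_apply, theta_apply, Module.End.one_apply,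
        zero_mul, add_zero, add_sub_cancel_left, ← pow_mul, ← pow_add]
      congr 2
      ring
  rw [map_sub, map_pow, map_sub, aeval_X, map_one, LinearMap.sub_apply, h2, Module.End.one_apply,
    sub_eq_zero] at h1
  exact h1

/-- All the torsion is rational at the origin. -/
lemma exists_torPoly_zero_eq_prod {κ : Type} [Field κ] [Fintype κ] [Algebra F κ] {N : F[X]}
    (hN : N.Monic) (h1 : N.eval 1 ≠ 0) {m n : ℕ} (hm : N ∣ (X - 1) ^ m - 1)
    (hκ : Fintype.card κ = q ^ (3 * m)) (hn : n = q ^ (3 * N.natDegree) - 1) :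
    ∃ y : Fin n → κ, Function.Injective y ∧ torPoly (0 : κ) N = ∏ i, (X - C (y i)) := by
  let S := AlgebraicClosure κ
  obtain ⟨w, hw, hw', hw''⟩ := torPoly_eq_prod (F := F) (E := S) (G := 0) hN h1
    (IsAlgClosed.splits _) hn
  have hr (i) : ∃ y : κ, algebraMap κ S y = w i := by
    have h2 := theta_pow_fixed hm ((hw' (w i)).mpr ⟨i, rfl⟩).1
    rw [← hκ] at h2
    have h3 : (X ^ Fintype.card κ - X : κ[X]).Splits := by
      rw [splits_iff_card_roots, FiniteField.roots_X_pow_card_sub_X,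
        FiniteField.X_pow_card_sub_X_natDegree_eq _ Fintype.one_lt_card]
      rfl
    exact h3.mem_range_of_isRoot (i := algebraMap κ S) (x := w i)
      (FiniteField.X_pow_card_sub_X_ne_zero _ Fintype.one_lt_card) (by simp [h2])
  choose y hy using hr
  refine ⟨y, fun a b hab => hw (by rw [← hy, hab, hy]), ?_⟩
  apply map_injective (algebraMap κ S) (algebraMap κ S).injective
  have h5 := map_torPoly (IsScalarTower.toAlgHom F κ S) 0 N
  rw [map_zero, hw''] at h5
  rw [Polynomial.map_prod]
  simp only [Polynomial.map_sub, map_X, map_C, hy]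
  exact h5

end torsion

end

section

open Polynomial Module

section construction

variable {F : Type} [Field F] [Fintype F]

local notation "q" => Fintype.card F

lemma theta_sub_one_mem_torsion {E : Type} [Field E] [Algebra F E] {G : E} {N : F[X]}
    (h1 : N.eval 1 ≠ 0) {x : E} (hx : aeval (theta F G) N x = 0) (hx0 : x ≠ 0) :
    aeval (theta F G) N (G * x ^ q ^ 2 + x ^ q ^ 3) = 0 ∧ G * x ^ q ^ 2 + x ^ q ^ 3 ≠ 0 := by
  have hθ : G * x ^ q ^ 2 + x ^ q ^ 3 = aeval (theta F G) (X - 1 : F[X]) x := by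
    rw [map_sub, aeval_X, map_one, LinearMap.sub_apply, theta_apply, Module.End.one_apply]
    ring
  rw [hθ]
  constructor
  · rw [← Module.End.mul_apply, ← map_mul, mul_comm, map_mul, Module.End.mul_apply, hx, map_zero]
  · intro h0
    have h2 : (X - 1 : F[X]) ∣ N - C (N.eval 1) := by
      have := X_sub_C_dvd_sub_C_eval (p := N) (a := 1)
      rwa [C_1] at this
    obtain ⟨u, hu⟩ := h2
    have h3 := congrArg (fun p => aeval (theta F G) p x) hu
    simp only [map_sub, mul_comm _ u] at h3
    rw [map_mul, Module.End.mul_apply, h0, map_zero, LinearMap.sub_apply, hx, zero_sub,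
      neg_eq_zero, aeval_C, Module.algebraMap_end_apply, smul_eq_zero] at h3
    exact h3.elim h1 hx0

/-- The function spaces of the tower, over a finite field containing the torsion at the origin. -/
theorem exists_functionSpaces (κ : Type) [Field κ] [Fintype κ] [Algebra F κ] {N : F[X]}
    (hNi : Irreducible N) (hN : N.Monic) (hd : 1 ≤ N.natDegree) (h1 : N.eval 1 ≠ 0)
    (hκ : Fintype.card κ = q ^ (3 * (q ^ N.natDegree - 1))) {n g0 : ℕ}
    (hn : n = q ^ (3 * N.natDegree) - 1) (hg : (n : ℝ) * loss F ≤ g0) (σ : κ →ₐ[F] κ)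
    (hσ : ∀ a, σ a = a ^ q ^ 3) :
    ∃ L, FunctionSpaces κ (Fin n) L g0 (σ : κ →+* κ) := by
  obtain ⟨y, hy, hyP⟩ := exists_torPoly_zero_eq_prod hN h1
    (dvd_X_sub_one_pow_sub_one hNi hN h1) hκ hn
  obtain ⟨E, _, ι, x, c, _, hc, hnorm, hinf, hne, hΨ⟩ :=
    exists_place_at_infinity κ hNi hN hd h1 hn
  obtain ⟨P, hP⟩ : ∃ P, P = torPoly (X : κ[X]) N := ⟨_, rfl⟩
  rw [← hP] at hinf
  have hPm : P.Monic := hP ▸ (monic_torPoly (F := F) (X : κ[X]) hN).1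
  have hP0 : P.map constantCoeff = ∏ i, (X - C (y i)) := by
    rw [← hyP, hP]
    have := map_torPoly ((aeval (0 : κ)).restrictScalars F : κ[X] →ₐ[F] κ) X N
    simp only [AlgHom.restrictScalars_apply, aeval_X] at this
    rw [← this]
    congr 1
    ext a <;> simp
  obtain ⟨z, hz, hzP⟩ := exists_powerSeries_roots hPm hy hP0
  have hq : 1 < q := Fintype.one_lt_card
  have hn0 : 0 < n := by
    have : 1 < q ^ (3 * N.natDegree) := Nat.one_lt_pow (by omega) (by omega)
    omega
  have h : CurveData P n ι x c z :=
    ⟨hn0, hc, hnorm, hinf, hne, hzP, by simpa only [hz] using hy⟩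
  have hσP : P.map (mapRingHom (σ : κ →+* κ)) = P := by
    have := map_torPoly (mapAlgHom σ : κ[X] →ₐ[F] κ[X]) X N
    rw [coe_mapAlgHom, map_X] at this
    rw [hP]
    exact this
  let _ : Algebra F E := ((ι.comp C).comp (algebraMap F κ)).toAlgebra
  let ι' : κ[X] →ₐ[F] E := { ι with commutes' := fun r => rfl }
  have hιP : P.map ι = torPoly (ι X) N := by
    rw [hP]
    exact map_torPoly ι' X N
  have hroot (w : E) : (aeval (theta F (ι X)) N w = 0 ∧ w ≠ 0) ↔ ∃ i, w = x i := by
    rw [← torPoly_eval_eq_zero h1, ← hιP, hinf, eval_prod, Finset.prod_eq_zero_iff]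
    simp [sub_eq_zero]
  let φ : κ[X][X] := C X * X ^ q ^ 2 + X ^ q ^ 3
  have hφ (i) : ∃ j, φ.eval₂ ι (x i) = x j := by
    have h2 := (hroot (x i)).mpr ⟨i, rfl⟩
    have h3 := (hroot _).mp (theta_sub_one_mem_torsion h1 h2.1 h2.2)
    simpa [φ] using h3
  have hσz := h.map_powerSeries_root (σ : κ →+* κ) hσP φ hφ fun i => by
    simp [φ, hσ]
  refine ⟨_, h.functionSpaces (σ : κ →+* κ) hσP φ hφ hσz fun t => ?_⟩
  obtain ⟨m, hm, hΨ⟩ := hΨ t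
  refine ⟨m, ?_, hΨ⟩
  have : (n * t : ℝ) ≤ m + g0 := by linarith
  exact_mod_cast this

end construction

end

section Codes

open Module

variable {F : Type} [Field F] [DecidableEq F] {n : ℕ}

/-- A form of the Singleton bound. -/
lemma finrank_add_le_of_lt_hammingNorm (C : Submodule F (Fin n → F)) {w : ℕ} (hw : w ≤ n)
    (h : ∀ c ∈ C, c ≠ 0 → w < hammingNorm c) : finrank F C + w ≤ n := by
  let f : (Fin n → F) →ₗ[F] (Fin (n - w) → F) := LinearMap.funLeft F F (Fin.castLE (by omega))
  have hf : Function.Injective (f ∘ₗ C.subtype) := by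
    rw [← LinearMap.ker_eq_bot, LinearMap.ker_eq_bot']
    rintro ⟨c, hc⟩ hfc
    by_contra hne
    have hlt := h c hc (fun h0 => hne (by ext1; exact h0))
    have hsub : (Finset.univ.filter fun i => c i ≠ 0) ⊆
        (Finset.univ.map (Fin.castLEEmb (Nat.sub_le n w)))ᶜ := by
      intro i hi
      simp only [Finset.mem_compl, Finset.mem_map, Finset.mem_univ, true_and, not_exists]
      intro j hj
      refine (Finset.mem_filter.mp hi).2 ?_
      rw [← hj]
      exact congrFun hfc j
    have hcard := Finset.card_le_card hsub
    rw [Finset.card_compl, Finset.card_map, Finset.card_univ, Fintype.card_fin,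
      Fintype.card_fin] at hcard
    have : hammingNorm c ≤ n - (n - w) := hcard
    omega
  have := LinearMap.finrank_le_finrank_of_injective hf
  rw [finrank_fin_fun] at this
  omega

lemma finrank_add_finrank_dualCode (C : Submodule F (Fin n → F)) :
    finrank F C + finrank F (dualCode C) = n := by
  have h := Subspace.finrank_add_finrank_dualAnnihilator_eq C
  have hmap : (dualCode C).map (dotProductEquiv F (Fin n)).toLinearMap = C.dualAnnihilator := by
    ext φ
    rw [Submodule.mem_map_equiv, Submodule.mem_dualAnnihilator]
    obtain ⟨x, rfl⟩ := (dotProductEquiv F (Fin n)).surjective φ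
    rw [LinearEquiv.symm_apply_apply]
    rfl
  rw [← hmap, LinearEquiv.finrank_map_eq, finrank_fin_fun] at h
  exact h

lemma le_finrank_of_lt_hammingNorm_dualCode (C : Submodule F (Fin n → F)) {w : ℕ} (hw : w ≤ n)
    (h : ∀ c ∈ dualCode C, c ≠ 0 → w < hammingNorm c) : w ≤ finrank F C := by
  have h1 := finrank_add_le_of_lt_hammingNorm _ hw h
  have h2 := finrank_add_finrank_dualCode C
  omega

lemma lt_hammingNorm_of_codeSq {C : Submodule F (Fin n → F)} {w : ℕ}
    (h : ∀ c ∈ codeSq C, c ≠ 0 → w < hammingNorm c) : ∀ c ∈ C, c ≠ 0 → w < hammingNorm c := by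
  intro c hc hc0
  have hs : hammingNorm (c * c) = hammingNorm c := by
    simp [hammingNorm]
  rw [← hs]
  refine h _ (Submodule.subset_span ⟨c, hc, c, hc, rfl⟩) fun h0 => hc0 ?_
  ext i
  simpa using congrFun h0 i

lemma lt_hammingNorm_dualCode_codeSq {C : Submodule F (Fin n → F)} {w : ℕ} (hw : 1 ≤ w)
    (h : ∀ c ∈ dualCode C, c ≠ 0 → w < hammingNorm c) :
    ∀ c ∈ dualCode (codeSq C), c ≠ 0 → w < hammingNorm c := by
  intro y hy hy0
  obtain ⟨i, hi⟩ : ∃ i, y i ≠ 0 := by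
    by_contra! h0
    exact hy0 (funext h0)
  obtain ⟨a, ha, hai⟩ : ∃ a ∈ C, a i ≠ 0 := by
    by_contra! h0
    have h1 : (Pi.single i 1 : Fin n → F) ∈ dualCode C := by
      intro c hc
      simp [Pi.single_apply, h0 c hc]
    have h2 := h _ h1 (by simp)
    have h3 : hammingNorm (Pi.single i 1 : Fin n → F) ≤ 1 := by
      rw [hammingNorm, Finset.card_le_one]
      intro j hj k hk
      simp only [Finset.mem_filter, Pi.single_apply, ne_eq, ite_eq_right_iff, not_forall] at hj hk
      rw [hj.2.choose, hk.2.choose]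
    omega
  have hya : y * a ∈ dualCode C := by
    intro c hc
    have := hy (a * c) (Submodule.subset_span ⟨a, ha, c, hc, rfl⟩)
    simpa [mul_assoc] using this
  refine (h _ hya fun h0 => ?_).trans_le ?_
  · have := congrFun h0 i
    simp [hi, hai] at this
  · refine Finset.card_le_card fun j hj => ?_
    simp only [Finset.mem_filter, Pi.mul_apply, mul_ne_zero_iff] at hj ⊢
    exact ⟨hj.1, hj.2.1⟩

/-- If a code has good dual and square distances, then all three codes have good parameters. -/
lemma code_parameters {C : Submodule F (Fin n → F)} {w : ℕ} (hw : 1 ≤ w) (hwn : w ≤ n)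
    (hd : ∀ c ∈ dualCode C, c ≠ 0 → w < hammingNorm c)
    (hs : ∀ c ∈ codeSq C, c ≠ 0 → w < hammingNorm c) :
    w ≤ finrank F C ∧ (∀ c ∈ C, c ≠ 0 → w ≤ hammingNorm c) ∧
      w ≤ finrank F (dualCode C) ∧ (∀ c ∈ dualCode C, c ≠ 0 → w ≤ hammingNorm c) ∧
      w ≤ finrank F (codeSq C) ∧ ∀ c ∈ codeSq C, c ≠ 0 → w ≤ hammingNorm c := by
  have hC := lt_hammingNorm_of_codeSq hs
  refine ⟨le_finrank_of_lt_hammingNorm_dualCode C hwn hd, fun c hc h0 => (hC c hc h0).le, ?_,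
    fun c hc h0 => (hd c hc h0).le,
    le_finrank_of_lt_hammingNorm_dualCode _ hwn (lt_hammingNorm_dualCode_codeSq hw hd),
    fun c hc h0 => (hs c hc h0).le⟩
  have h1 := finrank_add_le_of_lt_hammingNorm _ hwn hC
  have h2 := finrank_add_finrank_dualCode C
  omega

/-- Transport of a code along an enumeration of its coordinates. -/
lemma exists_code_of_equiv {ι : Type} [Fintype ι] (e : Fin n ≃ ι) (D : Submodule F (ι → F))
    {w : ℕ} (hd : ∀ y : ι → F, y ≠ 0 → (∀ x ∈ D, ∑ i, y i * x i = 0) → w < hammingNorm y)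
    (hs : ∀ z ∈ Submodule.span F {z | ∃ a ∈ D, ∃ b ∈ D, z = a * b}, z ≠ 0 → w < hammingNorm z) :
    ∃ C : Submodule F (Fin n → F), (∀ c ∈ dualCode C, c ≠ 0 → w < hammingNorm c) ∧
      ∀ c ∈ codeSq C, c ≠ 0 → w < hammingNorm c := by
  let f : (Fin n → F) ≃ₗ[F] (ι → F) := LinearEquiv.funCongrLeft F F e.symm
  have hf : ∀ c i, f c i = c (e.symm i) := fun c i => rfl
  have hnorm : ∀ c, hammingNorm (f c) = hammingNorm c := by
    intro c
    refine Finset.card_equiv e.symm fun i => ?_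
    simp [hf]
  refine ⟨D.comap f.toLinearMap, fun c hc h0 => ?_, fun c hc h0 => ?_⟩
  · rw [← hnorm]
    refine hd _ (by simpa using h0) fun x hx => ?_
    have := hc (f.symm x) (by simpa using hx)
    rw [← this, ← e.sum_comp]
    refine Finset.sum_congr rfl fun i _ => ?_
    rw [hf, e.symm_apply_apply]
    rfl
  · rw [← hnorm]
    refine hs _ ?_ (by simpa using h0)
    have hmem : f c ∈ (codeSq (D.comap f.toLinearMap)).map f.toLinearMap := ⟨c, hc, rfl⟩
    rw [codeSq, Submodule.map_span] at hmem
    refine Submodule.span_mono ?_ hmem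
    rintro _ ⟨_, ⟨a, ha, b, hb, rfl⟩, rfl⟩
    exact ⟨f a, ha, f b, hb, rfl⟩

end Codes

section Fields

open Polynomial Module

variable (F : Type) [Field F] [Fintype F]

lemma exists_irreducible_natDegree_eq {d : ℕ} (hd : 2 ≤ d) :
    ∃ N : F[X], Irreducible N ∧ N.Monic ∧ N.natDegree = d ∧ N.eval 1 ≠ 0 := by
  obtain ⟨p, hp⟩ := CharP.exists F
  have : Fact p.Prime := ⟨CharP.char_is_prime F p⟩
  have : NeZero d := ⟨by omega⟩
  obtain ⟨α, hα⟩ := Field.exists_primitive_element F (FiniteField.Extension F p d)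
  have hinteg : IsIntegral F α := Algebra.IsIntegral.isIntegral α
  have hdeg : (minpoly F α).natDegree = d := by
    rw [(Field.primitive_element_iff_minpoly_natDegree_eq F α).mp hα,
      FiniteField.finrank_extension]
  have hirr := minpoly.irreducible hinteg
  refine ⟨_, hirr, minpoly.monic hinteg, hdeg, fun h => ?_⟩
  have : (minpoly F α).natDegree = 1 :=
    natDegree_eq_of_degree_eq_some (degree_eq_one_of_irreducible_of_root hirr h)
  omega

/-- A tower of finite fields of prescribed degrees, with the Frobenius of the middle field. -/
lemma exists_finite_tower {m : ℕ} (hm : 1 ≤ m) :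
    ∃ (K κ : Type) (_ : Field K) (_ : Fintype K) (_ : Algebra F K) (_ : Field κ) (_ : Fintype κ)
      (_ : Algebra F κ) (_ : Algebra K κ) (σ : κ →ₐ[F] κ), finrank F K = 3 ∧
      Fintype.card κ = Fintype.card F ^ (3 * m) ∧ ∀ a, σ a = a ^ Fintype.card F ^ 3 := by
  obtain ⟨p, hp⟩ := CharP.exists F
  have : Fact p.Prime := ⟨CharP.char_is_prime F p⟩
  have : NeZero m := ⟨by omega⟩
  let K := FiniteField.Extension F p 3
  have : CharP K p := charP_of_injective_algebraMap (algebraMap F K).injective p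
  have : Finite K := inferInstance
  let κ := FiniteField.Extension K p m
  have : Finite κ := inferInstance
  let : Fintype K := Fintype.ofFinite K
  let : Fintype κ := Fintype.ofFinite κ
  let : Algebra F κ := ((algebraMap K κ).comp (algebraMap F K)).toAlgebra
  refine ⟨K, κ, inferInstance, inferInstance, inferInstance, inferInstance, inferInstance,
    inferInstance, inferInstance, (FiniteField.frobeniusAlgHom F κ) ^ 3,
    FiniteField.finrank_extension F p 3, ?_, fun a => ?_⟩
  · rw [← Nat.card_eq_fintype_card, FiniteField.natCard_extension K p m,
      FiniteField.natCard_extension F p 3, Nat.card_eq_fintype_card, pow_mul]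
  · simp only [pow_succ, pow_zero, one_mul, AlgHom.mul_apply, FiniteField.coe_frobeniusAlgHom,
      pow_mul]

end Fields

section Numerics

/-- Binomial coefficients with a small lower index grow at a small exponential rate. -/
lemma exists_choose_mul_two_pow_le {β : ℝ} (hβ : 0 < β) :
    ∃ ε : ℝ, 0 < ε ∧ ∀ n w : ℕ, (w : ℝ) ≤ ε * n →
      (n.choose w : ℝ) * 2 ^ w ≤ Real.exp (β * n) := by
  obtain ⟨x, hx⟩ : ∃ x, x = β / 2 := ⟨_, rfl⟩
  have hx0 : 0 < x := by rw [hx]; positivity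
  obtain ⟨M, hM⟩ : ∃ M, M = |Real.log (2 / x)| + 1 := ⟨_, rfl⟩
  have hM0 : 0 < M := by rw [hM]; positivity
  refine ⟨β / (2 * M), by positivity, fun n w hw => ?_⟩
  have h1 : (n.choose w : ℝ) * x ^ w ≤ Real.exp (x * n) := by
    by_cases hwn : w ≤ n
    · have h2 : (n.choose w : ℝ) * x ^ w ≤ (x + 1) ^ n := by
        rw [add_pow]
        refine le_trans (le_of_eq ?_) (Finset.single_le_sum
          (f := fun m => x ^ m * 1 ^ (n - m) * (n.choose m : ℝ))
          (fun i _ => by positivity) (Finset.mem_range.mpr (Nat.lt_succ_of_le hwn)))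
        simp [mul_comm]
      refine h2.trans ?_
      rw [mul_comm, Real.exp_nat_mul]
      gcongr
      exact Real.add_one_le_exp x
    · rw [Nat.choose_eq_zero_of_lt (by omega)]
      simp [Real.exp_nonneg]
  have h2 : (2 / x) ^ w ≤ Real.exp (x * n) := by
    rw [← Real.exp_log (show 0 < 2 / x by positivity), ← Real.exp_nat_mul, Real.exp_le_exp]
    calc (w : ℝ) * Real.log (2 / x) ≤ w * M := by
          gcongr
          rw [hM]
          linarith [le_abs_self (Real.log (2 / x))]
      _ ≤ β / (2 * M) * n * M := by gcongr
      _ = x * n := by rw [hx]; field_simp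
  calc (n.choose w : ℝ) * 2 ^ w = (n.choose w * x ^ w) * (2 / x) ^ w := by
        rw [div_pow]; field_simp
    _ ≤ Real.exp (x * n) * Real.exp (x * n) := by gcongr
    _ = Real.exp (β * n) := by rw [← Real.exp_add, hx]; ring_nf

/-- The choice of the parameters of the construction. -/
lemma exists_parameters {ℓ : ℝ} {q : ℕ} (hδ : (q + 4) * ℓ < 1) (hℓ : 0 ≤ ℓ) :
    ∃ ε : ℝ, 0 < ε ∧ ∃ n₀ : ℕ, ∀ n, n₀ ≤ n → ∃ g τ w : ℕ, (n : ℝ) * ℓ ≤ g ∧ 1 ≤ w ∧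
      ε * n ≤ w ∧ w ≤ τ ∧ (q + 4) * g + (q + 8) * τ + w ≤ n ∧
      (n.choose w : ℝ) * 2 ^ w < (4 / 3) ^ τ := by
  obtain ⟨δ, hδ'⟩ : ∃ δ, δ = 1 - (q + 4) * ℓ := ⟨_, rfl⟩
  have hδ0 : 0 < δ := by linarith
  obtain ⟨η, hη⟩ : ∃ η, η = δ / (2 * (q + 9)) := ⟨_, rfl⟩
  have hη0 : 0 < η := by rw [hη]; positivity
  have hηδ : (q + 9) * η = δ / 2 := by rw [hη]; field_simp
  have hL : 0 < Real.log (4 / 3) := Real.log_pos (by norm_num)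
  obtain ⟨ε', hε', hch⟩ := exists_choose_mul_two_pow_le
    (show 0 < η * Real.log (4 / 3) / 4 by positivity)
  obtain ⟨ε, hε⟩ : ∃ ε, ε = min ε' η := ⟨_, rfl⟩
  have hε0 : 0 < ε := by rw [hε]; exact lt_min hε' hη0
  obtain ⟨n₀, hn₀⟩ := exists_nat_ge (2 / η + 2 / ε + 2 * (q + 4) / δ)
  refine ⟨ε / 2, by positivity, n₀, fun n hn => ?_⟩
  have hnr : 2 / η + 2 / ε + 2 * (q + 4) / δ ≤ n := hn₀.trans (by exact_mod_cast hn)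
  have p1 : 0 < 2 / η := by positivity
  have p2 : 0 < 2 / ε := by positivity
  have p3 : 0 ≤ 2 * (q + 4) / δ := by positivity
  have hn0 : (0 : ℝ) < n := by linarith
  have h1 : 2 ≤ η * n := by
    rw [mul_comm, ← div_le_iff₀ hη0]; linarith
  have h2 : 2 ≤ ε * n := by
    rw [mul_comm, ← div_le_iff₀ hε0]; linarith
  have h3 : 2 * (q + 4) ≤ δ * n := by
    rw [mul_comm δ, ← div_le_iff₀ hδ0]; linarith
  have hgl := Nat.le_ceil ((n : ℝ) * ℓ)
  have hgu := Nat.ceil_lt_add_one (show 0 ≤ (n : ℝ) * ℓ by positivity)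
  have hτu := Nat.floor_le (show 0 ≤ η * n by positivity)
  have hτl := Nat.lt_floor_add_one (η * n)
  have hwu := Nat.floor_le (show 0 ≤ ε * n by positivity)
  have hwl := Nat.lt_floor_add_one (ε * n)
  have hwτ : ⌊ε * n⌋₊ ≤ ⌊η * n⌋₊ := by
    gcongr
    rw [hε]; exact min_le_right _ _
  generalize ⌈(n : ℝ) * ℓ⌉₊ = g at *
  generalize ⌊η * n⌋₊ = τ at *
  generalize ⌊ε * n⌋₊ = w at *
  refine ⟨g, τ, w, hgl, ?_, by linarith, hwτ, ?_, ?_⟩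
  · have : (0 : ℝ) < w := by linarith
    exact_mod_cast this
  · have hwτ' : (w : ℝ) ≤ τ := by exact_mod_cast hwτ
    have : ((q : ℝ) + 4) * g + (q + 8) * τ + w ≤ n := by
      calc ((q : ℝ) + 4) * g + (q + 8) * τ + w ≤ (q + 4) * (n * ℓ + 1) + (q + 9) * (η * n) := by
            have : ((q : ℝ) + 4) * g ≤ (q + 4) * (n * ℓ + 1) := by gcongr
            have : ((q : ℝ) + 9) * τ ≤ (q + 9) * (η * n) := by gcongr
            linarith
        _ = (1 - δ) * n + (q + 4) + δ / 2 * n := by rw [← hηδ, hδ']; ring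
        _ ≤ n := by linarith
    exact_mod_cast this
  · refine (hch n w (hwu.trans ?_)).trans_lt ?_
    · gcongr
      rw [hε]; exact min_le_left _ _
    · rw [← Real.exp_log (show (0 : ℝ) < 4 / 3 by norm_num), ← Real.exp_nat_mul, Real.exp_lt_exp,
        Real.exp_log (by norm_num)]
      nlinarith

lemma counting_inequality {q T g τ c : ℕ} (hq : 8 ≤ q)
    (hT : 2 * ((q ^ 3 - 1) * (q ^ 3 - q) * (q ^ 3 - q ^ 2)) ≤ T + q ^ 9)
    (hc : (c : ℝ) < (4 / 3) ^ τ) :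
    (2 * q ^ 2) ^ 3 ≤ T ∧
      (q ^ 3) ^ (g + 2 * τ) * c * ((2 * q ^ 2) ^ 3) ^ (2 * g + 5 * τ) < T ^ (2 * g + 5 * τ) := by
  have h512 : 512 ≤ q ^ 3 := Nat.pow_le_pow_left hq 3
  have hT2 : q ^ 9 ≤ 2 * T := by
    have h8 : 8 * q ^ 2 ≤ q ^ 3 := by nlinarith [Nat.zero_le (q ^ 2)]
    have h64 : 64 * q ≤ q ^ 3 := by nlinarith
    have a1 : 511 * q ^ 3 ≤ 512 * (q ^ 3 - 1) := by omega
    have a2 : 63 * q ^ 3 ≤ 64 * (q ^ 3 - q) := by omega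
    have a3 : 7 * q ^ 3 ≤ 8 * (q ^ 3 - q ^ 2) := by omega
    have := Nat.mul_le_mul (Nat.mul_le_mul a1 a2) a3
    have e1 : 511 * q ^ 3 * (63 * q ^ 3) * (7 * q ^ 3) = 225351 * q ^ 9 := by ring
    have e2 : 512 * (q ^ 3 - 1) * (64 * (q ^ 3 - q)) * (8 * (q ^ 3 - q ^ 2)) =
      262144 * ((q ^ 3 - 1) * (q ^ 3 - q) * (q ^ 3 - q ^ 2)) := by ring
    omega
  have hsq : q ^ 3 * ((2 * q ^ 2) ^ 3) ^ 2 ≤ T ^ 2 := by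
    have h1 : q ^ 18 ≤ 4 * T ^ 2 := by
      calc q ^ 18 = q ^ 9 * q ^ 9 := by ring
        _ ≤ (2 * T) * (2 * T) := Nat.mul_le_mul hT2 hT2
        _ = 4 * T ^ 2 := by ring
    have h2 : 512 * q ^ 15 ≤ q ^ 18 := by
      calc 512 * q ^ 15 ≤ q ^ 3 * q ^ 15 := Nat.mul_le_mul_right _ h512
        _ = q ^ 18 := by ring
    calc q ^ 3 * ((2 * q ^ 2) ^ 3) ^ 2 = 64 * q ^ 15 := by ring
      _ ≤ T ^ 2 := by omega
  have hcq : c < q ^ τ := by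
    have : (c : ℝ) < (q : ℝ) ^ τ := by
      refine hc.trans_le ?_
      gcongr
      have : (8 : ℝ) ≤ q := by exact_mod_cast hq
      linarith
    exact_mod_cast this
  constructor
  · have h1 : 512 * q ^ 6 ≤ q ^ 9 := by
      calc 512 * q ^ 6 ≤ q ^ 3 * q ^ 6 := Nat.mul_le_mul_right _ h512
        _ = q ^ 9 := by ring
    have : (2 * q ^ 2) ^ 3 = 8 * q ^ 6 := by ring
    omega
  · refine lt_of_pow_lt_pow_left₀ 2 (Nat.zero_le _) ?_
    have hq0 : 0 < q := by omega
    have hB : 0 < (2 * q ^ 2) ^ 3 := by positivity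
    generalize (2 * q ^ 2) ^ 3 = B at *
    calc ((q ^ 3) ^ (g + 2 * τ) * c * B ^ (2 * g + 5 * τ)) ^ 2
        < ((q ^ 3) ^ (g + 2 * τ) * q ^ τ * B ^ (2 * g + 5 * τ)) ^ 2 := by gcongr
      _ = q ^ (6 * g + 14 * τ) * (B ^ 2) ^ (2 * g + 5 * τ) := by ring
      _ ≤ q ^ (3 * (2 * g + 5 * τ)) * (B ^ 2) ^ (2 * g + 5 * τ) := by
          refine Nat.mul_le_mul_right _ (Nat.pow_le_pow_right hq0 ?_)
          omega
      _ = (q ^ 3 * B ^ 2) ^ (2 * g + 5 * τ) := by rw [mul_pow, ← pow_mul q]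
      _ ≤ (T ^ 2) ^ (2 * g + 5 * τ) := Nat.pow_le_pow_left hsq _
      _ = (T ^ (2 * g + 5 * τ)) ^ 2 := by rw [← pow_mul, ← pow_mul, mul_comm]

end Numerics

section Family

open Polynomial Module

variable {F : Type} [Field F] [Fintype F]

lemma mul_loss_lt_one (h8 : 8 ≤ Fintype.card F) :
    ((Fintype.card F : ℝ) + 4) * loss F < 1 := by
  have h : (8 : ℝ) ≤ Fintype.card F := by exact_mod_cast h8
  rw [loss]
  generalize (Fintype.card F : ℝ) = q at *
  have h1 : 0 < q - 1 := by linarith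
  have h2 : 0 < q ^ 2 - 1 := by nlinarith
  have e : (1 / (q - 1) + 1 / (q ^ 2 - 1)) / 2 = (q + 2) / (2 * (q ^ 2 - 1)) := by
    field_simp
    ring
  rw [e, ← mul_div_assoc, div_lt_one (by positivity)]
  nlinarith

variable [DecidableEq F]

/-- Codes with good dual and square distances, from admissible parameters. -/
lemma exists_code (h8 : 8 ≤ Fintype.card F) {d n g τ w : ℕ} (hd : 2 ≤ d)
    (hn : n = Fintype.card F ^ (3 * d) - 1) (hg : (n : ℝ) * loss F ≤ g) (hw : 1 ≤ w)
    (hwτ : w ≤ τ)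
    (hsum : (Fintype.card F + 4) * g + (Fintype.card F + 8) * τ + w ≤ n)
    (hch : (n.choose w : ℝ) * 2 ^ w < (4 / 3) ^ τ) :
    ∃ C : Submodule F (Fin (n * 3) → F), (∀ c ∈ dualCode C, c ≠ 0 → w < hammingNorm c) ∧
      ∀ c ∈ codeSq C, c ≠ 0 → w < hammingNorm c := by
  obtain ⟨N, hNi, hN, rfl, h1⟩ := exists_irreducible_natDegree_eq F hd
  have hm : 1 ≤ Fintype.card F ^ N.natDegree - 1 := by
    have := Nat.lt_pow_self (n := N.natDegree) (by omega : 1 < Fintype.card F)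
    omega
  obtain ⟨K, κ, _, _, _, _, _, _, _, σ, h3, hκ, hσ⟩ := exists_finite_tower F hm
  obtain ⟨L, hL⟩ := exists_functionSpaces κ hNi hN (by omega) h1 hκ hn hg σ hσ
  have hcard : Fintype.card (Fin n) = n := Fintype.card_fin n
  obtain ⟨q, hq⟩ : ∃ q, q = Fintype.card F := ⟨_, rfl⟩
  have hsum' : q * g + 4 * g + (q * τ + 8 * τ) + w ≤ n := by
    rw [hq]; linarith
  have hz : (q + 1) * (g + τ) = q * g + q * τ + g + τ := by ring
  have hz' : (q + 1) * τ = q * τ + τ := by ring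
  have hτ' : (n.choose w : ℝ) * 2 ^ w * (3 / 4) ^ τ < 1 := by
    calc (n.choose w : ℝ) * 2 ^ w * (3 / 4) ^ τ < (4 / 3) ^ τ * (3 / 4) ^ τ := by gcongr
      _ = 1 := by rw [← mul_pow]; norm_num
  have hc : (n.choose w : ℝ) < (4 / 3) ^ τ := by
    refine lt_of_le_of_lt ?_ hch
    exact le_mul_of_one_le_right (by positivity) (one_le_pow₀ (by norm_num))
  obtain ⟨C, H₀, H₁, hC, hCσ, hH₀, hH₁, hD₀, hD₁, hZ₀, hZ₁⟩ := hL.exists_codes w τ q hw (by omega)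
    (by omega) (by omega) (by rwa [hcard])
  classical
  obtain ⟨hB, hnum⟩ := counting_inequality (g := g) h8 (card_goodTriples h3) hc
  obtain ⟨D, hD, hDs⟩ := exists_expanded_code (F := F) (K := K) h3 C H₀ H₁ w w (g + 2 * τ)
    (q * g + (q + 1) * τ) (2 * (g + τ)) ((q + 1) * (g + τ)) (2 * g + 5 * τ) (by omega) (by omega)
    hC (fun c hc => by
      have := hCσ c hc
      simpa only [card_eq_of_finrank_three h3, AlgHom.coe_toRingHom, hσ] using this)
    hH₀ (hq ▸ hH₁) hD₀ hD₁ hZ₀ hZ₁ (by omega) hB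
    (by rwa [hcard, card_eq_of_finrank_three h3])
  refine exists_code_of_equiv finProdFinEquiv.symm D (fun y hy hyD => ?_) (fun z hz hz0 => ?_)
  · convert hD y hy hyD
  · have := hDs z hz hz0
    rcases this with h | h
    · rw [hcard] at h
      refine lt_of_lt_of_le ?_ (le_of_eq (show hammingNorm z = _ from by congr))
      omega
    · convert h

end Family

theorem stmt3 (q : ℕ) (hq : q = 8 ∨ q = 9 ∨ (IsPrimePow q ∧ 16 ≤ q))
    (F : Type) [Field F] [Fintype F] [DecidableEq F] (hF : Fintype.card F = q) :
    ∃ (n : ℕ → ℕ) (C : ∀ j, Submodule F (Fin (n j) → F)) (ε : ℝ),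
      0 < ε ∧ Tendsto n atTop atTop ∧
      ∀ j,
        ε * (n j : ℝ) ≤ (Module.finrank F (C j) : ℝ) ∧
        (∀ c ∈ C j, c ≠ 0 → ε * (n j : ℝ) ≤ (hammingNorm c : ℝ)) ∧
        ε * (n j : ℝ) ≤ (Module.finrank F (dualCode (C j)) : ℝ) ∧
        (∀ c ∈ dualCode (C j), c ≠ 0 → ε * (n j : ℝ) ≤ (hammingNorm c : ℝ)) ∧
        ε * (n j : ℝ) ≤ (Module.finrank F (codeSq (C j)) : ℝ) ∧
        (∀ c ∈ codeSq (C j), c ≠ 0 → ε * (n j : ℝ) ≤ (hammingNorm c : ℝ)) := by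
  have h8 : 8 ≤ Fintype.card F := by omega
  obtain ⟨ε, hε, n₀, hpar⟩ := exists_parameters (mul_loss_lt_one h8) (loss_nonneg F)
  have hlen : ∀ j, n₀ + 2 + j ≤ Fintype.card F ^ (3 * (n₀ + 2 + j)) - 1 := by
    intro j
    have h1 : 3 * (n₀ + 2 + j) < Fintype.card F ^ (3 * (n₀ + 2 + j)) :=
      Nat.lt_pow_self (by omega)
    omega
  have hcode : ∀ j, ∃ C : Submodule F (Fin ((Fintype.card F ^ (3 * (n₀ + 2 + j)) - 1) * 3) → F),
      ∃ w : ℕ, 1 ≤ w ∧ w ≤ (Fintype.card F ^ (3 * (n₀ + 2 + j)) - 1) * 3 ∧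
        ε / 3 * ((Fintype.card F ^ (3 * (n₀ + 2 + j)) - 1) * 3 : ℕ) ≤ w ∧
        (∀ c ∈ dualCode C, c ≠ 0 → w < hammingNorm c) ∧
        ∀ c ∈ codeSq C, c ≠ 0 → w < hammingNorm c := by
    intro j
    obtain ⟨g, τ, w, hg, hw, hεw, hwτ, hsum, hch⟩ := hpar _ ((by omega : n₀ ≤ n₀ + 2 + j).trans
      (hlen j))
    obtain ⟨C, hC⟩ := exists_code h8 (by omega) rfl hg hw hwτ hsum hch
    refine ⟨C, w, hw, by omega, ?_, hC⟩
    push_cast at hεw ⊢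
    linarith
  choose C w hw hwn hεw hd hs using hcode
  refine ⟨_, C, ε / 3, by positivity, ?_, fun j => ?_⟩
  · refine tendsto_atTop_mono (fun j => ?_) tendsto_id
    have := hlen j
    simp only [id]
    omega
  · obtain ⟨h1, h2, h3, h4, h5, h6⟩ := code_parameters (hw j) (hwn j) (hd j) (hs j)
    have key : ∀ m : ℕ, w j ≤ m →
        ε / 3 * ((Fintype.card F ^ (3 * (n₀ + 2 + j)) - 1) * 3 : ℕ) ≤ (m : ℝ) :=
      fun m hm => (hεw j).trans (by exact_mod_cast hm)
    exact ⟨key _ h1, fun c hc h0 => key _ (h2 c hc h0), key _ h3,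
      fun c hc h0 => key _ (h4 c hc h0), key _ h5, fun c hc h0 => key _ (h6 c hc h0)⟩
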